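/- Let X be a non-empty subshift of edge-to-edge rhombus tilings on a finite shapeset 𝒯. Then Domino(X) — given a finite 𝒯-tileset 𝐓, decide whether there exists a valid 𝐓-tiling x with π(x) ∈ X — is Π⁰₁-hard, and therefore undecidable. -/

import Mathlib

open Set Metric

noncomputable section

/-- Points of the euclidean plane. -/
abbrev Pt : Type := EuclideanSpace ℝ (Fin 2)

/-- A rhombus tile in the plane, given by a position (a distinguished vertex)
and its two edge vectors. -/
structure Rhombus where
  pos : Pt
  u : Pt
  v : Pt

namespace Rhombus

/-- A genuine rhombus: linearly independent edge vectors of equal euclidean length. -/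
def IsValid (r : Rhombus) : Prop :=
  LinearIndependent ℝ ![r.u, r.v] ∧ ‖r.u‖ = ‖r.v‖

/-- The support of a rhombus: the closed parallelogram it spans. -/
def support (r : Rhombus) : Set Pt :=
  {x | ∃ s t : ℝ, s ∈ Icc (0 : ℝ) 1 ∧ t ∈ Icc (0 : ℝ) 1 ∧ x = r.pos + s • r.u + t • r.v}

/-- The four vertices of a rhombus. -/
def vertices (r : Rhombus) : Set Pt :=
  {r.pos, r.pos + r.u, r.pos + r.v, r.pos + r.u + r.v}

/-- The four (closed) edges of a rhombus, indexed as in the paper: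
edge `0` from `pos` to `pos + u`, edge `1` from `pos + u` to `pos + u + v`,
edge `2` from `pos + u + v` to `pos + v`, edge `3` from `pos + v` to `pos`. -/
def edge (r : Rhombus) : Fin 4 → Set Pt :=
  ![segment ℝ r.pos (r.pos + r.u),
    segment ℝ (r.pos + r.u) (r.pos + r.u + r.v),
    segment ℝ (r.pos + r.u + r.v) (r.pos + r.v),
    segment ℝ (r.pos + r.v) r.pos]

/-- The set of edges of a rhombus. -/
def edges (r : Rhombus) : Set (Set Pt) := Set.range r.edge

/-- Translation of a rhombus by a vector. -/
def translate (r : Rhombus) (w : Pt) : Rhombus := ⟨r.pos + w, r.u, r.v⟩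

/-- The center of a rhombus. -/
def center (r : Rhombus) : Pt := r.pos + (2⁻¹ : ℝ) • r.u + (2⁻¹ : ℝ) • r.v

/-- Two rhombi are translates of each other (same shape up to translation). -/
def SameShape (r s : Rhombus) : Prop := r.u = s.u ∧ r.v = s.v

/-- `w` is one of the two edge directions of `r` (up to sign). -/
def HasEdgeDir (r : Rhombus) (w : Pt) : Prop :=
  r.u = w ∨ r.u = -w ∨ r.v = w ∨ r.v = -w

end Rhombus

/-- Two rhombi are in edge-to-edge position: they are disjoint, share exactly one
common vertex, or share exactly one full common edge. -/
def EdgeToEdgePair (r s : Rhombus) : Prop :=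
  r.support ∩ s.support = ∅ ∨
  (∃ p, p ∈ r.vertices ∧ p ∈ s.vertices ∧ r.support ∩ s.support = {p}) ∨
  (∃ e, e ∈ r.edges ∧ e ∈ s.edges ∧ r.support ∩ s.support = e)

/-- An edge-to-edge rhombus tiling of the plane: a covering of the plane
without overlap where any two tiles are disjoint, share exactly one vertex or
share a full common edge. -/
def IsTiling (x : Set Rhombus) : Prop :=
  (∀ r ∈ x, r.IsValid) ∧
  (⋃ r ∈ x, r.support) = univ ∧
  ∀ r ∈ x, ∀ s ∈ x, r ≠ s → EdgeToEdgePair r s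

/-- Every tile of `x` is a translate of a shape of the shapeset `T`. -/
def UsesShapes (T : Set Rhombus) (x : Set Rhombus) : Prop :=
  ∀ r ∈ x, ∃ s ∈ T, r.SameShape s

/-- An edge-to-edge tiling whose tiles are translates of shapes of `T`. -/
def IsTilingOn (T : Set Rhombus) (x : Set Rhombus) : Prop :=
  IsTiling x ∧ UsesShapes T x

/-- Support of a patch. -/
def PatchSupport (P : Set Rhombus) : Set Pt := ⋃ r ∈ P, r.support

/-- A patch: a finite nonempty edge-to-edge set of rhombi whose support is
simply connected (no holes). -/
def IsPatch (P : Set Rhombus) : Prop :=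
  P.Finite ∧ P.Nonempty ∧ (∀ r ∈ P, r.IsValid) ∧
  (∀ r ∈ P, ∀ s ∈ P, r ≠ s → EdgeToEdgePair r s) ∧
  SimplyConnectedSpace (PatchSupport P)

/-- Translation of a set of rhombi. -/
def translatePatch (P : Set Rhombus) (w : Pt) : Set Rhombus :=
  (fun r => r.translate w) '' P

/-- The pattern `f` appears in `x`: some translate of `f` is a sub-collection of `x`. -/
def Appears (f : Set Rhombus) (x : Set Rhombus) : Prop :=
  ∃ w : Pt, translatePatch f w ⊆ x

/-- Vertices of a patch. -/
def PatchVertices (P : Set Rhombus) : Set Pt := ⋃ r ∈ P, r.vertices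

/-- The support of `P` contains a disk of radius `ρ` centered at a vertex of `P`. -/
def HasRadius (P : Set Rhombus) (ρ : ℝ) : Prop :=
  ∃ c ∈ PatchVertices P, closedBall c ρ ⊆ PatchSupport P

/-- `P` has minimal radius `ρ`: its support contains a disk of radius `ρ` centered
at one of its vertices, and removing any tile breaks this property. -/
def MinimalRadius (P : Set Rhombus) (ρ : ℝ) : Prop :=
  HasRadius P ρ ∧ ∀ r ∈ P, ¬ HasRadius (P \ {r}) ρ

/-- A rhombus Wang tile: a rhombus with a colour (a natural number) on each edge. -/
structure ColoredRhombus where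
  shape : Rhombus
  color : Fin 4 → ℕ

namespace ColoredRhombus

def translate (t : ColoredRhombus) (w : Pt) : ColoredRhombus :=
  ⟨t.shape.translate w, t.color⟩

/-- Two coloured tiles are equal up to translation. -/
def SameTile (t s : ColoredRhombus) : Prop :=
  t.shape.SameShape s.shape ∧ t.color = s.color

end ColoredRhombus

/-- The colour-erasing operator `π`. -/
def eraseColors (x : Set ColoredRhombus) : Set Rhombus := ColoredRhombus.shape '' x

def translateColoredPatch (P : Set ColoredRhombus) (w : Pt) : Set ColoredRhombus :=
  (fun t => t.translate w) '' P

/-- Any two tiles sharing an edge carry the same colour on the shared edge. -/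
def ColorMatching (x : Set ColoredRhombus) : Prop :=
  ∀ t ∈ x, ∀ s ∈ x, t.shape ≠ s.shape →
    ∀ i j : Fin 4, t.shape.edge i = s.shape.edge j → t.color i = s.color j

/-- No two distinct coloured tiles occupy the same rhombus. -/
def ShapeInjective (x : Set ColoredRhombus) : Prop :=
  ∀ t ∈ x, ∀ s ∈ x, t.shape = s.shape → t = s

/-- A valid tiling by rhombus Wang tiles. -/
def IsColoredTiling (x : Set ColoredRhombus) : Prop :=
  IsTiling (eraseColors x) ∧ ShapeInjective x ∧ ColorMatching x

/-- A valid patch of rhombus Wang tiles. -/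
def IsColoredPatch (x : Set ColoredRhombus) : Prop :=
  IsPatch (eraseColors x) ∧ ShapeInjective x ∧ ColorMatching x

/-- All tiles of `x` are translates of tiles of the tileset `T`. -/
def TilesFrom (T : Set ColoredRhombus) (x : Set ColoredRhombus) : Prop :=
  ∀ t ∈ x, ∃ s ∈ T, t.SameTile s

/-- A subshift on the shapeset `T`: a set of `T`-tilings that is invariant under
translation and closed for the tiling topology (a tiling all of whose finite
patterns appear in tilings of `X` belongs to `X`). -/
def IsSubshift (T : Set Rhombus) (X : Set (Set Rhombus)) : Prop :=
  (∀ x ∈ X, IsTilingOn T x) ∧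
  (∀ x ∈ X, ∀ w : Pt, translatePatch x w ∈ X) ∧
  (∀ x, IsTilingOn T x →
    (∀ P, P ⊆ x → P.Finite → P.Nonempty → ∃ y ∈ X, Appears P y) → x ∈ X)

/-- The shape `r` is uniformly recurrent in the tiling `x`: for some `R > 0`,
every disk of radius `R` contains an occurrence (a translate) of `r`. -/
def UniformlyRecurrentIn (r : Rhombus) (x : Set Rhombus) : Prop :=
  ∃ R : ℝ, 0 < R ∧ ∀ p : Pt, ∃ s ∈ x, s.SameShape r ∧ s.support ⊆ closedBall p R

/-- A shape uniformly recurrent subshift: every shape appearing somewhere in `X`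
is uniformly recurrent in every tiling of `X`. -/
def ShapeUniformlyRecurrent (X : Set (Set Rhombus)) : Prop :=
  ∀ r : Rhombus, (∃ y ∈ X, ∃ s ∈ y, s.SameShape r) →
    ∀ x ∈ X, UniformlyRecurrentIn r x

/-- The restriction of `X` to the tilings using only shapes of `T'`. -/
def restrictShapes (T' : Set Rhombus) (X : Set (Set Rhombus)) : Set (Set Rhombus) :=
  {x ∈ X | UsesShapes T' x}

/-- The subshift on `T` defined by the sequence `F` of forbidden patterns. -/
def SubshiftOfForbidden (T : Set Rhombus) (F : ℕ → Set Rhombus) : Set (Set Rhombus) :=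
  {x | IsTilingOn T x ∧ ∀ n : ℕ, ¬ Appears (F n) x}

/-- A chain of rhombuses of normal vector `w` in the tiling `x`: a bi-infinite
sequence of tiles in which any two consecutive tiles share a full common edge of
direction `w`, the chain crossing each of its tiles from one of its two
`w`-edges to the other one. -/
structure Chain (x : Set Rhombus) (w : Pt) where
  seq : ℤ → Rhombus
  mem : ∀ n : ℤ, seq n ∈ x
  shares : ∀ n : ℤ, ∃ a : Pt,
    segment ℝ a (a + w) ∈ (seq n).edges ∧
    segment ℝ a (a + w) ∈ (seq (n + 1)).edges ∧
    (seq n).support ∩ (seq (n + 1)).support = segment ℝ a (a + w)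
  progress : ∀ n : ℤ,
    (seq (n - 1)).support ∩ (seq n).support ≠ (seq n).support ∩ (seq (n + 1)).support

/-- The set of tiles of a chain. -/
def Chain.tiles {x : Set Rhombus} {w : Pt} (c : Chain x w) : Set Rhombus :=
  Set.range c.seq

/-- A symbolic Wang tile on the shapeset indexed by `Fin k`: a shape index
together with the four edge colours `(a₀, a₁, a₂, a₃)`. -/
abbrev SymbTile (k : ℕ) : Type := Fin k × ℕ × ℕ × ℕ × ℕ

/-- The colours of a symbolic tile, as a function on edge indices. -/
def SymbTile.colors {k : ℕ} (t : SymbTile k) : Fin 4 → ℕ :=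
  ![t.2.1, t.2.2.1, t.2.2.2.1, t.2.2.2.2]

/-- The geometric coloured tile `t` is a translate of the symbolic tile `p`. -/
def Realizes {k : ℕ} (shapes : Fin k → Rhombus) (t : ColoredRhombus) (p : SymbTile k) :
    Prop :=
  t.shape.SameShape (shapes p.1) ∧ t.color = SymbTile.colors p

/-- The Domino problem on the subshift `X`: given a tileset `T`, decide whether
there is a valid tiling by translates of tiles of `T` whose colour-erased image
belongs to `X`. -/
def DominoPred {k : ℕ} (shapes : Fin k → Rhombus) (X : Set (Set Rhombus))
    (T : List (SymbTile k)) : Prop :=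
  ∃ x : Set ColoredRhombus, IsColoredTiling x ∧
    (∀ t ∈ x, ∃ p ∈ T, Realizes shapes t p) ∧ eraseColors x ∈ X

/-- A displacement code: a formal integer combination of edge vectors of the shapes. -/
abbrev Disp (k : ℕ) : Type := List (Fin k × ℤ × ℤ)

/-- The vector coded by a displacement code. -/
def dispVec {k : ℕ} (shapes : Fin k → Rhombus) (d : Disp k) : Pt :=
  (d.map (fun e => (e.2.1 : ℝ) • (shapes e.1).u + (e.2.2 : ℝ) • (shapes e.1).v)).sum

/-- A code for a pattern of (uncoloured) shapes: each entry is a shape index and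
the displacement of the corresponding tile. -/
abbrev PatternCode (k : ℕ) : Type := List (Fin k × Disp k)

/-- The pattern coded by a pattern code. -/
def decodePattern {k : ℕ} (shapes : Fin k → Rhombus) (c : PatternCode k) : Set Rhombus :=
  {r | ∃ e ∈ c, r = (shapes e.1).translate (dispVec shapes e.2)}

/-- A code for a pattern of coloured tiles. -/
abbrev ColoredCode (k : ℕ) : Type := List (SymbTile k × Disp k)

/-- The coloured pattern coded by a coloured pattern code. -/
def decodeColored {k : ℕ} (shapes : Fin k → Rhombus) (c : ColoredCode k) :
    Set ColoredRhombus :=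
  {t | ∃ e ∈ c,
    t = ColoredRhombus.mk ((shapes e.1.1).translate (dispVec shapes e.2))
          (SymbTile.colors e.1)}

/-- A decision problem is `Π⁰₁` (co-computably enumerable): there is a total
computable `f` such that `A x ↔ ∀ n, f x n = true`. -/
def Pi01 {α : Type} [Primcodable α] (A : α → Prop) : Prop :=
  ∃ f : α → ℕ → Bool, Computable₂ f ∧ ∀ a, A a ↔ ∀ n : ℕ, f a n = true

/-- A decision problem is `Π⁰₁`-hard: every `Π⁰₁` problem many-one reduces to it. -/
def Pi01Hard {α : Type} [Primcodable α] (A : α → Prop) : Prop :=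
  ∀ (β : Type) [Primcodable β], ∀ B : β → Prop, Pi01 B → ManyOneReducible B A

/-- A square Wang tile, as `(west, east, south, north)`. -/
abbrev WT : Type := ℕ × ℕ × ℕ × ℕ

/-- The Wang tileset `W` tiles `ℤ²`. -/
def TilesZ (W : List WT) : Prop :=
  ∃ t : ℤ → ℤ → WT, (∀ i j, t i j ∈ W) ∧ (∀ i j, (t i j).2.1 = (t (i + 1) j).1) ∧
    (∀ i j, (t i j).2.2.2 = (t i (j + 1)).2.2.1)

/-- The Wang tileset `W` tiles an `n × n` square. -/
def TilesSq (W : List WT) (n : ℕ) : Prop :=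
  ∃ t : ℕ → ℕ → WT, (∀ i j, i < n → j < n → t i j ∈ W) ∧
    (∀ i j, i + 1 < n → j < n → (t i j).2.1 = (t (i + 1) j).1) ∧
    (∀ i j, i < n → j + 1 < n → (t i j).2.2.2 = (t i (j + 1)).2.2.1)

/-- The Wang tileset `W` tiles a quadrant with zero boundary. -/
def QuadAll (W : List WT) : Prop :=
  ∃ t : ℕ → ℕ → WT, (∀ i j, t i j ∈ W) ∧ (∀ i j, (t i j).2.1 = (t (i + 1) j).1) ∧
    (∀ i j, (t i j).2.2.2 = (t i (j + 1)).2.2.1) ∧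
    (∀ j, (t 0 j).1 = 0) ∧ (∀ i, (t i 0).2.2.1 = 0)

/-- The Wang tileset `W` tiles an `m × m` square with zero boundary on the left and bottom. -/
def QuadSq (W : List WT) (m : ℕ) : Prop :=
  ∃ t : ℕ → ℕ → WT, (∀ i j, i < m → j < m → t i j ∈ W) ∧
    (∀ i j, i + 1 < m → j < m → (t i j).2.1 = (t (i + 1) j).1) ∧
    (∀ i j, i < m → j + 1 < m → (t i j).2.2.2 = (t i (j + 1)).2.2.1) ∧
    (∀ j, j < m → (t 0 j).1 = 0) ∧ (∀ i, i < m → (t i 0).2.2.1 = 0)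

/-- Limit of a sequence with values eventually in a finite list, along an ultrafilter. -/
theorem exists_ultra_limit {α : Type} (l : List α) (U : Ultrafilter ℕ) (f : ℕ → α)
    (h : ∀ᶠ n in (U : Filter ℕ), f n ∈ l) : ∃ a ∈ l, ∀ᶠ n in (U : Filter ℕ), f n = a := by
  induction l with
  | nil => exact absurd (by simpa using h) (by simp [Filter.NeBot.ne])
  | cons a l ih =>
    have h' : ∀ᶠ n in (U : Filter ℕ), f n = a ∨ f n ∈ l := by simpa using h
    rcases Ultrafilter.eventually_or.1 h' with h1 | h1
    · exact ⟨a, by simp, h1⟩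
    · obtain ⟨b, hb, hb'⟩ := ih h1
      exact ⟨b, by simp [hb], hb'⟩

theorem tilesZ_of_sq (W : List WT) (h : ∀ n, TilesSq W n) : TilesZ W := by
  choose t ht h1 h2 using h
  let U : Ultrafilter ℕ := Filter.hyperfilter ℕ
  have hU : ∀ N : ℕ, ∀ᶠ n in (U : Filter ℕ), N ≤ n := by
    intro N
    have : ∀ᶠ n in Filter.atTop, N ≤ n := Filter.eventually_ge_atTop N
    rw [← Nat.cofinite_eq_atTop] at this
    exact Filter.hyperfilter_le_cofinite this
  let f : ℤ → ℤ → ℕ → WT := fun i j n => t (2 * n + 1) (i + n).toNat (j + n).toNat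
  have hf : ∀ i j, ∀ᶠ n in (U : Filter ℕ), f i j n ∈ W := by
    intro i j
    filter_upwards [hU (i.natAbs + j.natAbs)] with n hn
    exact ht _ _ _ (by omega) (by omega)
  choose g hg hg' using fun i j => exists_ultra_limit W U (f i j) (hf i j)
  refine ⟨g, hg, fun i j => ?_, fun i j => ?_⟩
  · obtain ⟨n, hn1, hn2, hn3⟩ := ((hg' i j).and ((hg' (i + 1) j).and
      (hU (i.natAbs + j.natAbs + 1)))).exists
    rw [← hn1, ← hn2]
    have e : (i + 1 + n).toNat = (i + n).toNat + 1 := by omega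
    show _ = (t _ (i + 1 + n).toNat _).1
    rw [e]
    exact h1 _ _ _ (by omega) (by omega)
  · obtain ⟨n, hn1, hn2, hn3⟩ := ((hg' i j).and ((hg' i (j + 1)).and
      (hU (i.natAbs + j.natAbs + 1)))).exists
    rw [← hn1, ← hn2]
    have e : (j + 1 + n).toNat = (j + n).toNat + 1 := by omega
    show _ = (t _ _ (j + 1 + n).toNat).2.2.1
    rw [e]
    exact h2 _ _ _ (by omega) (by omega)

/-! ### The hierarchical layer -/

/-- Structural part of an edge: two phase bits, orientation bit, colour bit. -/
abbrev TE : Type := Bool × Bool × Bool × Bool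

abbrev TE.hi (e : TE) : Bool := e.1
abbrev TE.lo (e : TE) : Bool := e.2.1
abbrev TE.b (e : TE) : Bool := e.2.2.1
abbrev TE.k (e : TE) : Bool := e.2.2.2

/-- Corner cell. -/
def BX (w e s n : TE) : Prop :=
  w.lo = false ∧ e.lo = true ∧ e.hi = w.hi ∧ s.lo = false ∧ n.lo = true ∧ n.hi = s.hi ∧
  w.b = s.hi ∧ e.b = s.hi ∧ s.b = w.hi ∧ n.b = w.hi ∧ e.k = w.k ∧ s.k = w.k ∧ n.k = w.k

/-- Crossing cell whose horizontal line has the finer level. -/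
def BV (w e s n : TE) : Prop :=
  w.lo = true ∧ e.lo = false ∧ e.hi = !w.hi ∧ e.b = w.b ∧ e.k = w.k ∧ s = n ∧
  (w.hi = false → s.k = (!w.k) ∧ s.lo = w.b)

/-- Structural rule. -/
def BT (w e s n : TE) : Prop := BX w e s n ∨ BV w e s n ∨ BV s n w e

theorem BX.symm {w e s n : TE} (h : BX w e s n) : BX s n w e := by
  obtain ⟨h1, h2, h3, h4, h5, h6, h7, h8, h9, h10, h11, h12, h13⟩ := h
  refine ⟨h4, h5, h6, h1, h2, h3, h9, h10, h7, h8, ?_, h12.symm, ?_⟩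
  · rw [h13, h12]
  · rw [h11, h12]

theorem BT.symm {w e s n : TE} (h : BT w e s n) : BT s n w e := by
  rcases h with h | h | h
  · exact Or.inl h.symm
  · exact Or.inr (Or.inr h)
  · exact Or.inr (Or.inl h)

/-- A whole plane obeying the structural rule. -/
def BTAll (h v : ℤ → ℤ → TE) : Prop :=
  ∀ i j, BT (h i (j + 1)) (h (i + 1) (j + 1)) (v (i + 1) j) (v (i + 1) (j + 1))

/-- All odd-odd cells are corners of colour `κ`. -/
def XX (κ : Bool) (h v : ℤ → ℤ → TE) : Prop :=
  ∀ i j, BX (h (2 * i) (2 * j + 1)) (h (2 * i + 1) (2 * j + 1)) (v (2 * i + 1) (2 * j))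
    (v (2 * i + 1) (2 * j + 1)) ∧ (h (2 * i) (2 * j + 1)).k = κ

/-- Transposition. -/
abbrev trp {α : Type} (h : ℤ → ℤ → α) : ℤ → ℤ → α := fun i j => h j i

theorem BTAll.symm {h v : ℤ → ℤ → TE} (H : BTAll h v) : BTAll (trp v) (trp h) :=
  fun i j => (H j i).symm

theorem XX.symm {κ : Bool} {h v : ℤ → ℤ → TE} (H : XX κ h v) : XX κ (trp v) (trp h) := by
  intro i j
  refine ⟨(H j i).1.symm, ?_⟩
  have := H j i
  rw [← this.2]
  exact this.1.2.2.2.2.2.2.2.2.2.2.2.1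

theorem XX.vv {κ : Bool} {h v : ℤ → ℤ → TE} (H : XX κ h v) (hB : BTAll h v) (i j : ℤ) :
    BV (h (2 * i + 1) (2 * j + 1)) (h (2 * i + 2) (2 * j + 1)) (v (2 * i + 2) (2 * j))
      (v (2 * i + 2) (2 * j + 1)) := by
  have h1 := (H i j).1
  have h2 := (H (i + 1) j).1
  have h3 := hB (2 * i + 1) (2 * j)
  rw [show 2 * (i + 1) = 2 * i + 2 by ring] at h2
  rw [show 2 * i + 1 + 1 = 2 * i + 2 by ring] at h3
  have a1 : (h (2 * i + 1) (2 * j + 1)).lo = true := h1.2.1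
  have a2 : (h (2 * i + 2) (2 * j + 1)).lo = false := h2.1
  rcases h3 with h3 | h3 | h3
  · rw [h3.1] at a1; simp at a1
  · exact h3
  · rw [h3.2.2.2.2.2.1, a2] at a1; simp at a1

theorem bool_alt (a : ℤ → Bool) (h : ∀ i, a (i + 1) = !a i) (h0 : a 0 = false) (i : ℤ) :
    a i = decide (i % 2 = 1) := by
  have key : ∀ i, a (i + 2) = a i := by
    intro i
    rw [show i + 2 = i + 1 + 1 by ring, h, h, Bool.not_not]
  have k2 : ∀ n : ℕ, ∀ i, a (i + 2 * n) = a i := by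
    intro n
    induction n with
    | zero => simp
    | succ n ih =>
      intro i
      rw [show i + 2 * ((n + 1 : ℕ) : ℤ) = (i + 2 * n) + 2 by push_cast; ring, key, ih]
  have k3 : ∀ q : ℤ, a (2 * q) = false := by
    intro q
    rcases Int.le_total 0 q with hq | hq
    · have := k2 q.toNat 0
      rw [Int.toNat_of_nonneg hq] at this
      simpa [h0] using this
    · have := k2 (-q).toNat (2 * q)
      rw [Int.toNat_of_nonneg (by omega)] at this
      rw [← this, ← h0]
      congr 1; ring
  rcases Int.emod_two_eq_zero_or_one i with hi | hi
  · rw [show i = 2 * (i / 2) by omega, k3]; simp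
  · rw [show i = 2 * (i / 2) + 1 by omega, h, k3]; simp

/-- Normalised position. -/
def Nrm (h v : ℤ → ℤ → TE) : Prop :=
  ∀ i j, (h (2 * i) (2 * j + 1)).hi = decide (i % 2 = 1) ∧
    (v (2 * i + 1) (2 * j)).hi = decide (j % 2 = 1)

theorem XX.hi_step {κ : Bool} {h v : ℤ → ℤ → TE} (H : XX κ h v) (hB : BTAll h v) (i j : ℤ) :
    (h (2 * (i + 1)) (2 * j + 1)).hi = !(h (2 * i) (2 * j + 1)).hi := by
  have h1 := (H.vv hB i j).2.2.1
  rw [show 2 * (i + 1) = 2 * i + 2 by ring, h1, (H i j).1.2.2.1]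

theorem XX.hi_const {κ : Bool} {h v : ℤ → ℤ → TE} (H : XX κ h v) (hB : BTAll h v) (i j : ℤ) :
    (h (2 * i) (2 * (j + 1) + 1)).hi = (h (2 * i) (2 * j + 1)).hi := by
  have h1 := (H.symm.vv hB.symm j i).2.2.2.1
  have h2 := (H i (j + 1)).1.2.2.2.2.2.2.2.2.1
  have h3 := (H i j).1.2.2.2.2.2.2.2.2.2.1
  rw [← h2, ← h3, show 2 * (j + 1) = 2 * j + 2 by ring]
  exact h1

theorem int_const_of_step {α : Type} (a : ℤ → α) (h : ∀ i, a (i + 1) = a i) (i : ℤ) :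
    a i = a 0 := by
  induction i using Int.induction_on with
  | zero => rfl
  | succ i ih => rw [h, ih]
  | pred i ih => rw [← ih, ← h]; congr 1; ring

theorem XX.nrm {κ : Bool} {h v : ℤ → ℤ → TE} (H : XX κ h v) (hB : BTAll h v)
    (h1 : (h 0 1).hi = false) (h2 : (v 1 0).hi = false) : Nrm h v := by
  have key : ∀ {h v : ℤ → ℤ → TE}, XX κ h v → BTAll h v → (h 0 1).hi = false →
      ∀ i j, (h (2 * i) (2 * j + 1)).hi = decide (i % 2 = 1) := by
    intro h v H hB h1 i j
    have e1 := int_const_of_step (fun j => (h (2 * i) (2 * j + 1)).hi)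
      (fun j => H.hi_const hB i j) j
    have e2 := bool_alt (fun i => (h (2 * i) (2 * 0 + 1)).hi) (fun i => H.hi_step hB i 0)
      (by simpa using h1) i
    exact e1.trans e2
  intro i j
  exact ⟨key H hB h1 i j, key H.symm hB.symm h2 j i⟩

/-- Model value of an edge of level `m`. -/
def mdl (κ : Bool) (m : ℕ) (X y : ℤ) : TE :=
  (decide (X / 2 ^ m / 2 % 2 = 1), decide (X / 2 ^ m % 2 = 1), decide (y % 2 = 1),
    xor κ (decide (m % 2 = 1)))

theorem Nrm.level_zero {κ : Bool} {h v : ℤ → ℤ → TE} (H : XX κ h v)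
    (hN : Nrm h v) (X y : ℤ) : h X (2 * y + 1) = mdl κ 0 X y := by
  have hb : ∀ i, (h (2 * i) (2 * y + 1)).b = decide (y % 2 = 1) := fun i => by
    rw [← (hN i y).2]; exact (H i y).1.2.2.2.2.2.2.1
  have hb2 : ∀ i, (h (2 * i + 1) (2 * y + 1)).b = decide (y % 2 = 1) := fun i => by
    rw [← (hN i y).2]; exact (H i y).1.2.2.2.2.2.2.2.1
  have hk2 : ∀ i, (h (2 * i + 1) (2 * y + 1)).k = κ := fun i => by
    rw [← (H i y).2]; exact (H i y).1.2.2.2.2.2.2.2.2.2.2.1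
  have hh2 : ∀ i, (h (2 * i + 1) (2 * y + 1)).hi = decide (i % 2 = 1) := fun i => by
    rw [← (hN i y).1]; exact (H i y).1.2.2.1
  rcases Int.emod_two_eq_zero_or_one X with hi | hi
  · obtain ⟨i, rfl⟩ : ∃ i, X = 2 * i := ⟨X / 2, by omega⟩
    refine Prod.ext ?_ (Prod.ext ?_ (Prod.ext ?_ ?_))
    · simpa [mdl] using (hN i y).1
    · simpa [mdl] using (H i y).1.1
    · simpa [mdl] using hb i
    · simpa [mdl] using (H i y).2
  · obtain ⟨i, rfl⟩ : ∃ i, X = 2 * i + 1 := ⟨X / 2, by omega⟩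
    have e : (2 * i + 1) / 2 = i := by omega
    have e' : (2 * i + 1) % 2 = 1 := by omega
    refine Prod.ext ?_ (Prod.ext ?_ (Prod.ext ?_ ?_))
    · simpa [mdl, e] using hh2 i
    · simpa [mdl, e'] using (H i y).1.2.1
    · simpa [mdl] using hb2 i
    · simpa [mdl] using hk2 i

/-- Subsampling. -/
abbrev subs (h : ℤ → ℤ → TE) : ℤ → ℤ → TE := fun i j => h (2 * i) (2 * j)

theorem XX.pass {κ : Bool} {h v : ℤ → ℤ → TE} (H : XX κ h v) (hB : BTAll h v) (i j : ℤ) :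
    h (2 * i + 1) (2 * j) = h (2 * i) (2 * j) := by
  have := (H.symm.vv hB.symm (j - 1) i).2.2.2.2.2.1
  have e : (2 * (j - 1) + 2) = 2 * j := by ring
  rw [e] at this
  exact this.symm

theorem XX.subs_BT {κ : Bool} {h v : ℤ → ℤ → TE} (H : XX κ h v) (hB : BTAll h v) :
    BTAll (subs h) (subs v) := by
  intro i j
  have := hB (2 * i + 1) (2 * j + 1)
  rw [show 2 * i + 1 + 1 = 2 * (i + 1) by ring, show 2 * j + 1 + 1 = 2 * (j + 1) by ring,
    H.pass hB] at this
  have h2 := H.symm.pass hB.symm j (i + 1)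
  change v (2 * (i + 1)) (2 * j + 1) = v (2 * (i + 1)) (2 * j) at h2
  rw [h2] at this
  exact this

theorem Nrm.side {κ : Bool} {h v : ℤ → ℤ → TE} (H : XX κ h v) (hB : BTAll h v)
    (hN : Nrm h v) (i j : ℤ) :
    (v (4 * i + 2) (2 * j)).k = (!κ) ∧ (v (4 * i + 2) (2 * j)).lo = decide (j % 2 = 1) := by
  have h1 := H.vv hB (2 * i) j
  have h2 := Nrm.level_zero H hN (2 * (2 * i) + 1) j
  have h3 := h1.2.2.2.2.2.2
  rw [h2] at h3
  have e : (2 * (2 * i) + 1) / 2 % 2 = 0 := by omega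
  have := h3 (by simp [mdl, e])
  rw [show 4 * i + 2 = 2 * (2 * i) + 2 by ring]
  simpa [mdl] using this

theorem Nrm.symm {h v : ℤ → ℤ → TE} (hN : Nrm h v) : Nrm (trp v) (trp h) :=
  fun i j => ⟨(hN j i).2, (hN j i).1⟩

theorem Nrm.subs_XX {κ : Bool} {h v : ℤ → ℤ → TE} (H : XX κ h v) (hB : BTAll h v)
    (hN : Nrm h v) : XX (!κ) (subs h) (subs v) := by
  intro i j
  have a1 := Nrm.side H hB hN i (2 * j)
  have a2 := Nrm.side H hB hN i (2 * j + 1)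
  have b1 := Nrm.side H.symm hB.symm hN.symm j (2 * i)
  have b2 := Nrm.side H.symm hB.symm hN.symm j (2 * i + 1)
  have c := H.subs_BT hB (2 * i) (2 * j)
  simp only [subs] at c ⊢
  rw [show 2 * (2 * i + 1) = 4 * i + 2 by ring] at *
  rw [show 2 * (2 * j + 1) = 4 * j + 2 by ring] at *
  have d1 : (v (4 * i + 2) (2 * (2 * j))).lo = false := by rw [a1.2]; simp
  have d2 : (h (2 * (2 * i)) (4 * j + 2)).lo = false := by
    have := b1.2
    simp only [Int.mul_emod_right] at this
    simpa using this
  refine ⟨?_, b1.1⟩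
  rcases c with c | c | c
  · exact c
  · have := c.1; rw [d2] at this; simp at this
  · have := c.1; rw [d1] at this; simp at this

theorem mdl_succ (κ : Bool) (m : ℕ) (X y : ℤ) :
    mdl κ (m + 1) X y = mdl (!κ) m (X / 2) y := by
  have e : X / 2 ^ (m + 1) = X / 2 / 2 ^ m := by
    rw [pow_succ, mul_comm, ← Int.ediv_ediv_of_nonneg (by norm_num)]
  have e2 : xor κ (decide ((m + 1) % 2 = 1)) = xor (!κ) (decide (m % 2 = 1)) := by
    rcases Nat.mod_two_eq_zero_or_one m with h | h
    · have : (m + 1) % 2 = 1 := by omega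
      simp [h, this]
    · have : (m + 1) % 2 = 0 := by omega
      simp [h, this]
  simp only [mdl, e, e2]

theorem rigidity (N : ℕ) : ∀ (κ : Bool) (h v : ℤ → ℤ → TE), BTAll h v → XX κ h v →
    ∃ A B : ℤ, A % 2 = 0 ∧ B % 2 = 0 ∧ ∀ m < N, ∀ X y : ℤ,
      h (A + X) (B + 2 ^ m * (2 * y + 1)) = mdl κ m X y ∧
      v (A + 2 ^ m * (2 * y + 1)) (B + X) = mdl κ m X y := by
  induction N with
  | zero => intro κ h v _ _; exact ⟨0, 0, rfl, rfl, by simp⟩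
  | succ N ih =>
    intro κ h v hB H
    obtain ⟨s, hs⟩ : ∃ s : ℤ, (h (2 * s) 1).hi = false := by
      by_cases h0 : (h 0 1).hi = false
      · exact ⟨0, h0⟩
      · refine ⟨1, ?_⟩
        have := H.hi_step hB 0 0
        simp at h0
        simpa [h0] using this
    obtain ⟨t, ht⟩ : ∃ t : ℤ, (v 1 (2 * t)).hi = false := by
      by_cases h0 : (v 1 0).hi = false
      · exact ⟨0, h0⟩
      · refine ⟨1, ?_⟩
        have := H.symm.hi_step hB.symm 0 0
        simp at h0
        simpa [h0] using this
    let h' : ℤ → ℤ → TE := fun i j => h (2 * s + i) (2 * t + j)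
    let v' : ℤ → ℤ → TE := fun i j => v (2 * s + i) (2 * t + j)
    have hB' : BTAll h' v' := by
      intro i j
      have := hB (2 * s + i) (2 * t + j)
      simpa only [h', v', add_assoc] using this
    have H' : XX κ h' v' := by
      intro i j
      have := H (s + i) (t + j)
      simpa only [h', v', mul_add, add_assoc] using this
    have hc1 : (h' 0 1).hi = false := by
      have e1 := int_const_of_step (fun j => (h (2 * s) (2 * j + 1)).hi)
        (fun j => H.hi_const hB s j) t
      simp only [h', add_zero]
      rw [← hs]
      simpa using e1
    have hc2 : (v' 1 0).hi = false := by
      have e1 := int_const_of_step (fun j => (v (2 * j + 1) (2 * t)).hi)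
        (fun j => H.symm.hi_const hB.symm t j) s
      simp only [v', add_zero]
      rw [← ht]
      simpa using e1
    have hN' : Nrm h' v' := H'.nrm hB' hc1 hc2
    obtain ⟨A, B, hA, hB2, hAB⟩ := ih (!κ) (subs h') (subs v') (H'.subs_BT hB')
      (hN'.subs_XX H' hB')
    refine ⟨2 * s + 2 * A, 2 * t + 2 * B, by omega, by omega, ?_⟩
    have key : ∀ (h' v' : ℤ → ℤ → TE) (A B : ℤ), XX κ h' v' → BTAll h' v' → Nrm h' v' →
        A % 2 = 0 → B % 2 = 0 → (∀ m < N, ∀ X y : ℤ,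
        subs h' (A + X) (B + 2 ^ m * (2 * y + 1)) = mdl (!κ) m X y) →
        ∀ m < N + 1, ∀ X y : ℤ,
        h' (2 * A + X) (2 * B + 2 ^ m * (2 * y + 1)) = mdl κ m X y := by
      intro h' v' A B H' hB' hN' hA hB2 hAB m hm X y
      obtain ⟨A, rfl⟩ : ∃ a, A = 2 * a := ⟨A / 2, by omega⟩
      obtain ⟨B, rfl⟩ : ∃ a, B = 2 * a := ⟨B / 2, by omega⟩
      rcases m with _ | m
      · have := Nrm.level_zero H' hN' (2 * (2 * A) + X) (2 * B + y)
        rw [show 2 * (2 * B) + 2 ^ 0 * (2 * y + 1) = 2 * (2 * B + y) + 1 by ring, this]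
        simp only [mdl, pow_zero, Int.ediv_one]
        have e1 : (2 * (2 * A) + X) / 2 % 2 = X / 2 % 2 := by omega
        have e2 : (2 * (2 * A) + X) % 2 = X % 2 := by omega
        have e3 : (2 * B + y) % 2 = y % 2 := by omega
        rw [e1, e2, e3]
      · have := hAB m (by omega) (X / 2) y
        rw [mdl_succ, ← this]
        simp only [subs]
        have e : 2 * (2 * B) + 2 ^ (m + 1) * (2 * y + 1) =
          2 * (2 * B + 2 ^ m * (2 * y + 1)) := by ring
        rw [e]
        rcases Int.emod_two_eq_zero_or_one X with hi | hi
        · congr 1; omega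
        · rw [← H'.pass hB']; congr 1; omega
    intro m hm X y
    constructor
    · have := key h' v' A B H' hB' hN' hA hB2 (fun m hm X y => (hAB m hm X y).1) m hm X y
      simpa only [h', add_assoc] using this
    · have := key (trp v') (trp h') B A H'.symm hB'.symm hN'.symm hB2 hA
        (fun m hm X y => (hAB m hm X y).2) m hm X y
      simpa only [v', trp, add_assoc] using this

/-! ### The full hierarchical tileset -/

/-- Base edges: structure, two signals, two parity bits. -/
abbrev BE : Type := TE × Bool × Bool × Bool × Bool

abbrev BE.f (e : BE) : Bool := e.2.1
abbrev BE.g (e : BE) : Bool := e.2.2.1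
abbrev BE.q1 (e : BE) : Bool := e.2.2.2.1
abbrev BE.q2 (e : BE) : Bool := e.2.2.2.2

/-- The cell lies on a red line. -/
def red (w e : TE) : Prop := w.k = true ∧ (w.hi ≠ w.lo ∨ e.hi ≠ e.lo)

/-- Signal rule. -/
def sig (w e s n : BE) : Prop :=
  (red w.1 e.1 → n.f = w.1.b ∧ s.g = w.1.b) ∧ (¬ red w.1 e.1 → n.f = s.f ∧ n.g = s.g)

/-- Parity rule. -/
def parOK (w e s n : BE) : Prop :=
  e.q1 = (!w.q1) ∧ e.q2 = w.q2 ∧ n.q1 = (!s.q1) ∧ n.q2 = s.q2 ∧ w.q1 = s.q2 ∧ s.q1 = w.q2 ∧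
  (w.q1 = true → w.q2 = true → BX w.1 e.1 s.1 n.1 ∧ w.1.k = false)

/-- The rule for the base layer. -/
def baseOK (w e s n : BE) : Prop :=
  BT w.1 e.1 s.1 n.1 ∧ parOK w e s n ∧ sig w e s n ∧ sig s n w e

def frs (w : BE) : Prop := w.f = false ∧ w.g = true

def freeC (w e s n : BE) : Prop := ¬ red w.1 e.1 ∧ ¬ red s.1 n.1 ∧ frs w ∧ frs s

def passC (w e s n : BE) : Prop := ¬ red w.1 e.1 ∧ ¬ red s.1 n.1 ∧ ¬ (frs w ∧ frs s)

/-- Colours of a Wang tileset. -/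
def cols (W : List WT) : List ℕ := 0 :: W.flatMap (fun t => [t.1, t.2.1, t.2.2.1, t.2.2.2])

/-- The data rule. -/
def dataOK (W : List WT) (w e s n : BE) (d : WT) : Prop :=
  (freeC w e s n → d ∈ W) ∧ (passC w e s n → d.1 = d.2.1 ∧ d.2.2.1 = d.2.2.2) ∧
  (red s.1 n.1 → s.1.b = false → d.2.1 = 0) ∧ (red w.1 e.1 → w.1.b = false → d.2.2.2 = 0) ∧
  d.1 ∈ cols W ∧ d.2.1 ∈ cols W ∧ d.2.2.1 ∈ cols W ∧ d.2.2.2 ∈ cols W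

open Classical in
/-- The list of base quadruples satisfying a condition. -/
def baseL (P : BE × BE × BE × BE → Prop) : List (BE × BE × BE × BE) :=
  (Finset.univ.filter P).toList

theorem mem_baseL (P : BE × BE × BE × BE → Prop) (q : BE × BE × BE × BE) :
    q ∈ baseL P ↔ P q := by
  simp [baseL]

/-- Combine base and data layers. -/
def combE (e : BE) (d : ℕ) : ℕ := Nat.pair (Encodable.encode e) d

theorem combE_inj {e e' : BE} {d d' : ℕ} (h : combE e d = combE e' d') : e = e' ∧ d = d' := by
  have := Nat.pair_eq_pair.1 h
  exact ⟨Encodable.encode_injective this.1, this.2⟩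

def combQ (q : BE × BE × BE × BE) (d : WT) : WT :=
  (combE q.1 d.1, combE q.2.1 d.2.1, combE q.2.2.1 d.2.2.1, combE q.2.2.2 d.2.2.2)

def passD (W : List WT) : List WT :=
  (cols W).flatMap fun a => (cols W).map fun c => (a, a, c, c)

def allD (W : List WT) : List WT :=
  (cols W).flatMap fun a => (cols W).flatMap fun b => (cols W).flatMap fun c =>
    (cols W).map fun d => (a, b, c, d)

def zeroD (ze zn : Bool) (d : WT) : WT :=
  (d.1, bif ze then 0 else d.2.1, d.2.2.1, bif zn then 0 else d.2.2.2)

def partH (L : List (BE × BE × BE × BE)) (D : List WT) : List WT :=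
  L.flatMap fun q => D.map fun d => combQ q d

def wallL (ze zn : Bool) : List (BE × BE × BE × BE) :=
  baseL fun q => baseOK q.1 q.2.1 q.2.2.1 q.2.2.2 ∧ (red q.1.1 q.2.1.1 ∨ red q.2.2.1.1 q.2.2.2.1) ∧
    ((red q.2.2.1.1 q.2.2.2.1 ∧ q.2.2.1.1.b = false) ↔ ze = true) ∧
    ((red q.1.1 q.2.1.1 ∧ q.1.1.b = false) ↔ zn = true)

/-- The hierarchical tileset simulating quadrant tilings by `W`. -/
def hier (W : List WT) : List WT :=
  partH (baseL fun q => baseOK q.1 q.2.1 q.2.2.1 q.2.2.2 ∧ freeC q.1 q.2.1 q.2.2.1 q.2.2.2) W ++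
  partH (baseL fun q => baseOK q.1 q.2.1 q.2.2.1 q.2.2.2 ∧ passC q.1 q.2.1 q.2.2.1 q.2.2.2)
    (passD W) ++
  partH (wallL false false) ((allD W).map fun d => zeroD false false d) ++
  partH (wallL false true) ((allD W).map fun d => zeroD false true d) ++
  partH (wallL true false) ((allD W).map fun d => zeroD true false d) ++
  partH (wallL true true) ((allD W).map fun d => zeroD true true d)

theorem mem_partH {L : List (BE × BE × BE × BE)} {D : List WT} {x : WT} :
    x ∈ partH L D ↔ ∃ q ∈ L, ∃ d ∈ D, x = combQ q d := by
  simp only [partH, List.mem_flatMap, List.mem_map]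
  constructor
  · rintro ⟨q, hq, d, hd, rfl⟩; exact ⟨q, hq, d, hd, rfl⟩
  · rintro ⟨q, hq, d, hd, rfl⟩; exact ⟨q, hq, d, hd, rfl⟩

theorem cols_of_mem {W : List WT} {d : WT} (h : d ∈ W) :
    d.1 ∈ cols W ∧ d.2.1 ∈ cols W ∧ d.2.2.1 ∈ cols W ∧ d.2.2.2 ∈ cols W := by
  refine ⟨?_, ?_, ?_, ?_⟩ <;>
  · refine List.mem_cons_of_mem _ (List.mem_flatMap.2 ⟨d, h, ?_⟩)
    simp

theorem mem_allD {W : List WT} {d : WT} : d ∈ allD W ↔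
    d.1 ∈ cols W ∧ d.2.1 ∈ cols W ∧ d.2.2.1 ∈ cols W ∧ d.2.2.2 ∈ cols W := by
  obtain ⟨a, b, c, e⟩ := d
  simp only [allD, List.mem_flatMap, List.mem_map]
  constructor
  · rintro ⟨a', ha, b', hb, c', hc, e', he, h⟩
    simp only [Prod.mk.injEq] at h
    obtain ⟨rfl, rfl, rfl, rfl⟩ := h
    exact ⟨ha, hb, hc, he⟩
  · rintro ⟨ha, hb, hc, he⟩
    exact ⟨a, ha, b, hb, c, hc, e, he, rfl⟩

theorem zero_mem_cols (W : List WT) : 0 ∈ cols W := by simp [cols]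

theorem mem_hier {W : List WT} {x : WT} : x ∈ hier W ↔
    ∃ q : BE × BE × BE × BE, ∃ d : WT, baseOK q.1 q.2.1 q.2.2.1 q.2.2.2 ∧
      dataOK W q.1 q.2.1 q.2.2.1 q.2.2.2 d ∧ x = combQ q d := by
  have hz : ∀ ze zn, x ∈ partH (wallL ze zn) ((allD W).map fun d => zeroD ze zn d) →
      ∃ q : BE × BE × BE × BE, ∃ d : WT, baseOK q.1 q.2.1 q.2.2.1 q.2.2.2 ∧
      dataOK W q.1 q.2.1 q.2.2.1 q.2.2.2 d ∧ x = combQ q d := by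
    intro ze zn h
    obtain ⟨q, hq, d, hd, rfl⟩ := mem_partH.1 h
    obtain ⟨d, hd', rfl⟩ := List.mem_map.1 hd
    rw [wallL, mem_baseL] at hq
    have hd := mem_allD.1 hd'
    obtain ⟨h1, h2, h3, h4⟩ := hq
    refine ⟨q, _, h1, ⟨fun h => ?_, fun h => ?_, fun ha hb => ?_, fun ha hb => ?_, ?_⟩, rfl⟩
    · exact absurd h2 (not_or.2 ⟨h.1, h.2.1⟩)
    · exact absurd h2 (not_or.2 ⟨h.1, h.2.1⟩)
    · simp [zeroD, h3.1 ⟨ha, hb⟩]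
    · simp [zeroD, h4.1 ⟨ha, hb⟩]
    · obtain ⟨a, b, c, e⟩ := hd
      refine ⟨a, ?_, c, ?_⟩
      · cases ze <;> simp [zeroD, b, zero_mem_cols]
      · cases zn <;> simp [zeroD, e, zero_mem_cols]
  constructor
  · intro h
    simp only [hier, List.mem_append] at h
    rcases h with ((((h | h) | h) | h) | h) | h
    · obtain ⟨q, hq, d, hd, rfl⟩ := mem_partH.1 h
      rw [mem_baseL] at hq
      have := hq.2
      exact ⟨q, d, hq.1, ⟨fun _ => hd, fun h => absurd this.2.2 h.2.2,
        fun h => absurd h this.2.1, fun h => absurd h this.1, cols_of_mem hd⟩, rfl⟩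
    · obtain ⟨q, hq, d, hd, rfl⟩ := mem_partH.1 h
      rw [mem_baseL] at hq
      have := hq.2
      simp only [passD, List.mem_flatMap, List.mem_map] at hd
      obtain ⟨a, ha, c, hc, rfl⟩ := hd
      exact ⟨q, _, hq.1, ⟨fun h => absurd h.2.2 this.2.2, fun h => ⟨rfl, rfl⟩,
        fun h => absurd h this.2.1, fun h => absurd h this.1, ha, ha, hc, hc⟩, rfl⟩
    · exact hz _ _ h
    · exact hz _ _ h
    · exact hz _ _ h
    · exact hz _ _ h
  · rintro ⟨q, d, hq, ⟨h1, h2, h3, h4, h5⟩, rfl⟩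
    simp only [hier, List.mem_append]
    by_cases hr : red q.1.1 q.2.1.1 ∨ red q.2.2.1.1 q.2.2.2.1
    · have key : ∀ ze zn, ((red q.2.2.1.1 q.2.2.2.1 ∧ q.2.2.1.1.b = false) ↔ ze = true) →
        ((red q.1.1 q.2.1.1 ∧ q.1.1.b = false) ↔ zn = true) → combQ q d ∈
          partH (wallL ze zn) ((allD W).map fun d => zeroD ze zn d) := by
        intro ze zn hze hzn
        refine mem_partH.2 ⟨q, (mem_baseL _ _).2 ⟨hq, hr, hze, hzn⟩, d,
          List.mem_map.2 ⟨d, mem_allD.2 h5, ?_⟩, rfl⟩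
        refine Prod.ext rfl (Prod.ext ?_ (Prod.ext rfl ?_))
        · cases ze
          · rfl
          · have := hze.2 rfl
            simp [zeroD, h3 this.1 this.2]
        · cases zn
          · rfl
          · have := hzn.2 rfl
            simp [zeroD, h4 this.1 this.2]
      by_cases a1 : (red q.2.2.1.1 q.2.2.2.1 ∧ q.2.2.1.1.b = false) <;>
      by_cases a2 : (red q.1.1 q.2.1.1 ∧ q.1.1.b = false)
      · exact Or.inr (key true true (by simp only [a1]; simp) (by simp only [a2]; simp))
      · exact Or.inl (Or.inr (key true false (by simp only [a1]; simp) (by simp only [a2]; simp)))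
      · exact Or.inl (Or.inl (Or.inr (key false true (by simp only [a1]; simp)
          (by simp only [a2]; simp))))
      · exact Or.inl (Or.inl (Or.inl (Or.inr (key false false (by simp only [a1]; simp)
          (by simp only [a2]; simp)))))
    · rw [not_or] at hr
      by_cases hf : frs q.1 ∧ frs q.2.2.1
      · refine Or.inl (Or.inl (Or.inl (Or.inl (Or.inl (mem_partH.2 ⟨q, (mem_baseL _ _).2
          ⟨hq, hr.1, hr.2, hf⟩, d, h1 ⟨hr.1, hr.2, hf⟩, rfl⟩)))))
      · have h6 := h2 ⟨hr.1, hr.2, hf⟩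
        refine Or.inl (Or.inl (Or.inl (Or.inl (Or.inr (mem_partH.2 ⟨q, (mem_baseL _ _).2
          ⟨hq, hr.1, hr.2, hf⟩, d, ?_, rfl⟩)))))
        simp only [passD, List.mem_flatMap, List.mem_map]
        exact ⟨d.1, h5.1, d.2.2.1, h5.2.2.1,
          Prod.ext rfl (Prod.ext h6.1 (Prod.ext rfl h6.2))⟩

/-- One cell of a hierarchical tiling. -/
def CellOK (W : List WT) (w e s n : BE) (d : WT) : Prop := baseOK w e s n ∧ dataOK W w e s n d

theorem hier_plane {W : List WT} (h : TilesZ (hier W)) :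
    ∃ (h v : ℤ → ℤ → BE) (dh dv : ℤ → ℤ → ℕ), ∀ i j,
      CellOK W (h i (j + 1)) (h (i + 1) (j + 1)) (v (i + 1) j) (v (i + 1) (j + 1))
        (dh i (j + 1), dh (i + 1) (j + 1), dv (i + 1) j, dv (i + 1) (j + 1)) := by
  obtain ⟨t, ht, h1, h2⟩ := h
  choose q d hb hd hq using fun i j => mem_hier.1 (ht i j)
  have e1 : ∀ i j, (q (i + 1) j).1 = (q i j).2.1 ∧ (d (i + 1) j).1 = (d i j).2.1 := by
    intro i j
    have := h1 i j
    rw [hq, hq] at this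
    have := combE_inj this
    exact ⟨this.1.symm, this.2.symm⟩
  have e2 : ∀ i j, (q i (j + 1)).2.2.1 = (q i j).2.2.2 ∧ (d i (j + 1)).2.2.1 = (d i j).2.2.2 := by
    intro i j
    have := h2 i j
    rw [hq, hq] at this
    have := combE_inj this
    exact ⟨this.1.symm, this.2.symm⟩
  refine ⟨fun i j => (q i j).2.1, fun i j => (q i j).2.2.2, fun i j => (d i j).2.1,
    fun i j => (d i j).2.2.2, fun i j => ?_⟩
  have b := hb (i + 1) (j + 1)
  have c := hd (i + 1) (j + 1)
  have a1 := e1 i (j + 1)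
  have a2 := e2 (i + 1) j
  have hdd : d (i + 1) (j + 1) = ((d i (j + 1)).2.1, (d (i + 1) (j + 1)).2.1,
      (d (i + 1) j).2.2.2, (d (i + 1) (j + 1)).2.2.2) :=
    Prod.ext a1.2 (Prod.ext rfl (Prod.ext a2.2 rfl))
  rw [a1.1, a2.1] at b
  rw [a1.1, a2.1, hdd] at c
  exact ⟨b, c⟩

theorem hier_sq {W : List WT} (h v : ℕ → ℕ → BE) (dh dv : ℕ → ℕ → ℕ)
    (H : ∀ i j, CellOK W (h i (j + 1)) (h (i + 1) (j + 1)) (v (i + 1) j) (v (i + 1) (j + 1))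
        (dh i (j + 1), dh (i + 1) (j + 1), dv (i + 1) j, dv (i + 1) (j + 1))) :
    TilesZ (hier W) := by
  apply tilesZ_of_sq
  intro n
  refine ⟨fun i j => combQ (h i (j + 1), h (i + 1) (j + 1), v (i + 1) j, v (i + 1) (j + 1))
    (dh i (j + 1), dh (i + 1) (j + 1), dv (i + 1) j, dv (i + 1) (j + 1)), ?_, ?_, ?_⟩
  · intro i j _ _
    exact mem_hier.2 ⟨_, _, (H i j).1, (H i j).2, rfl⟩
  · intro i j _ _; rfl
  · intro i j _ _; rfl

/-- Natural-number version of the model. -/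
def mdlN (m X y : ℕ) : TE :=
  (decide (X / 2 ^ m / 2 % 2 = 1), decide (X / 2 ^ m % 2 = 1), decide (y % 2 = 1),
    decide (m % 2 = 1))

theorem mdl_cast (m X y : ℕ) : mdl false m (X : ℤ) (y : ℤ) = mdlN m X y := by
  have e : ((X : ℤ) / 2 ^ m) = ((X / 2 ^ m : ℕ) : ℤ) := by push_cast; rfl
  simp only [mdl, mdlN, e, Bool.false_xor]
  have e1 : ((X / 2 ^ m : ℕ) : ℤ) / 2 % 2 = 1 ↔ X / 2 ^ m / 2 % 2 = 1 := by omega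
  have e2 : ((X / 2 ^ m : ℕ) : ℤ) % 2 = 1 ↔ X / 2 ^ m % 2 = 1 := by omega
  have e3 : (y : ℤ) % 2 = 1 ↔ y % 2 = 1 := by omega
  simp only [e1, e2, e3]

/-- In a hierarchical tiling, every window of the model appears. -/
theorem hier_window {W : List WT} (H : TilesZ (hier W)) (N : ℕ) :
    ∃ (h v : ℕ → ℕ → BE) (dh dv : ℕ → ℕ → ℕ), (∀ i j,
      CellOK W (h i (j + 1)) (h (i + 1) (j + 1)) (v (i + 1) j) (v (i + 1) (j + 1))
        (dh i (j + 1), dh (i + 1) (j + 1), dv (i + 1) j, dv (i + 1) (j + 1))) ∧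
      ∀ m < N, ∀ X y, (h X (2 ^ m * (2 * y + 1))).1 = mdlN m X y ∧
        (v (2 ^ m * (2 * y + 1)) X).1 = mdlN m X y := by
  obtain ⟨h, v, dh, dv, H⟩ := hier_plane H
  have p1 : ∀ i j, (h (i + 1) j).q1 = !(h i j).q1 := by
    intro i j
    have := (H i (j - 1)).1.2.1.1
    rwa [sub_add_cancel] at this
  have p2 : ∀ i j, (h i (j + 1)).q1 = (h i j).q1 := by
    intro i j
    have a := (H i (j - 1)).1.2.1
    have b := (H i j).1.2.1
    rw [sub_add_cancel] at a
    rw [b.2.2.2.2.1, a.2.2.2.2.1, a.2.2.2.1]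
  have p3 : ∀ i j, (h (i + 1) j).q2 = (h i j).q2 := by
    intro i j
    have := (H i (j - 1)).1.2.1.2.1
    rwa [sub_add_cancel] at this
  have p4 : ∀ i j, (h i (j + 1)).q2 = !(h i j).q2 := by
    intro i j
    have a := (H i (j - 1)).1.2.1
    have b := (H i j).1.2.1
    rw [sub_add_cancel] at a
    rw [← b.2.2.2.2.2.1, ← a.2.2.2.2.2.1, a.2.2.1]
  obtain ⟨s, hs⟩ : ∃ s, (h s 0).q1 = true := by
    by_cases h0 : (h 0 0).q1 = true
    · exact ⟨0, h0⟩
    · exact ⟨0 + 1, by rw [p1]; simpa using h0⟩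
  obtain ⟨t, ht⟩ : ∃ t, (h 0 t).q2 = false := by
    by_cases h0 : (h 0 0).q2 = false
    · exact ⟨0, h0⟩
    · exact ⟨0 + 1, by rw [p4]; simpa using h0⟩
  have r1 : ∀ i j, (h (s + 2 * i) j).q1 = true := by
    intro i j
    rw [int_const_of_step (fun j => (h (s + 2 * i) j).q1) (fun j => p2 _ j) j]
    rw [← hs, int_const_of_step (fun i => (h (s + 2 * i) 0).q1) (fun i => ?_) i]
    · simp
    · rw [show s + 2 * (i + 1) = s + 2 * i + 1 + 1 by ring, p1, p1]; simp
  have r2 : ∀ i j, (h i (t + 2 * j + 1)).q2 = true := by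
    intro i j
    rw [int_const_of_step (fun i => (h i (t + 2 * j + 1)).q2) (fun i => p3 i _) i, p4]
    rw [int_const_of_step (fun j => (h 0 (t + 2 * j)).q2) (fun j => ?_) j]
    · simp [ht]
    · rw [show t + 2 * (j + 1) = t + 2 * j + 1 + 1 by ring, p4, p4]; simp
  obtain ⟨A, B, -, -, hAB⟩ := rigidity N false (fun i j => (h (s + i) (t + j)).1)
    (fun i j => (v (s + i) (t + j)).1)
    (fun i j => by
      have := (H (s + i) (t + j)).1.1
      simpa only [add_assoc] using this)
    (fun i j => by
      have := (H (s + 2 * i) (t + 2 * j)).1.2.1.2.2.2.2.2.2 (r1 _ _) (r2 _ _)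
      simpa only [add_assoc] using this)
  refine ⟨fun i j => h (s + (A + i)) (t + (B + j)), fun i j => v (s + (A + i)) (t + (B + j)),
    fun i j => dh (s + (A + i)) (t + (B + j)), fun i j => dv (s + (A + i)) (t + (B + j)),
    fun i j => ?_, fun m hm X y => ?_⟩
  · have := H (s + (A + i)) (t + (B + j))
    simpa only [add_assoc, Nat.cast_add, Nat.cast_one] using this
  · have := hAB m hm X y
    rw [mdl_cast] at this
    push_cast
    exact this

/-! ### Red squares and signals -/

def ph (m X : ℕ) : Prop := X / 2 ^ m % 4 = 1 ∨ X / 2 ^ m % 4 = 2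

def extz (m Z : ℕ) : Prop := ph m (Z - 1) ∨ ph m Z

/-- `m` is the least odd level whose extended red zone contains `X`. -/
def Mu (X m : ℕ) : Prop := m % 2 = 1 ∧ extz m X ∧ ∀ m' < m, m' % 2 = 1 → ¬ extz m' X

/-- Red horizontal line through the cell `(X, Y)`. -/
def RedH (X Y : ℕ) : Prop := ∃ m y, m % 2 = 1 ∧ Y = 2 ^ m * (2 * y + 1) ∧ extz m X

theorem red_mdlN (m X y : ℕ) : red (mdlN m X y) (mdlN m (X + 1) y) ↔ m % 2 = 1 ∧ extz m (X + 1) := by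
  have key : ∀ a : ℕ, (decide (a / 2 % 2 = 1) ≠ decide (a % 2 = 1)) ↔ (a % 4 = 1 ∨ a % 4 = 2) := by
    intro a
    rw [Ne, decide_eq_decide]
    omega
  simp only [red, mdlN, extz, ph, key, TE.k, decide_eq_true_eq, Nat.add_sub_cancel]

theorem ext_self (m y : ℕ) : extz m (2 ^ m * (2 * y + 1)) := by
  have hq : 0 < 2 ^ m := by positivity
  rcases Nat.mod_two_eq_zero_or_one y with h | h
  · right
    rw [ph, Nat.mul_div_cancel_left _ hq]; omega
  · left
    have : (2 ^ m * (2 * y + 1) - 1) / 2 ^ m = 2 * y := by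
      rw [Nat.div_eq_iff hq]
      constructor
      · rw [mul_add, mul_one, mul_comm]; omega
      · rw [mul_add, mul_one, mul_comm (2 * y)]
    rw [ph, this]; omega

theorem ext_not_ph {m Y : ℕ} (h : extz m Y) (h2 : ¬ ph m Y) : ∃ y, Y = 2 ^ m * (2 * y + 1) := by
  have hq : 0 < 2 ^ m := by positivity
  rcases h with h | h
  · rcases Nat.eq_zero_or_pos Y with h0 | h0
    · subst h0; exact absurd h h2
    obtain ⟨Z, rfl⟩ : ∃ Z, Y = Z + 1 := ⟨Y - 1, by omega⟩
    simp only [ph, Nat.add_sub_cancel] at h h2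
    rw [Nat.succ_div] at h2
    split_ifs at h2 with hd
    · obtain ⟨c, hc⟩ := hd
      have e : Z / 2 ^ m + 1 = c := by
        have : (Z + 1) / 2 ^ m = c := by rw [hc, Nat.mul_div_cancel_left _ hq]
        rw [← this, Nat.succ_div, if_pos ⟨c, hc⟩]
      refine ⟨c / 2, ?_⟩
      rw [hc]; congr 1; omega
    · exact absurd h h2
  · exact absurd h h2

theorem lev_unique {m m' y y' : ℕ} (h : 2 ^ m * (2 * y + 1) = 2 ^ m' * (2 * y' + 1)) :
    m = m' ∧ y = y' := by
  have key : ∀ {m m' y y' : ℕ}, m < m' → 2 ^ m * (2 * y + 1) = 2 ^ m' * (2 * y' + 1) → False := by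
    intro m m' y y' hm h
    obtain ⟨d, rfl⟩ : ∃ d, m' = m + (d + 1) := ⟨m' - m - 1, by omega⟩
    rw [pow_add, mul_assoc] at h
    have := Nat.eq_of_mul_eq_mul_left (by positivity) h
    rw [pow_succ] at this
    have : (2 * y + 1) = 2 * (2 ^ d * (2 * y' + 1)) := by rw [this]; ring
    omega
  rcases Nat.lt_trichotomy m m' with hm | hm | hm
  · exact (key hm h).elim
  · subst hm
    have := Nat.eq_of_mul_eq_mul_left (by positivity) h
    exact ⟨rfl, by omega⟩
  · exact (key hm h.symm).elim

theorem exists_lev {Y : ℕ} (h : Y ≠ 0) : ∃ m y, Y = 2 ^ m * (2 * y + 1) := by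
  obtain ⟨m, n, hn, rfl⟩ := Nat.exists_eq_two_pow_mul_odd h
  obtain ⟨y, rfl⟩ := hn
  exact ⟨m, y, rfl⟩

theorem Mu.nr {X m Y : ℕ} (h : Mu X m) (hr : RedH X Y) : ∃ d, Y = 2 ^ m * d ∧ d % 4 ≠ 2 := by
  obtain ⟨n, y, hn, rfl, he⟩ := hr
  have hmn : m ≤ n := by
    by_contra hc
    exact h.2.2 n (by omega) hn he
  obtain ⟨d, rfl⟩ : ∃ d, n = m + d := ⟨n - m, by omega⟩
  refine ⟨2 ^ d * (2 * y + 1), by rw [pow_add]; ring, ?_⟩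
  have hm := h.1
  have hd : d % 2 = 0 := by omega
  rcases d with _ | _ | d
  · rw [pow_zero]; omega
  · omega
  · rw [pow_succ, pow_succ, show 2 ^ d * 2 * 2 * (2 * y + 1) = 4 * (2 ^ d * (2 * y + 1)) by ring]
    omega

theorem Mu.red {X m p : ℕ} (h : Mu X m) (hp : p % 2 = 1) : RedH X (2 ^ m * p) :=
  ⟨m, p / 2, h.1, by congr 1; omega, h.2.1⟩

/-- The abstract signal rule on a column. -/
def SigRule (L X : ℕ) (f g : ℕ → Bool) : Prop :=
  ∀ Y, Y + 1 < L → (∀ m y, m % 2 = 1 → Y + 1 = 2 ^ m * (2 * y + 1) → extz m X →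
    f (Y + 1) = decide (y % 2 = 1) ∧ g Y = decide (y % 2 = 1)) ∧
    (¬ RedH X (Y + 1) → f (Y + 1) = f Y ∧ g (Y + 1) = g Y)

theorem SigRule.f_prop {L X : ℕ} {f g : ℕ → Bool} (h : SigRule L X f g) {m p0 p Y : ℕ}
    (hm : Mu X m) (h0 : p0 % 2 = 1) (hp : ∀ d, p0 < d → d ≤ p → d % 4 = 2)
    (hY : 2 ^ m * p0 ≤ Y) (hY2 : Y < 2 ^ m * (p + 1)) (hL : Y < L) :
    f Y = decide (p0 / 2 % 2 = 1) := by
  have hq : 0 < 2 ^ m := by positivity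
  induction Y, hY using Nat.le_induction with
  | base =>
    obtain ⟨Z, hZ⟩ : ∃ Z, 2 ^ m * p0 = Z + 1 :=
      ⟨2 ^ m * p0 - 1, by have := Nat.mul_pos hq (show 0 < p0 by omega); omega⟩
    have := ((h Z (by omega)).1 m (p0 / 2) hm.1 (by rw [← hZ]; congr 1; omega) hm.2.1).1
    rw [hZ]; exact this
  | succ Y hY ih =>
    rw [← ih (by omega) (by omega)]
    refine ((h Y hL).2 fun hr => ?_).1
    obtain ⟨d, hd, hd2⟩ := hm.nr hr
    refine hd2 (hp d ?_ ?_)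
    · apply Nat.lt_of_mul_lt_mul_left (a := 2 ^ m); omega
    · apply Nat.lt_succ_iff.1
      apply Nat.lt_of_mul_lt_mul_left (a := 2 ^ m)
      rw [← hd]; exact hY2

theorem SigRule.g_prop {L X : ℕ} {f g : ℕ → Bool} (h : SigRule L X f g) {m p1 Y : ℕ}
    (hm : Mu X m) (h0 : p1 % 2 = 1)
    (hp : ∀ Y', Y < Y' → Y' < 2 ^ m * p1 → ¬ RedH X Y')
    (hY : Y < 2 ^ m * p1) (hL : 2 ^ m * p1 < L) :
    g Y = decide (p1 / 2 % 2 = 1) := by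
  have hq : 0 < 2 ^ m := by positivity
  obtain ⟨Z, hZ⟩ : ∃ Z, 2 ^ m * p1 = Z + 1 := ⟨2 ^ m * p1 - 1, by omega⟩
  have base : g Z = decide (p1 / 2 % 2 = 1) :=
    ((h Z (by omega)).1 m (p1 / 2) hm.1 (by rw [← hZ]; congr 1; omega) hm.2.1).2
  have key : ∀ k, k ≤ Z - Y → g (Z - k) = decide (p1 / 2 % 2 = 1) := by
    intro k
    induction k with
    | zero => intro _; exact base
    | succ k ih =>
      intro hk
      rw [← ih (by omega)]
      have e : Z - k = Z - (k + 1) + 1 := by omega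
      rw [e]
      exact ((h (Z - (k + 1)) (by omega)).2 (hp _ (by omega) (by omega))).2.symm
  have := key (Z - Y) le_rfl
  rwa [show Z - (Z - Y) = Y by omega] at this

theorem SigRule.free_iff {L X : ℕ} {f g : ℕ → Bool} (h : SigRule L X f g) {m Y : ℕ}
    (hm : Mu X m) (hr : ¬ RedH X (Y + 1)) (hL : Y + 1 + 2 * 2 ^ m < L) :
    (f Y = false ∧ g Y = true) ↔ ph m (Y + 1) := by
  have hq : 0 < 2 ^ m := by positivity
  generalize hp : (Y + 1) / 2 ^ m = p
  have hp1 : 2 ^ m * p ≤ Y + 1 := by rw [← hp]; exact Nat.mul_div_le _ _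
  have hp2 : Y + 1 < 2 ^ m * (p + 1) := by
    rw [← hp]; exact Nat.lt_mul_div_succ _ hq
  have hpe1 : 2 ^ m * (p + 1) = 2 ^ m * p + 2 ^ m := by ring
  have hpe2 : 2 ^ m * (p + 2) = 2 ^ m * p + 2 * 2 ^ m := by ring
  have hodd : p % 2 = 1 → 2 ^ m * p ≤ Y := by
    intro ho
    by_contra hc
    have : Y + 1 = 2 ^ m * p := by omega
    exact hr (this ▸ hm.red ho)
  have hg : ∀ p1, p1 % 2 = 1 → p < p1 → p1 ≤ p + 2 → (∀ d, p < d → d < p1 → d % 4 = 2) →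
      g Y = decide (p1 / 2 % 2 = 1) := by
    intro p1 ho hlt hle hd
    have b1 : 2 ^ m * (p + 1) ≤ 2 ^ m * p1 := Nat.mul_le_mul_left _ hlt
    have b2 : 2 ^ m * p1 ≤ 2 ^ m * (p + 2) := Nat.mul_le_mul_left _ hle
    refine h.g_prop hm ho ?_ (by omega) (by omega)
    intro Y' h1 h2 hr'
    obtain ⟨d, rfl, hd2⟩ := hm.nr hr'
    have hdl := Nat.lt_of_mul_lt_mul_left h2
    rcases Nat.lt_or_ge p d with h3 | h3
    · exact hd2 (hd d h3 hdl)
    · have : 2 ^ m * d ≤ 2 ^ m * p := Nat.mul_le_mul_left _ h3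
      have e : 2 ^ m * d = Y + 1 := by omega
      rw [e] at hr'
      exact hr hr'
  simp only [ph, hp]
  have h4 : p % 4 < 4 := Nat.mod_lt _ (by norm_num)
  interval_cases hpm : p % 4
  · have := hg (p + 1) (by omega) (by omega) (by omega) (fun d _ _ => by omega)
    have e : (p + 1) / 2 % 2 = 0 := by omega
    simp [this, e]
  · have f1 := h.f_prop hm (p0 := p) (p := p) (by omega) (fun d _ _ => by omega)
      (hodd (by omega)) (by omega) (by omega)
    have g1 := hg (p + 2) (by omega) (by omega) (by omega) (fun d _ _ => by omega)
    have e1 : p / 2 % 2 = 0 := by omega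
    have e2 : (p + 2) / 2 % 2 = 1 := by omega
    rw [f1, g1, e1, e2]; simp
  · have e0 : 2 ^ m * p = 2 ^ m * (p - 1) + 2 ^ m := by
      obtain ⟨r, rfl⟩ : ∃ r, p = r + 1 := ⟨p - 1, by omega⟩
      simp only [Nat.add_sub_cancel]; ring
    have f1 := h.f_prop hm (p0 := p - 1) (p := p) (by omega) (fun d _ _ => by omega)
      (by omega) (by omega : Y < _) (by omega)
    have g1 := hg (p + 1) (by omega) (by omega) (by omega) (fun d _ _ => by omega)
    have e1 : (p - 1) / 2 % 2 = 0 := by omega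
    have e2 : (p + 1) / 2 % 2 = 1 := by omega
    rw [f1, g1, e1, e2]; simp
  · have f1 := h.f_prop hm (p0 := p) (p := p) (by omega) (fun d _ _ => by omega)
      (hodd (by omega)) (by omega) (by omega)
    have e1 : p / 2 % 2 = 1 := by omega
    simp [f1, e1]

theorem exists_Mu {X m : ℕ} (hm : m % 2 = 1) (h : extz m X) : ∃ m', m' ≤ m ∧ Mu X m' := by
  classical
  have hex : ∃ m, m % 2 = 1 ∧ extz m X := ⟨m, hm, h⟩
  refine ⟨Nat.find hex, Nat.find_min' hex ⟨hm, h⟩, (Nat.find_spec hex).1, (Nat.find_spec hex).2, ?_⟩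
  intro m' h1 h2 h3
  exact Nat.find_min hex h1 ⟨h2, h3⟩

theorem Mu.unique {X m m' : ℕ} (h : Mu X m) (h' : Mu X m') : m = m' := by
  by_contra hne
  rcases Nat.lt_or_gt_of_ne hne with hl | hl
  · exact h'.2.2 m hl h.1 h.2.1
  · exact h.2.2 m' hl h'.1 h'.2.1

/-! ### Soundness of the hierarchical tileset -/

/-- A window of the hierarchical tiling, in natural coordinates. -/
structure Win (W : List WT) (N : ℕ) (h v : ℕ → ℕ → BE) (dh dv : ℕ → ℕ → ℕ) : Prop where
  cell : ∀ i j, CellOK W (h i (j + 1)) (h (i + 1) (j + 1)) (v (i + 1) j) (v (i + 1) (j + 1))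
        (dh i (j + 1), dh (i + 1) (j + 1), dv (i + 1) j, dv (i + 1) (j + 1))
  hh : ∀ m < N, ∀ X y, (h X (2 ^ m * (2 * y + 1))).1 = mdlN m X y
  vv : ∀ m < N, ∀ X y, (v (2 ^ m * (2 * y + 1)) X).1 = mdlN m X y

theorem lev_lt {N m y Y : ℕ} (hY : Y = 2 ^ m * (2 * y + 1)) (hL : Y < 2 ^ N) : m < N := by
  by_contra hc
  have h1 : 2 ^ N ≤ 2 ^ m := Nat.pow_le_pow_right (by norm_num) (by omega)
  have h2 : 2 ^ m * 1 ≤ 2 ^ m * (2 * y + 1) := Nat.mul_le_mul_left _ (by omega)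
  omega

section
variable {W : List WT} {N : ℕ} {h v : ℕ → ℕ → BE} {dh dv : ℕ → ℕ → ℕ}

theorem Win.redh (w : Win W N h v dh dv) {X Y : ℕ} (hY : Y + 1 < 2 ^ N) :
    red (h X (Y + 1)).1 (h (X + 1) (Y + 1)).1 ↔ RedH (X + 1) (Y + 1) := by
  obtain ⟨m, y, hmy⟩ := exists_lev (Nat.succ_ne_zero Y)
  change Y + 1 = _ at hmy
  rw [hmy, w.hh m (lev_lt hmy hY), w.hh m (lev_lt hmy hY), red_mdlN]
  constructor
  · rintro ⟨h1, h2⟩; exact ⟨m, y, h1, rfl, h2⟩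
  · rintro ⟨m', y', h1, h2, h3⟩
    obtain ⟨rfl, rfl⟩ := lev_unique h2
    exact ⟨h1, h3⟩

theorem Win.redv (w : Win W N h v dh dv) {X Y : ℕ} (hX : X + 1 < 2 ^ N) :
    red (v (X + 1) Y).1 (v (X + 1) (Y + 1)).1 ↔ RedH (Y + 1) (X + 1) := by
  obtain ⟨m, y, hmy⟩ := exists_lev (Nat.succ_ne_zero X)
  change X + 1 = _ at hmy
  rw [hmy, w.vv m (lev_lt hmy hX), w.vv m (lev_lt hmy hX), red_mdlN]
  constructor
  · rintro ⟨h1, h2⟩; exact ⟨m, y, h1, rfl, h2⟩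
  · rintro ⟨m', y', h1, h2, h3⟩
    obtain ⟨rfl, rfl⟩ := lev_unique h2
    exact ⟨h1, h3⟩

theorem Win.sigv (w : Win W N h v dh dv) (X : ℕ) :
    SigRule (2 ^ N) (X + 1) (fun Y => (v (X + 1) Y).f) (fun Y => (v (X + 1) Y).g) := by
  intro Y hY
  have hs := (w.cell X Y).1.2.2.1
  refine ⟨fun m y hm hmy he => ?_, fun hr => hs.2 ((w.redh hY).not.2 hr)⟩
  have hr : RedH (X + 1) (Y + 1) := ⟨m, y, hm, hmy, he⟩
  have := hs.1 ((w.redh hY).2 hr)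
  have e : (h X (Y + 1)).1.b = decide (y % 2 = 1) := by
    rw [hmy, w.hh m (lev_lt hmy hY)]; rfl
  rwa [e] at this

theorem Win.sigh (w : Win W N h v dh dv) (Y : ℕ) :
    SigRule (2 ^ N) (Y + 1) (fun X => (h X (Y + 1)).f) (fun X => (h X (Y + 1)).g) := by
  intro X hX
  have hs := (w.cell X Y).1.2.2.2
  refine ⟨fun m y hm hmy he => ?_, fun hr => hs.2 ((w.redv hX).not.2 hr)⟩
  have hr : RedH (Y + 1) (X + 1) := ⟨m, y, hm, hmy, he⟩
  have := hs.1 ((w.redv hX).2 hr)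
  have e : (v (X + 1) Y).1.b = decide (y % 2 = 1) := by
    rw [hmy, w.vv m (lev_lt hmy hX)]; rfl
  rwa [e] at this

end

theorem in_sq_ph {n X : ℕ} (h1 : 2 ^ n < X) (h2 : X < 3 * 2 ^ n) : ph n X := by
  have hq : 0 < 2 ^ n := by positivity
  have a : 1 ≤ X / 2 ^ n := (Nat.le_div_iff_mul_le hq).2 (by omega)
  have b : X / 2 ^ n < 3 := (Nat.div_lt_iff_lt_mul hq).2 h2
  rw [ph]; omega

theorem in_sq_not_mul {n d : ℕ} (h1 : 2 ^ n < 2 ^ n * d) (h2 : 2 ^ n * d < 3 * 2 ^ n) : d = 2 := by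
  have a : 1 < d := Nat.lt_of_mul_lt_mul_left (a := 2 ^ n) (by omega)
  have b : d < 3 := Nat.lt_of_mul_lt_mul_left (a := 2 ^ n) (by omega)
  omega

theorem notred {n X Y : ℕ} (hY : Mu Y n) (hX1 : 2 ^ n < X) (hX2 : X < 3 * 2 ^ n)
    (hY1 : 2 ^ n < Y) (hY2 : Y < 3 * 2 ^ n) : ¬ RedH X Y ∧ ¬ RedH Y X := by
  constructor
  · rintro ⟨m, y, hm, hmy, he⟩
    have hmn : n ≤ m := by
      by_contra hc
      exact hY.2.2 m (by omega) hm (hmy ▸ ext_self m y)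
    have := Mu.nr hY (Y := Y) ⟨m, y, hm, hmy, by rw [hmy]; exact ext_self m y⟩
    obtain ⟨d, hd, hd2⟩ := this
    rw [hd] at hY1 hY2
    have := in_sq_not_mul hY1 hY2
    omega
  · intro hr
    obtain ⟨d, hd, hd2⟩ := hY.nr hr
    rw [hd] at hX1 hX2
    have := in_sq_not_mul hX1 hX2
    omega

section
variable {W : List WT} {n : ℕ} {h v : ℕ → ℕ → BE} {dh dv : ℕ → ℕ → ℕ}

theorem Win.frs_v (w : Win W (n + 3) h v dh dv) {X Y m : ℕ}
    (hm : Mu (X + 1) m) (hmn : m ≤ n) (hr : ¬ RedH (X + 1) (Y + 1)) (hY2 : Y + 1 < 3 * 2 ^ n) :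
    frs (v (X + 1) Y) ↔ ph m (Y + 1) := by
  have hq : 2 ^ m ≤ 2 ^ n := Nat.pow_le_pow_right (by norm_num) hmn
  refine (w.sigv X).free_iff hm hr ?_
  rw [pow_add]; omega

theorem Win.frs_h (w : Win W (n + 3) h v dh dv) {X Y m : ℕ}
    (hm : Mu (Y + 1) m) (hmn : m ≤ n) (hr : ¬ RedH (Y + 1) (X + 1)) (hX2 : X + 1 < 3 * 2 ^ n) :
    frs (h X (Y + 1)) ↔ ph m (X + 1) := by
  have hq : 2 ^ m ≤ 2 ^ n := Nat.pow_le_pow_right (by norm_num) hmn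
  refine (w.sigh Y).free_iff hm hr ?_
  rw [pow_add]; omega

theorem Win.free (w : Win W (n + 3) h v dh dv) {X Y : ℕ} (hX : Mu (X + 1) n) (hY : Mu (Y + 1) n)
    (hX1 : 2 ^ n < X + 1) (hX2 : X + 1 < 3 * 2 ^ n) (hY1 : 2 ^ n < Y + 1)
    (hY2 : Y + 1 < 3 * 2 ^ n) :
    (dh X (Y + 1), dh (X + 1) (Y + 1), dv (X + 1) Y, dv (X + 1) (Y + 1)) ∈ W := by
  have hN : 3 * 2 ^ n < 2 ^ (n + 3) := by rw [pow_add]; have : 0 < 2 ^ n := by positivity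
                                          omega
  obtain ⟨r1, r2⟩ := notred hY hX1 hX2 hY1 hY2
  refine (w.cell X Y).2.1 ⟨(w.redh (by omega)).not.2 r1, (w.redv (by omega)).not.2 r2, ?_, ?_⟩
  · exact (w.frs_h hY le_rfl r2 hX2).2 (in_sq_ph hX1 hX2)
  · exact (w.frs_v hX le_rfl r1 hY2).2 (in_sq_ph hY1 hY2)

theorem Win.pass_h (w : Win W (n + 3) h v dh dv) {X Y : ℕ} (hX : ¬ Mu (X + 1) n)
    (hY : Mu (Y + 1) n) (hX1 : 2 ^ n < X + 1) (hX2 : X + 1 < 3 * 2 ^ n) (hY1 : 2 ^ n < Y + 1)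
    (hY2 : Y + 1 < 3 * 2 ^ n) : dh X (Y + 1) = dh (X + 1) (Y + 1) := by
  have hN : 3 * 2 ^ n < 2 ^ (n + 3) := by rw [pow_add]; have : 0 < 2 ^ n := by positivity
                                          omega
  obtain ⟨r1, r2⟩ := notred hY hX1 hX2 hY1 hY2
  refine ((w.cell X Y).2.2.1 ⟨(w.redh (by omega)).not.2 r1, (w.redv (by omega)).not.2 r2, ?_⟩).1
  rintro ⟨-, hf⟩
  obtain ⟨m, hmn, hm⟩ := exists_Mu hY.1 (Or.inr (in_sq_ph hX1 hX2))
  have := (w.frs_v hm hmn r1 hY2).1 hf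
  rcases Nat.lt_or_ge m n with hl | hl
  · exact hY.2.2 m hl hm.1 (Or.inr this)
  · have : m = n := by omega
    subst this; exact hX hm

theorem Win.pass_v (w : Win W (n + 3) h v dh dv) {X Y : ℕ} (hX : Mu (X + 1) n)
    (hY : ¬ Mu (Y + 1) n) (hX1 : 2 ^ n < X + 1) (hX2 : X + 1 < 3 * 2 ^ n) (hY1 : 2 ^ n < Y + 1)
    (hY2 : Y + 1 < 3 * 2 ^ n) : dv (X + 1) Y = dv (X + 1) (Y + 1) := by
  have hN : 3 * 2 ^ n < 2 ^ (n + 3) := by rw [pow_add]; have : 0 < 2 ^ n := by positivity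
                                          omega
  obtain ⟨r1, r2⟩ := notred hX hY1 hY2 hX1 hX2
  refine ((w.cell X Y).2.2.1 ⟨(w.redh (by omega)).not.2 r2, (w.redv (by omega)).not.2 r1, ?_⟩).2
  rintro ⟨hf, -⟩
  obtain ⟨m, hmn, hm⟩ := exists_Mu hX.1 (Or.inr (in_sq_ph hY1 hY2))
  have := (w.frs_h hm hmn r1 hX2).1 hf
  rcases Nat.lt_or_ge m n with hl | hl
  · exact hX.2.2 m hl hm.1 (Or.inr this)
  · have : m = n := by omega
    subst this; exact hY hm

theorem Win.wall_h (w : Win W (n + 3) h v dh dv) {Y : ℕ} (hn : n % 2 = 1)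
    (hY1 : 2 ^ n < Y + 1) (hY2 : Y + 1 < 3 * 2 ^ n) : dh (2 ^ n) (Y + 1) = 0 := by
  have hq : 0 < 2 ^ n := by positivity
  have hN : 2 ^ n < 2 ^ (n + 3) := by rw [pow_add]; omega
  obtain ⟨X, hX⟩ : ∃ X, 2 ^ n = X + 1 := ⟨2 ^ n - 1, by omega⟩
  have hX' : X + 1 = 2 ^ n * (2 * 0 + 1) := by omega
  have hr : RedH (Y + 1) (X + 1) := ⟨n, 0, hn, hX', Or.inr (in_sq_ph hY1 hY2)⟩
  rw [hX]
  refine (w.cell X Y).2.2.2.1 ((w.redv (by omega)).2 hr) ?_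
  rw [hX', w.vv n (by omega)]; rfl

theorem Win.wall_v (w : Win W (n + 3) h v dh dv) {X : ℕ} (hn : n % 2 = 1)
    (hX1 : 2 ^ n < X + 1) (hX2 : X + 1 < 3 * 2 ^ n) : dv (X + 1) (2 ^ n) = 0 := by
  have hq : 0 < 2 ^ n := by positivity
  have hN : 2 ^ n < 2 ^ (n + 3) := by rw [pow_add]; omega
  obtain ⟨Y, hY⟩ : ∃ Y, 2 ^ n = Y + 1 := ⟨2 ^ n - 1, by omega⟩
  have hY' : Y + 1 = 2 ^ n * (2 * 0 + 1) := by omega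
  have hr : RedH (X + 1) (Y + 1) := ⟨n, 0, hn, hY', Or.inr (in_sq_ph hX1 hX2)⟩
  rw [hY]
  refine (w.cell X Y).2.2.2.2.1 ((w.redh (by omega)).2 hr) ?_
  rw [hY', w.hh n (by omega)]; rfl

end

/-- There are many free columns in a red square. -/
theorem free_column {n t : ℕ} (hn : n % 2 = 1) (ht : 2 * t + 1 < n) :
    Mu (2 ^ n + (2 ^ (2 * t + 1) - 1)) n := by
  have hp : ∀ k, 0 < 2 ^ k := fun k => by positivity
  have hlt : 2 ^ (2 * t + 1) < 2 ^ n := Nat.pow_lt_pow_right (by norm_num) ht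
  have h1 := hp (2 * t + 1)
  have h2 : 2 ≤ 2 ^ (2 * t + 1) := by
    calc 2 = 2 ^ 1 := rfl
      _ ≤ _ := Nat.pow_le_pow_right (by norm_num) (by omega)
  refine ⟨hn, Or.inr (in_sq_ph (by omega) (by omega)), ?_⟩
  intro m hm hmo
  have key : ∀ r, r < 2 ^ n → (2 ^ n + r) / 2 ^ m % 4 = r / 2 ^ m % 4 := by
    intro r _
    obtain ⟨d, rfl⟩ : ∃ d, n = m + (d + 2) := ⟨n - m - 2, by omega⟩
    have : 2 ^ (m + (d + 2)) + r = r + 2 ^ m * (2 ^ d * 4) := by ring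
    rw [this, Nat.add_mul_div_left _ _ (hp m)]
    omega
  have hnot : ∀ r, r / 2 ^ m % 4 = 0 ∨ r / 2 ^ m % 4 = 3 → r < 2 ^ n → ¬ ph m (2 ^ n + r) := by
    intro r hr hr2
    rw [ph, key r hr2]; omega
  have e : 2 ^ n + (2 ^ (2 * t + 1) - 1) - 1 = 2 ^ n + (2 ^ (2 * t + 1) - 2) := by omega
  rw [extz, e]
  have main : ∀ j, j ≤ 2 → 1 ≤ j → (2 ^ (2 * t + 1) - j) / 2 ^ m % 4 = 0 ∨
      (2 ^ (2 * t + 1) - j) / 2 ^ m % 4 = 3 := by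
    intro j hj2 hj1
    rcases Nat.lt_or_ge m (2 * t + 1) with hl | hl
    · right
      obtain ⟨d, hd⟩ : ∃ d, 2 * t + 1 = m + (d + 2) := ⟨2 * t + 1 - m - 2, by omega⟩
      have hm2 : 2 ≤ 2 ^ m := by
        calc 2 = 2 ^ 1 := rfl
          _ ≤ _ := Nat.pow_le_pow_right (by norm_num) (by omega)
      have hd0 := hp d
      have e2 : 2 ^ (2 * t + 1) = 2 ^ m * (4 * 2 ^ d) := by rw [hd]; ring
      obtain ⟨c, hc⟩ : ∃ c, 2 ^ d = c + 1 := ⟨2 ^ d - 1, by omega⟩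
      have e3 : 2 ^ (2 * t + 1) - j = (2 ^ m - j) + 2 ^ m * (4 * c + 3) := by
        rw [e2, hc]
        have : 2 ^ m * (4 * (c + 1)) = 2 ^ m * (4 * c + 3) + 2 ^ m := by ring
        omega
      rw [e3, Nat.add_mul_div_left _ _ (hp m), Nat.div_eq_of_lt (by omega)]
      omega
    · left
      have : 2 ^ (2 * t + 1) ≤ 2 ^ m := Nat.pow_le_pow_right (by norm_num) hl
      rw [Nat.div_eq_of_lt (by omega)]
  rw [not_or]
  exact ⟨hnot _ (main 2 (by omega) (by omega)) (by omega),
    hnot _ (main 1 (by omega) (by omega)) (by omega)⟩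

/-- Enumeration of the free columns. -/
theorem free_enum (M : ℕ) : ∃ (n : ℕ) (c : ℕ → ℕ), n % 2 = 1 ∧ (∀ i < M, Mu (c i) n ∧ 2 ^ n < c i ∧ c i < 3 * 2 ^ n) ∧
    (∀ i, i + 1 < M → c i < c (i + 1)) ∧
    (∀ i, i + 1 < M → ∀ X, c i < X → X < c (i + 1) → ¬ Mu X n) ∧
    (∀ X, 2 ^ n < X → X < c 0 → ¬ Mu X n) := by
  classical
  let n := 2 * M + 1
  let p : ℕ → Prop := fun X => 2 ^ n < X ∧ (Mu X n ∨ 3 * 2 ^ n ≤ X)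
  have hinf : (Set.ofPred p).Infinite := by
    apply Set.infinite_of_injective_forall_mem (f := fun k => 3 * 2 ^ n + k)
    · intro a b h; simpa using h
    · intro k
      have : 0 < 2 ^ n := by positivity
      exact ⟨by omega, Or.inr (by omega)⟩
  have hlt : ∀ i < M, Nat.nth p i < 3 * 2 ^ n := by
    have key : ∀ i, i < M → Nat.nth p i ≤ 2 ^ n + (2 ^ (2 * i + 1) - 1) := by
      intro i
      induction i with
      | zero =>
        intro hi
        have hm : p (2 ^ n + (2 ^ (2 * 0 + 1) - 1)) :=
          ⟨by omega, Or.inl (free_column (by omega) (by omega))⟩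
        have := Nat.nth_count hm
        rw [← this]
        exact Nat.nth_monotone hinf (Nat.zero_le _)
      | succ i ih =>
        intro hi
        have h0 := ih (by omega)
        have hpw : 2 ^ (2 * (i + 1) + 1) = 4 * 2 ^ (2 * i + 1) := by ring
        have hpos : 0 < 2 ^ (2 * i + 1) := by positivity
        have hm : p (2 ^ n + (2 ^ (2 * (i + 1) + 1) - 1)) :=
          ⟨by omega, Or.inl (free_column (by omega) (by omega))⟩
        have h2 := Nat.nth_count hm
        rw [← h2]
        apply Nat.nth_monotone hinf
        have h3 : Nat.nth p i < Nat.nth p (Nat.count p (2 ^ n + (2 ^ (2 * (i + 1) + 1) - 1))) := by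
          rw [h2]; omega
        exact (Nat.nth_lt_nth hinf).1 h3
    intro i hi
    have h1 := key i hi
    have h2 : 2 ^ (2 * i + 1) ≤ 2 ^ n := Nat.pow_le_pow_right (by norm_num) (by omega)
    have h3 : 0 < 2 ^ (2 * i + 1) := by positivity
    omega
  refine ⟨n, Nat.nth p, by omega, ?_, ?_, ?_, ?_⟩
  · intro i hi
    have h1 : p (Nat.nth p i) := Nat.nth_mem_of_infinite hinf i
    have h2 := hlt i hi
    refine ⟨?_, h1.1, h2⟩
    rcases h1.2 with h | h
    · exact h
    · omega
  · intro i _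
    exact Nat.nth_strictMono hinf (by omega)
  · intro i hi X h1 h2 hM
    have hpX : p X := ⟨by
      have : p (Nat.nth p i) := Nat.nth_mem_of_infinite hinf i
      have := this.1
      omega, Or.inl hM⟩
    have h3 := Nat.nth_count hpX
    rw [← h3] at h1 h2
    have a := (Nat.nth_lt_nth hinf).1 h1
    have b := (Nat.nth_lt_nth hinf).1 h2
    omega
  · intro X h1 h2 hM
    have hpX : p X := ⟨h1, Or.inl hM⟩
    have h3 := Nat.nth_count hpX
    rw [← h3] at h2
    have b := (Nat.nth_lt_nth hinf).1 h2
    omega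

theorem const_between (d : ℕ → ℕ) (a b : ℕ) (hab : a ≤ b)
    (h : ∀ X, a ≤ X → X < b → d X = d (X + 1)) : d a = d b := by
  induction b, hab using Nat.le_induction with
  | base => rfl
  | succ b hb ih =>
    rw [ih (fun X h1 h2 => h X h1 (by omega)), h b hb (by omega)]

theorem hier_sound {W : List WT} (H : TilesZ (hier W)) (M : ℕ) : QuadSq W M := by
  obtain ⟨n, c, hn, hc, hc1, hc2, hc0⟩ := free_enum M
  obtain ⟨h, v, dh, dv, hcell, hhv⟩ := hier_window H (n + 3)
  have w : Win W (n + 3) h v dh dv :=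
    ⟨hcell, fun m hm X y => (hhv m hm X y).1, fun m hm X y => (hhv m hm X y).2⟩
  refine ⟨fun i j => (dh (c i - 1) (c j), dh (c i) (c j), dv (c i) (c j - 1), dv (c i) (c j)),
    ?_, ?_, ?_, ?_, ?_⟩
  · intro i j hi hj
    obtain ⟨a1, a2, a3⟩ := hc i hi
    obtain ⟨b1, b2, b3⟩ := hc j hj
    obtain ⟨X, hX⟩ : ∃ X, c i = X + 1 := ⟨c i - 1, by omega⟩
    obtain ⟨Y, hY⟩ : ∃ Y, c j = Y + 1 := ⟨c j - 1, by omega⟩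
    simp only [hX, hY, Nat.add_sub_cancel] at *
    exact w.free a1 b1 a2 a3 b2 b3
  · intro i j hi hj
    obtain ⟨a1, a2, a3⟩ := hc i (by omega)
    obtain ⟨a4, a5, a6⟩ := hc (i + 1) hi
    obtain ⟨b1, b2, b3⟩ := hc j hj
    have h1 := hc1 i hi
    obtain ⟨Y, hY⟩ : ∃ Y, c j = Y + 1 := ⟨c j - 1, by omega⟩
    simp only [hY] at *
    refine const_between (fun X => dh X (Y + 1)) (c i) (c (i + 1) - 1) (by omega) ?_
    intro X h2 h3
    exact w.pass_h (hc2 i hi _ (by omega) (by omega)) b1 (by omega) (by omega) b2 b3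
  · intro i j hi hj
    obtain ⟨a1, a2, a3⟩ := hc j (by omega)
    obtain ⟨a4, a5, a6⟩ := hc (j + 1) hj
    obtain ⟨b1, b2, b3⟩ := hc i hi
    have h1 := hc1 j hj
    obtain ⟨X, hX⟩ : ∃ X, c i = X + 1 := ⟨c i - 1, by omega⟩
    simp only [hX] at *
    refine const_between (fun Y => dv (X + 1) Y) (c j) (c (j + 1) - 1) (by omega) ?_
    intro Y h2 h3
    exact w.pass_v b1 (hc2 j hj _ (by omega) (by omega)) b2 b3 (by omega) (by omega)
  · intro j hj
    obtain ⟨a4, a5, a6⟩ := hc 0 (by omega)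
    obtain ⟨b1, b2, b3⟩ := hc j hj
    obtain ⟨Y, hY⟩ : ∃ Y, c j = Y + 1 := ⟨c j - 1, by omega⟩
    simp only [hY] at *
    refine Eq.trans (Eq.symm (const_between (fun X => dh X (Y + 1)) (2 ^ n) (c 0 - 1)
      (by omega) ?_)) (w.wall_h hn b2 b3)
    intro X h2 h3
    exact w.pass_h (hc0 _ (by omega) (by omega)) b1 (by omega) (by omega) b2 b3
  · intro i hi
    obtain ⟨a4, a5, a6⟩ := hc 0 (by omega)
    obtain ⟨b1, b2, b3⟩ := hc i hi
    obtain ⟨X, hX⟩ : ∃ X, c i = X + 1 := ⟨c i - 1, by omega⟩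
    simp only [hX] at *
    refine Eq.trans (Eq.symm (const_between (fun Y => dv (X + 1) Y) (2 ^ n) (c 0 - 1)
      (by omega) ?_)) (w.wall_v hn b2 b3)
    intro Y h2 h3
    exact w.pass_v b1 (hc0 _ (by omega) (by omega)) b2 b3 (by omega) (by omega)

/-! ### Completeness: building a hierarchical tiling from a quadrant tiling -/

theorem exists_levfun : ∃ lev od : ℕ → ℕ, ∀ Y, Y = 0 ∨ Y = 2 ^ lev Y * (2 * od Y + 1) := by
  have : ∀ Y : ℕ, ∃ m y, Y = 0 ∨ Y = 2 ^ m * (2 * y + 1) := by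
    intro Y
    by_cases h : Y = 0
    · exact ⟨0, 0, Or.inl h⟩
    · obtain ⟨m, y, hh⟩ := exists_lev h
      exact ⟨m, y, Or.inr hh⟩
  choose lev od h using this
  exact ⟨lev, od, h⟩

theorem exists_sig (X : ℕ) : ∃ f g : ℕ → Bool, (∀ L, SigRule L X f g) ∧
    ((∀ Y, ¬ RedH X Y) → ∀ Y, f Y = true) := by
  classical
  obtain ⟨lev, od, hl⟩ := exists_levfun
  let f : ℕ → Bool := fun Y => Nat.rec true
    (fun Y r => if RedH X (Y + 1) then decide (od (Y + 1) % 2 = 1) else r) Y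
  have hf : ∀ Y, f (Y + 1) = if RedH X (Y + 1) then decide (od (Y + 1) % 2 = 1) else f Y :=
    fun Y => rfl
  let g : ℕ → Bool := fun Y => decide (∃ Y', Y < Y' ∧ RedH X Y' ∧ od Y' % 2 = 1 ∧
    ∀ Z, Y < Z → Z < Y' → ¬ RedH X Z)
  refine ⟨f, g, fun L Y _ => ⟨fun m y hm hy he => ?_, fun hr => ?_⟩, fun hn Y => ?_⟩
  · have hr : RedH X (Y + 1) := ⟨m, y, hm, hy, he⟩
    have ho : od (Y + 1) = y := by
      rcases hl (Y + 1) with h | h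
      · omega
      · exact (lev_unique (h.symm.trans hy)).2
    refine ⟨by rw [hf, if_pos hr, ho], ?_⟩
    simp only [g]
    rw [decide_eq_decide]
    constructor
    · rintro ⟨Y', h1, h2, h3, h4⟩
      by_cases hc : Y' = Y + 1
      · subst hc; rw [ho] at h3; exact h3
      · exact absurd hr (h4 _ (by omega) (by omega))
    · intro h
      exact ⟨Y + 1, by omega, hr, by rw [ho]; exact h, fun Z h1 h2 => by omega⟩
  · refine ⟨by rw [hf, if_neg hr], ?_⟩
    simp only [g]
    rw [decide_eq_decide]
    constructor
    · rintro ⟨Y', h1, h2, h3, h4⟩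
      refine ⟨Y', by omega, h2, h3, fun Z hz1 hz2 => ?_⟩
      by_cases hc : Z = Y + 1
      · subst hc; exact hr
      · exact h4 Z (by omega) hz2
    · rintro ⟨Y', h1, h2, h3, h4⟩
      refine ⟨Y', ?_, h2, h3, fun Z hz1 hz2 => h4 Z (by omega) hz2⟩
      by_contra hc
      have : Y' = Y + 1 := by omega
      exact hr (this ▸ h2)
  · induction Y with
    | zero => rfl
    | succ Y ih => rw [hf, if_neg (hn _), ih]

theorem free_iff' {X : ℕ} {f g : ℕ → Bool} (h : ∀ L, SigRule L X f g)
    (h2 : (∀ Y, ¬ RedH X Y) → ∀ Y, f Y = true) {Y : ℕ} (hr : ¬ RedH X (Y + 1)) :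
    (f Y = false ∧ g Y = true) ↔ ∃ m, Mu X m ∧ ph m (Y + 1) := by
  by_cases hm : ∃ m, Mu X m
  · obtain ⟨m, hm⟩ := hm
    rw [(h (Y + 1 + 2 * 2 ^ m + 1)).free_iff hm hr (by omega)]
    constructor
    · intro h; exact ⟨m, hm, h⟩
    · rintro ⟨m', h1, h3⟩; rwa [hm.unique h1]
  · have : f Y = true := by
      apply h2
      rintro Z ⟨m, y, a, b, c⟩
      obtain ⟨m', -, h'⟩ := exists_Mu a c
      exact hm ⟨m', h'⟩
    constructor
    · intro h; rw [this] at h; simp at h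
    · rintro ⟨m, h, -⟩; exact absurd ⟨m, h⟩ hm

theorem pred_div_mul {q : ℕ} (hq : 0 < q) (P : ℕ) : (q * (P + 1) - 1) / q = P := by
  rw [Nat.div_eq_iff hq]
  constructor
  · rw [mul_add, mul_one, mul_comm]; omega
  · rw [mul_add, mul_one, mul_comm P q]

theorem bt_model_lt (a c x y : ℕ) (hac : c < a) :
    BV (mdlN c (2 ^ a * (2 * x + 1) - 1) y) (mdlN c (2 ^ a * (2 * x + 1)) y)
      (mdlN a (2 ^ c * (2 * y + 1) - 1) x) (mdlN a (2 ^ c * (2 * y + 1)) x) := by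
  obtain ⟨d, rfl⟩ : ∃ d, a = c + (d + 1) := ⟨a - c - 1, by omega⟩
  have hq : 0 < 2 ^ c := by positivity
  have e1 : 2 ^ (c + (d + 1)) * (2 * x + 1) = 2 ^ c * (2 * (2 ^ d * (2 * x + 1))) := by ring
  obtain ⟨P, hP⟩ : ∃ P, 2 ^ d * (2 * x + 1) = P + 1 :=
    ⟨2 ^ d * (2 * x + 1) - 1, by have : 0 < 2 ^ d * (2 * x + 1) := by positivity
                                 omega⟩
  have e2 : (2 ^ (c + (d + 1)) * (2 * x + 1) - 1) / 2 ^ c = 2 * P + 1 := by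
    rw [e1, hP, show 2 * (P + 1) = (2 * P + 1) + 1 by ring, pred_div_mul hq]
  have e3 : (2 ^ (c + (d + 1)) * (2 * x + 1)) / 2 ^ c = 2 * P + 2 := by
    rw [e1, hP, Nat.mul_div_cancel_left _ hq]; ring
  have e4 : (2 ^ c * (2 * y + 1)) / 2 ^ (c + (d + 1)) = y / 2 ^ d := by
    rw [pow_add, ← Nat.div_div_eq_div_mul, Nat.mul_div_cancel_left _ hq, pow_succ',
      ← Nat.div_div_eq_div_mul, show (2 * y + 1) / 2 = y by omega]
  have e5 : (2 ^ c * (2 * y + 1) - 1) / 2 ^ (c + (d + 1)) = y / 2 ^ d := by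
    rw [pow_add, ← Nat.div_div_eq_div_mul, pred_div_mul hq, pow_succ',
      ← Nat.div_div_eq_div_mul, show (2 * y) / 2 = y by omega]
  simp only [BV, mdlN, TE.lo, TE.hi, TE.b, TE.k, e2, e3, e4, e5, decide_eq_true_eq,
    decide_eq_false_iff_not, true_and]
  refine ⟨by omega, by omega, ?_, ?_⟩
  · rw [← decide_not, decide_eq_decide]; omega
  · intro h
    have hd : d = 0 := by
      rcases d with _ | d
      · rfl
      · rw [pow_succ] at hP
        have : 2 ^ d * 2 * (2 * x + 1) = 2 * (2 ^ d * (2 * x + 1)) := by ring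
        omega
    subst hd
    refine ⟨?_, by simp⟩
    rw [← decide_not, decide_eq_decide]; omega

theorem bt_model_eq (c x y : ℕ) :
    BX (mdlN c (2 ^ c * (2 * x + 1) - 1) y) (mdlN c (2 ^ c * (2 * x + 1)) y)
      (mdlN c (2 ^ c * (2 * y + 1) - 1) x) (mdlN c (2 ^ c * (2 * y + 1)) x) := by
  have hq : 0 < 2 ^ c := by positivity
  simp only [BX, mdlN, TE.lo, TE.hi, TE.b, TE.k, pred_div_mul hq, Nat.mul_div_cancel_left _ hq,
    decide_eq_true_eq, decide_eq_false_iff_not, decide_eq_decide]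
  refine ⟨?_, ?_, ?_, ?_, ?_, ?_, ?_, ?_, ?_, ?_, ?_, ?_, ?_⟩ <;> first | omega | trivial

theorem bt_model (a c x y : ℕ) :
    BT (mdlN c (2 ^ a * (2 * x + 1) - 1) y) (mdlN c (2 ^ a * (2 * x + 1)) y)
      (mdlN a (2 ^ c * (2 * y + 1) - 1) x) (mdlN a (2 ^ c * (2 * y + 1)) x) := by
  rcases Nat.lt_trichotomy a c with h | h | h
  · exact Or.inr (Or.inr (bt_model_lt c a y x h))
  · subst h; exact Or.inl (bt_model_eq a x y)
  · exact Or.inr (Or.inl (bt_model_lt a c x y h))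

open Classical in
/-- Number of columns of minimal level `m` in the current square up to `Z`. -/
def cnt (m Z : ℕ) : ℕ :=
  ((Finset.Ioc (2 ^ m * (4 * (Z / 2 ^ m / 4) + 1)) Z).filter fun Z' => Mu Z' m).card

theorem cnt_succ {m Z : ℕ} (h1 : ph m Z) (h2 : ph m (Z + 1)) :
    (Mu (Z + 1) m → cnt m (Z + 1) = cnt m Z + 1) ∧ (¬ Mu (Z + 1) m → cnt m (Z + 1) = cnt m Z) := by
  classical
  have hq : 0 < 2 ^ m := by positivity
  have e : (Z + 1) / 2 ^ m / 4 = Z / 2 ^ m / 4 := by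
    have a : (Z + 1) / 2 ^ m = Z / 2 ^ m ∨ (Z + 1) / 2 ^ m = Z / 2 ^ m + 1 := by
      rw [Nat.succ_div]; split_ifs <;> simp
    simp only [ph] at h1 h2
    omega
  have e2 : 2 ^ m * (4 * (Z / 2 ^ m / 4) + 1) ≤ Z := by
    refine le_trans (Nat.mul_le_mul_left _ ?_) (Nat.mul_div_le Z (2 ^ m))
    simp only [ph] at h1
    omega
  have e3 : Finset.Ioc (2 ^ m * (4 * (Z / 2 ^ m / 4) + 1)) (Z + 1) =
      insert (Z + 1) (Finset.Ioc (2 ^ m * (4 * (Z / 2 ^ m / 4) + 1)) Z) := by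
    ext t; simp only [Finset.mem_Ioc, Finset.mem_insert]; omega
  simp only [cnt, e, e3, Finset.filter_insert]
  constructor
  · intro h
    rw [if_pos h, Finset.card_insert_of_notMem]
    simp
  · intro h
    rw [if_neg h]

theorem cnt_zero (m k : ℕ) : cnt m (2 ^ m * (4 * k + 1)) = 0 := by
  have hq : 0 < 2 ^ m := by positivity
  rw [cnt, Nat.mul_div_cancel_left _ hq, show (4 * k + 1) / 4 = k by omega]
  simp

open Classical in
/-- Data transported along lines. -/
def Dd (hc : ℕ → ℕ → ℕ) (A B : ℕ) : ℕ :=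
  if h : ∃ m, Mu B m ∧ ph m A then hc (cnt h.choose A) (cnt h.choose (B - 1)) else 0

theorem Dd_pos (hc : ℕ → ℕ → ℕ) {A B m : ℕ} (h1 : Mu B m) (h2 : ph m A) :
    Dd hc A B = hc (cnt m A) (cnt m (B - 1)) := by
  have h : ∃ m, Mu B m ∧ ph m A := ⟨m, h1, h2⟩
  rw [Dd, dif_pos h, h.choose_spec.1.unique h1]

theorem Dd_neg (hc : ℕ → ℕ → ℕ) {A B : ℕ} (h : ¬ ∃ m, Mu B m ∧ ph m A) :
    Dd hc A B = 0 := by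
  rw [Dd, dif_neg h]

theorem ph_step {m X Y : ℕ} (hY : Mu Y m) (hr : ¬ RedH Y (X + 1)) : ph m X ↔ ph m (X + 1) := by
  have key : ∀ y, X + 1 ≠ 2 ^ m * (2 * y + 1) := fun y hy => hr ⟨m, y, hY.1, hy, hY.2.1⟩
  constructor
  · intro h
    by_contra hc
    obtain ⟨y, hy⟩ := ext_not_ph (m := m) (Y := X + 1) (Or.inl h) hc
    exact key y hy
  · intro h
    by_contra hc
    have hq : 0 < 2 ^ m := by positivity
    simp only [ph] at h hc
    rw [Nat.succ_div] at h
    split_ifs at h with hd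
    · obtain ⟨c, hc'⟩ := hd
      have e : X / 2 ^ m + 1 = c := by
        have : (X + 1) / 2 ^ m = c := by rw [hc', Nat.mul_div_cancel_left _ hq]
        rw [← this, Nat.succ_div, if_pos ⟨c, hc'⟩]
      refine key (c / 2) ?_
      rw [hc']; congr 1; omega
    · exact hc h

theorem Dd_pass (hc : ℕ → ℕ → ℕ) {X Y : ℕ} (hr1 : ¬ RedH (X + 1) Y) (hr2 : ¬ RedH Y (X + 1))
    (hf : ¬ ((∃ m, Mu Y m ∧ ph m (X + 1)) ∧ (∃ m, Mu (X + 1) m ∧ ph m Y))) :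
    Dd hc X Y = Dd hc (X + 1) Y := by
  by_cases hm : ∃ m, Mu Y m ∧ ph m X
  · obtain ⟨m, hY, hX⟩ := hm
    have hX' := (ph_step hY hr2).1 hX
    rw [Dd_pos hc hY hX, Dd_pos hc hY hX']
    rw [(cnt_succ hX hX').2]
    intro hmu
    refine hf ⟨⟨m, hY, hX'⟩, m, hmu, ?_⟩
    by_contra hp
    obtain ⟨y, hy⟩ := ext_not_ph hY.2.1 hp
    exact hr1 ⟨m, y, hY.1, hy, hmu.2.1⟩
  · rw [Dd_neg hc hm, Dd_neg]
    rintro ⟨m, h1, h2⟩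
    exact hm ⟨m, h1, (ph_step h1 hr2).2 h2⟩

theorem Dd_wall (hc : ℕ → ℕ → ℕ) (h0 : ∀ j, hc 0 j = 0) {a x Y : ℕ} (ha : a % 2 = 1)
    (hx : x % 2 = 0) (hY : extz a Y) : Dd hc (2 ^ a * (2 * x + 1)) Y = 0 := by
  by_cases hm : ∃ m, Mu Y m ∧ ph m (2 ^ a * (2 * x + 1))
  · obtain ⟨m, h1, h2⟩ := hm
    rw [Dd_pos hc h1 h2]
    have hma : m ≤ a := by
      by_contra hc
      exact h1.2.2 a (by omega) ha hY
    obtain ⟨d, rfl⟩ : ∃ d, a = m + d := ⟨a - m, by omega⟩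
    have hm1 := h1.1
    rcases d with _ | _ | d
    · rw [add_zero, show 2 * x + 1 = 4 * (x / 2) + 1 by omega, cnt_zero, h0]
    · omega
    · exfalso
      have hq : 0 < 2 ^ m := by positivity
      have : 2 ^ (m + (d + 1 + 1)) * (2 * x + 1) = 2 ^ m * (4 * (2 ^ d * (2 * x + 1))) := by ring
      rw [ph, this, Nat.mul_div_cancel_left _ hq] at h2
      omega
  · exact Dd_neg hc hm

theorem Dd_free (hc : ℕ → ℕ → ℕ) {X Y : ℕ} (_hr1 : ¬ RedH (X + 1) (Y + 1))
    (hr2 : ¬ RedH (Y + 1) (X + 1))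
    {m : ℕ} (h1 : Mu (X + 1) m) (h2 : Mu (Y + 1) m) (h4 : ph m (X + 1)) :
    Dd hc X (Y + 1) = hc (cnt m X) (cnt m Y) ∧
    Dd hc (X + 1) (Y + 1) = hc (cnt m X + 1) (cnt m Y) := by
  have h3 := (ph_step h2 hr2).2 h4
  rw [Dd_pos hc h2 h3, Dd_pos hc h2 h4, (cnt_succ h3 h4).1 h1]
  exact ⟨rfl, rfl⟩

theorem hier_complete {W : List WT} (H : QuadAll W) : TilesZ (hier W) := by
  obtain ⟨q, hq, he, hn, hw0, hs0⟩ := H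
  obtain ⟨lev, od, hl⟩ := exists_levfun
  have hl' : ∀ X, X + 1 = 2 ^ lev (X + 1) * (2 * od (X + 1) + 1) := by
    intro X
    rcases hl (X + 1) with h | h
    · omega
    · exact h
  choose f g hfg hf0 using exists_sig
  let v : ℕ → ℕ → BE := fun X Y => (mdlN (lev X) Y (od X), f X Y, g X Y,
    decide (Y % 2 = 0), decide (X % 2 = 1))
  let hc : ℕ → ℕ → ℕ := fun i j => (q i j).1
  let vc : ℕ → ℕ → ℕ := fun j i => (q i j).2.2.1
  have hred : ∀ X Y, red (v (Y + 1) X).1 (v (Y + 1) (X + 1)).1 ↔ RedH (X + 1) (Y + 1) := by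
    intro X Y
    refine (red_mdlN _ _ _).trans ⟨fun h => ⟨_, _, h.1, hl' Y, h.2⟩, ?_⟩
    rintro ⟨m, y, h1, h2, h3⟩
    rw [hl' Y] at h2
    have := (lev_unique h2).1
    rw [this]; exact ⟨h1, h3⟩
  have hbt : ∀ X Y, BT (v (Y + 1) X).1 (v (Y + 1) (X + 1)).1 (v (X + 1) Y).1
      (v (X + 1) (Y + 1)).1 := by
    intro X Y
    have := bt_model (lev (X + 1)) (lev (Y + 1)) (od (X + 1)) (od (Y + 1))
    rw [← hl' X, ← hl' Y] at this
    exact this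
  have hpar : ∀ X Y, parOK (v (Y + 1) X) (v (Y + 1) (X + 1)) (v (X + 1) Y)
      (v (X + 1) (Y + 1)) := by
    intro X Y
    refine ⟨?_, rfl, ?_, rfl, ?_, ?_, ?_⟩
    · simp only [v, BE.q1]; rw [← decide_not, decide_eq_decide]; omega
    · simp only [v, BE.q1]; rw [← decide_not, decide_eq_decide]; omega
    · simp only [v, BE.q1, BE.q2]; rw [decide_eq_decide]; omega
    · simp only [v, BE.q1, BE.q2]; rw [decide_eq_decide]; omega
    · intro h1 h2
      simp only [v, BE.q1, BE.q2, decide_eq_true_eq] at h1 h2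
      have a1 : lev (X + 1) = 0 ∧ od (X + 1) = X / 2 := by
        apply lev_unique; rw [← hl']; omega
      have a2 : lev (Y + 1) = 0 ∧ od (Y + 1) = Y / 2 := by
        apply lev_unique; rw [← hl']; omega
      have := bt_model_eq 0 (od (X + 1)) (od (Y + 1))
      have b1 : 2 ^ 0 * (2 * od (X + 1) + 1) = X + 1 := by omega
      have b2 : 2 ^ 0 * (2 * od (Y + 1) + 1) = Y + 1 := by omega
      rw [b1, b2] at this
      simp only [v, a1.1, a2.1]
      exact ⟨this, by simp [mdlN]⟩
  have hsig : ∀ X Y, sig (v (Y + 1) X) (v (Y + 1) (X + 1)) (v (X + 1) Y)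
      (v (X + 1) (Y + 1)) := by
    intro X Y
    have := hfg (X + 1) (Y + 2) Y (by omega)
    constructor
    · intro hr
      have h2 := (red_mdlN _ _ _).1 hr
      exact this.1 _ _ h2.1 (hl' Y) h2.2
    · intro hr
      rw [hred] at hr
      exact this.2 hr
  have hfrs : ∀ X Y, ¬ RedH (X + 1) (Y + 1) →
      (frs (v (X + 1) Y) ↔ ∃ m, Mu (X + 1) m ∧ ph m (Y + 1)) := by
    intro X Y hr
    exact free_iff' (hfg (X + 1)) (hf0 (X + 1)) hr
  have hcol : ∀ A B, Dd hc A B ∈ cols W := by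
    intro A B
    rw [Dd]
    split_ifs with h
    · exact (cols_of_mem (hq _ _)).1
    · exact zero_mem_cols W
  have vcol : ∀ A B, Dd vc A B ∈ cols W := by
    intro A B
    rw [Dd]
    split_ifs with h
    · exact (cols_of_mem (hq _ _)).2.2.1
    · exact zero_mem_cols W
  refine hier_sq (fun X Y => v Y X) v (fun X Y => Dd hc X Y) (fun X Y => Dd vc Y X) ?_
  intro X Y
  refine ⟨⟨hbt X Y, hpar X Y, hsig X Y, hsig Y X⟩, ?_, ?_, ?_, ?_, hcol _ _, hcol _ _,
    vcol _ _, vcol _ _⟩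
  · rintro ⟨h1, h2, h3, h4⟩
    simp only [hred] at h1 h2
    rw [hfrs _ _ h2] at h3
    rw [hfrs _ _ h1] at h4
    obtain ⟨m, h5, h6⟩ := h3
    obtain ⟨m', h7, h8⟩ := h4
    have e : m = m' := by
      apply le_antisymm
      · by_contra hlt
        exact h5.2.2 m' (by omega) h7.1 (Or.inr h8)
      · by_contra hlt
        exact h7.2.2 m (by omega) h5.1 (Or.inr h6)
    subst e
    have A := Dd_free hc h1 h2 h7 h5 h6
    have B := Dd_free vc h2 h1 h5 h7 h8
    rw [A.1, A.2, B.1, B.2]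
    have := hq (cnt m X) (cnt m Y)
    simp only [hc, vc]
    rw [← he, ← hn]
    exact this
  · rintro ⟨h1, h2, h3⟩
    simp only [hred] at h1 h2
    rw [hfrs _ _ h2, hfrs _ _ h1] at h3
    exact ⟨Dd_pass hc h1 h2 h3, Dd_pass vc h2 h1 (fun h => h3 ⟨h.2, h.1⟩)⟩
  · intro hr hb
    have h2 := (red_mdlN _ _ _).1 hr
    have := Dd_wall hc hw0 (x := od (X + 1)) h2.1 (by simpa [v, mdlN, TE.b] using hb) h2.2
    rwa [← hl'] at this
  · intro hr hb
    have h2 := (red_mdlN _ _ _).1 hr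
    have := Dd_wall vc hs0 (x := od (Y + 1)) h2.1 (by simpa [v, mdlN, TE.b] using hb) h2.2
    rwa [← hl'] at this

/-! ### Rhombus geometry -/

def det2 (a b : Pt) : ℝ := a 0 * b 1 - a 1 * b 0

@[simp] theorem det2_add_left (a b c : Pt) : det2 (a + b) c = det2 a c + det2 b c := by
  simp [det2]; ring
@[simp] theorem det2_add_right (a b c : Pt) : det2 a (b + c) = det2 a b + det2 a c := by
  simp [det2]; ring
@[simp] theorem det2_sub_left (a b c : Pt) : det2 (a - b) c = det2 a c - det2 b c := by
  simp [det2]; ring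
@[simp] theorem det2_sub_right (a b c : Pt) : det2 a (b - c) = det2 a b - det2 a c := by
  simp [det2]; ring
@[simp] theorem det2_smul_left (t : ℝ) (a b : Pt) : det2 (t • a) b = t * det2 a b := by
  simp [det2]; ring
@[simp] theorem det2_smul_right (t : ℝ) (a b : Pt) : det2 a (t • b) = t * det2 a b := by
  simp [det2]; ring
@[simp] theorem det2_neg_left (a b : Pt) : det2 (-a) b = - det2 a b := by
  simp [det2]; ring
@[simp] theorem det2_neg_right (a b : Pt) : det2 a (-b) = - det2 a b := by
  simp [det2]; ring
@[simp] theorem det2_self (a : Pt) : det2 a a = 0 := by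
  simp [det2]; ring
theorem det2_swap (a b : Pt) : det2 a b = - det2 b a := by
  simp [det2]; ring

theorem det2_ne_zero {u v : Pt} (h : LinearIndependent ℝ ![u, v]) : det2 u v ≠ 0 := by
  intro h0
  rw [LinearIndependent.pair_iff] at h
  have h0' : u 0 * v 1 - u 1 * v 0 = 0 := h0
  have a1 := h (v 1) (- u 1) (by
    ext i
    fin_cases i
    · simp; linarith
    · simp; ring)
  have a2 := h (v 0) (- u 0) (by
    ext i
    fin_cases i
    · simp; ring
    · simp; linarith)
  have hu : u = 0 := by
    ext i
    fin_cases i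
    · simpa using a2.2
    · simpa using a1.2
  have := h 1 0 (by simp [hu])
  simp at this

theorem det2_expand {u v : Pt} (h : det2 u v ≠ 0) (p : Pt) :
    p = (det2 p v / det2 u v) • u + (det2 u p / det2 u v) • v := by
  have key : det2 u v • p = det2 p v • u + det2 u p • v := by
    ext i
    fin_cases i
    · simp [det2]; ring
    · simp [det2]; ring
  calc p = (det2 u v)⁻¹ • (det2 u v • p) := by rw [smul_smul, inv_mul_cancel₀ h, one_smul]
    _ = _ := by
      rw [key, smul_add, smul_smul, smul_smul, div_eq_inv_mul, div_eq_inv_mul]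

namespace Rhombus

/-- Outward offsets of the four edges (twice the vector from the center to the midpoint). -/
def off (r : Rhombus) : Fin 4 → Pt := ![-r.v, r.u, r.v, -r.u]

theorem off_two (r : Rhombus) (i : Fin 4) : r.off (i + 2) = - r.off i := by
  fin_cases i <;> simp [off]

theorem off_three (r : Rhombus) (i : Fin 4) : r.off (i + 3) = - r.off (i + 1) := by
  fin_cases i <;> simp [off]

theorem det_off (r : Rhombus) (i : Fin 4) : det2 (r.off i) (r.off (i + 1)) = det2 r.u r.v := by
  fin_cases i
  · simp [off]; rw [det2_swap]; simp
  · simp [off]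
  · simp [off]; rw [det2_swap]; simp
  · simp [off]

theorem IsValid.det_ne {r : Rhombus} (h : r.IsValid) (i : Fin 4) :
    det2 (r.off i) (r.off (i + 1)) ≠ 0 := by
  rw [det_off]; exact det2_ne_zero h.1

end Rhombus

/-- The segment of center `m` and direction `d`. -/
def Eseg (m d : Pt) : Set Pt := {p | ∃ t : ℝ, |t| ≤ 1 / 2 ∧ p = m + t • d}

theorem Eseg_eq (m d : Pt) : Eseg m d = segment ℝ (m - (1 / 2 : ℝ) • d) (m + (1 / 2 : ℝ) • d) := by
  ext p
  rw [segment_eq_image']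
  constructor
  · rintro ⟨t, ht, rfl⟩
    rw [abs_le] at ht
    refine ⟨t + 1 / 2, ⟨by linarith, by linarith⟩, ?_⟩
    module
  · rintro ⟨t, ⟨h1, h2⟩, rfl⟩
    refine ⟨t - 1 / 2, by rw [abs_le]; constructor <;> linarith, ?_⟩
    module

theorem Eseg_inj {m d m' d' : Pt} (hd : d ≠ 0) (h : Eseg m d = Eseg m' d') :
    m = m' ∧ (d = d' ∨ d = - d') := by
  have h1 : m + (1 / 2 : ℝ) • d ∈ Eseg m' d' := h ▸ ⟨1 / 2, by norm_num, rfl⟩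
  have h2 : m + (-1 / 2 : ℝ) • d ∈ Eseg m' d' := h ▸ ⟨-1 / 2, by norm_num [abs_le], rfl⟩
  have h3 : m' + (1 / 2 : ℝ) • d' ∈ Eseg m d := h ▸ ⟨1 / 2, by norm_num, rfl⟩
  have h4 : m' + (-1 / 2 : ℝ) • d' ∈ Eseg m d := h ▸ ⟨-1 / 2, by norm_num [abs_le], rfl⟩
  obtain ⟨a, ha, e1⟩ := h1
  obtain ⟨b, hb, e2⟩ := h2
  obtain ⟨c, hc, e3⟩ := h3
  obtain ⟨e, he, e4⟩ := h4
  have f1 : d = (a - b) • d' := by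
    have : d = (m + (1 / 2 : ℝ) • d) - (m + (-1 / 2 : ℝ) • d) := by module
    rw [this, e1, e2]; module
  have f2 : d' = (c - e) • d := by
    have : d' = (m' + (1 / 2 : ℝ) • d') - (m' + (-1 / 2 : ℝ) • d') := by module
    rw [this, e3, e4]; module
  have f3 : (a - b) * (c - e) = 1 := by
    have : (((a - b) * (c - e)) - 1) • d = 0 := by
      rw [sub_smul, mul_smul, one_smul, ← f2, ← f1, sub_self]
    rcases smul_eq_zero.1 this with h | h
    · linarith
    · exact absurd h hd
  rw [abs_le] at ha hb hc he
  have hab : a + b = 0 ∧ (a - b = 1 ∨ a - b = -1) := by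
    rcases lt_or_ge (a - b) 0 with hs | hs
    · have : a - b = -1 := by nlinarith
      exact ⟨by linarith, Or.inr this⟩
    · have : a - b = 1 := by nlinarith
      exact ⟨by linarith, Or.inl this⟩
  constructor
  · have : (2 : ℝ) • m = (2 : ℝ) • m' := by
      have e : (2 : ℝ) • m = (m + (1 / 2 : ℝ) • d) + (m + (-1 / 2 : ℝ) • d) := by module
      rw [e, e1, e2]
      have : m' + a • d' + (m' + b • d') = (2 : ℝ) • m' + (a + b) • d' := by module
      rw [this, hab.1]; simp
    exact smul_right_injective Pt (by norm_num : (2 : ℝ) ≠ 0) this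
  · rcases hab.2 with h | h
    · left; rw [f1, h, one_smul]
    · right; rw [f1, h]; simp

namespace Rhombus

def mid (r : Rhombus) (i : Fin 4) : Pt := r.center + (1 / 2 : ℝ) • r.off i

theorem edge_eq (r : Rhombus) (i : Fin 4) : r.edge i = Eseg (r.mid i) (r.off (i + 1)) := by
  rw [Eseg_eq]
  fin_cases i
  · change segment ℝ r.pos (r.pos + r.u) =
      segment ℝ (r.center + (1 / 2 : ℝ) • (-r.v) - (1 / 2 : ℝ) • r.u)
        (r.center + (1 / 2 : ℝ) • (-r.v) + (1 / 2 : ℝ) • r.u)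
    unfold center
    congr 1 <;> module
  · change segment ℝ (r.pos + r.u) (r.pos + r.u + r.v) =
      segment ℝ (r.center + (1 / 2 : ℝ) • r.u - (1 / 2 : ℝ) • r.v)
        (r.center + (1 / 2 : ℝ) • r.u + (1 / 2 : ℝ) • r.v)
    unfold center
    congr 1 <;> module
  · change segment ℝ (r.pos + r.u + r.v) (r.pos + r.v) =
      segment ℝ (r.center + (1 / 2 : ℝ) • r.v - (1 / 2 : ℝ) • (-r.u))
        (r.center + (1 / 2 : ℝ) • r.v + (1 / 2 : ℝ) • (-r.u))
    unfold center
    congr 1 <;> module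
  · change segment ℝ (r.pos + r.v) r.pos =
      segment ℝ (r.center + (1 / 2 : ℝ) • (-r.u) - (1 / 2 : ℝ) • (-r.v))
        (r.center + (1 / 2 : ℝ) • (-r.u) + (1 / 2 : ℝ) • (-r.v))
    unfold center
    congr 1 <;> module

theorem mem_support_iff (r : Rhombus) (i : Fin 4) (p : Pt) : p ∈ r.support ↔
    ∃ s t : ℝ, |s| ≤ 1 / 2 ∧ |t| ≤ 1 / 2 ∧ p = r.center + s • r.off i + t • r.off (i + 1) := by
  have base : p ∈ r.support ↔ ∃ s t : ℝ, |s| ≤ 1 / 2 ∧ |t| ≤ 1 / 2 ∧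
      p = r.center + s • r.u + t • r.v := by
    constructor
    · rintro ⟨s, t, ⟨h1, h2⟩, ⟨h3, h4⟩, rfl⟩
      refine ⟨s - 1 / 2, t - 1 / 2, ?_, ?_, ?_⟩
      · rw [abs_le]; constructor <;> linarith
      · rw [abs_le]; constructor <;> linarith
      · simp only [center]; module
    · rintro ⟨s, t, h1, h2, rfl⟩
      rw [abs_le] at h1 h2
      refine ⟨s + 1 / 2, t + 1 / 2, ⟨by linarith, by linarith⟩, ⟨by linarith, by linarith⟩, ?_⟩
      simp only [center]; module
  rw [base]
  fin_cases i
  · constructor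
    · rintro ⟨s, t, h1, h2, rfl⟩
      exact ⟨-t, s, by rwa [abs_neg], h1, by simp [off]; module⟩
    · rintro ⟨s, t, h1, h2, rfl⟩
      exact ⟨t, -s, h2, by rwa [abs_neg], by simp [off]; module⟩
  · constructor
    · rintro ⟨s, t, h1, h2, rfl⟩
      exact ⟨s, t, h1, h2, by simp [off]⟩
    · rintro ⟨s, t, h1, h2, rfl⟩
      exact ⟨s, t, h1, h2, by simp [off]⟩
  · constructor
    · rintro ⟨s, t, h1, h2, rfl⟩
      exact ⟨t, -s, h2, by rwa [abs_neg], by simp [off]; module⟩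
    · rintro ⟨s, t, h1, h2, rfl⟩
      exact ⟨-t, s, by rwa [abs_neg], h1, by simp [off]; module⟩
  · constructor
    · rintro ⟨s, t, h1, h2, rfl⟩
      exact ⟨-s, -t, by rwa [abs_neg], by rwa [abs_neg], by simp [off]⟩
    · rintro ⟨s, t, h1, h2, rfl⟩
      exact ⟨-s, -t, by rwa [abs_neg], by rwa [abs_neg], by simp [off]⟩

def vert (r : Rhombus) (i : Fin 4) : Pt :=
  r.center + (1 / 2 : ℝ) • r.off i + (1 / 2 : ℝ) • r.off (i + 1)

theorem exists_vert {r : Rhombus} {p : Pt} (h : p ∈ r.vertices) : ∃ i, p = r.vert i := by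
  rcases h with h | h | h | h
  · exact ⟨3, by rw [h]; simp [vert, off, center]; module⟩
  · exact ⟨0, by rw [h]; simp [vert, off, center]; module⟩
  · exact ⟨2, by rw [h]; simp [vert, off, center]; module⟩
  · exact ⟨1, by rw [h]; simp [vert, off, center]; module⟩

theorem vert_mem_edge (r : Rhombus) (i : Fin 4) : r.vert i ∈ r.edge i := by
  rw [edge_eq]; exact ⟨1 / 2, by norm_num, rfl⟩

theorem edge_subset (r : Rhombus) (i : Fin 4) : r.edge i ⊆ r.support := by
  intro p hp
  rw [edge_eq] at hp
  obtain ⟨t, ht, rfl⟩ := hp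
  exact (r.mem_support_iff i _).2 ⟨1 / 2, t, by norm_num, ht, rfl⟩

theorem mid_mem_edge (r : Rhombus) (i : Fin 4) : r.mid i ∈ r.edge i := by
  rw [edge_eq]; exact ⟨0, by norm_num, by simp⟩

theorem center_mem (r : Rhombus) : r.center ∈ r.support :=
  (r.mem_support_iff 0 _).2 ⟨0, 0, by norm_num, by norm_num, by simp⟩

theorem mid_mem (r : Rhombus) (i : Fin 4) : r.mid i ∈ r.support :=
  r.edge_subset i (r.mid_mem_edge i)

theorem vert_mem (r : Rhombus) (i : Fin 4) : r.vert i ∈ r.support :=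
  r.edge_subset i (r.vert_mem_edge i)

theorem center_notMem_edge {r : Rhombus} (h : r.IsValid) (i : Fin 4) : r.center ∉ r.edge i := by
  intro hc
  rw [edge_eq] at hc
  obtain ⟨t, ht, e⟩ := hc
  have : det2 (r.center) (r.off (i + 1)) = det2 (r.mid i + t • r.off (i + 1)) (r.off (i + 1)) := by
    rw [← e]
  simp [mid] at this
  exact h.det_ne i this

theorem fin4_cases (i j : Fin 4) : j = i ∨ j = i + 1 ∨ j = i + 2 ∨ j = i + 3 := by
  revert i j; decide

theorem mid_edge {r : Rhombus} (h : r.IsValid) {i j : Fin 4} (hm : r.mid i ∈ r.edge j) : j = i := by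
  rw [edge_eq] at hm
  obtain ⟨t, ht, e⟩ := hm
  have hd := h.det_ne i
  have a1 : ∀ w, det2 (r.mid i) w = det2 (r.mid j + t • r.off (j + 1)) w := by intro w; rw [← e]
  rcases fin4_cases i j with rfl | rfl | rfl | rfl
  · rfl
  · exfalso
    have := a1 (r.off i)
    rw [add_assoc, show (1 : Fin 4) + 1 = 2 by rfl, off_two] at this
    simp [mid] at this
    rw [det2_swap] at this
    simp at this
    exact hd this
  · exfalso
    have := a1 (r.off (i + 1))
    rw [add_assoc, show (2 : Fin 4) + 1 = 3 by rfl, off_three] at this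
    simp [mid] at this
    rw [off_two] at this
    simp at this
    apply hd; linarith
  · exfalso
    have := a1 (r.off i)
    rw [add_assoc, show (3 : Fin 4) + 1 = 0 by rfl, add_zero] at this
    simp [mid] at this
    rw [off_three] at this
    simp at this
    rw [det2_swap] at this
    apply hd; linarith

theorem mid_ne_vert {r : Rhombus} (h : r.IsValid) (i j : Fin 4) : r.mid i ≠ r.vert j := by
  intro he
  have h1 := mid_edge h (i := i) (j := j) (he ▸ r.vert_mem_edge j)
  subst h1
  have : det2 (r.off j) (r.mid j) = det2 (r.off j) (r.vert j) := by rw [he]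
  simp [mid, vert] at this
  exact h.det_ne _ this

end Rhombus

/-! ### Local finiteness and heights -/

theorem exists_pos_le {k : ℕ} (f : Fin k → ℝ) (hf : ∀ i, 0 < f i) : ∃ ρ > 0, ∀ i, ρ ≤ f i := by
  have hs : 0 ≤ ∑ i, (f i)⁻¹ := Finset.sum_nonneg fun i _ => (inv_pos.2 (hf i)).le
  refine ⟨(∑ i, (f i)⁻¹ + 1)⁻¹, by positivity, fun i => ?_⟩
  rw [inv_le_comm₀ (by positivity) (hf i)]
  have := Finset.single_le_sum (f := fun i => (f i)⁻¹) (fun i _ => (inv_pos.2 (hf i)).le)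
    (Finset.mem_univ i)
  linarith

theorem exists_ge {k : ℕ} (f : Fin k → ℝ) : ∃ C > 0, ∀ i, f i ≤ C := by
  refine ⟨∑ i, |f i| + 1, ?_, fun i => ?_⟩
  · have : 0 ≤ ∑ i, |f i| := Finset.sum_nonneg fun i _ => abs_nonneg _
    linarith
  · have := Finset.single_le_sum (f := fun i => |f i|) (fun i _ => abs_nonneg _)
      (Finset.mem_univ i)
    linarith [le_abs_self (f i)]

theorem abs_coord_le (a : Pt) (i : Fin 2) : |a i| ≤ ‖a‖ := by
  simpa using PiLp.norm_apply_le a i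

theorem abs_det2_le (a b : Pt) : |det2 a b| ≤ 2 * ‖a‖ * ‖b‖ := by
  have h1 := abs_sub (a 0 * b 1) (a 1 * b 0)
  rw [abs_mul, abs_mul] at h1
  have h2 := mul_le_mul (abs_coord_le a 0) (abs_coord_le b 1) (abs_nonneg _) (norm_nonneg _)
  have h3 := mul_le_mul (abs_coord_le a 1) (abs_coord_le b 0) (abs_nonneg _) (norm_nonneg _)
  unfold det2
  linarith

section tiling

variable {k : ℕ} {shapes : Fin k → Rhombus} {x : Set Rhombus}

theorem IsTiling.cover (hx : IsTiling x) (p : Pt) : ∃ r ∈ x, p ∈ r.support := by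
  have : p ∈ ⋃ r ∈ x, r.support := hx.2.1 ▸ mem_univ p
  simpa using this

theorem IsTiling.center_notMem (hx : IsTiling x) {r s : Rhombus} (hr : r ∈ x) (hs : s ∈ x)
    (hne : r ≠ s) : s.center ∉ r.support := by
  intro hc
  have hm : s.center ∈ r.support ∩ s.support := ⟨hc, s.center_mem⟩
  rcases hx.2.2 r hr s hs hne with h | ⟨p, -, hp, h⟩ | ⟨e, -, ⟨j, rfl⟩, h⟩
  · rw [h] at hm; exact hm
  · rw [h] at hm
    obtain ⟨i, hi⟩ := Rhombus.exists_vert hp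
    have := s.vert_mem_edge i
    rw [← hi, ← (mem_singleton_iff.1 hm)] at this
    exact Rhombus.center_notMem_edge (hx.1 s hs) i this
  · rw [h] at hm
    exact Rhombus.center_notMem_edge (hx.1 s hs) j hm

theorem ball_subset_support (r : Rhombus) (h : r.IsValid) :
    ∃ ρ > 0, ∀ p, ‖p - r.center‖ < ρ → p ∈ r.support := by
  have hd := det2_ne_zero h.1
  have hd' : 0 < |det2 r.u r.v| := abs_pos.2 hd
  refine ⟨|det2 r.u r.v| / (4 * (‖r.u‖ + ‖r.v‖ + 1)), by positivity, fun p hp => ?_⟩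
  have e := det2_expand hd (p - r.center)
  rw [lt_div_iff₀ (by positivity)] at hp
  have n1 := norm_nonneg (p - r.center)
  have n2 := norm_nonneg r.u
  have n3 := norm_nonneg r.v
  refine (r.mem_support_iff 1 p).2 ⟨det2 (p - r.center) r.v / det2 r.u r.v,
    det2 r.u (p - r.center) / det2 r.u r.v, ?_, ?_, ?_⟩
  rotate_left 2
  · rw [add_assoc, ← sub_eq_iff_eq_add']; exact e
  · rw [abs_div, div_le_iff₀ hd']
    have := abs_det2_le (p - r.center) r.v
    nlinarith
  · rw [abs_div, div_le_iff₀ hd']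
    have := abs_det2_le r.u (p - r.center)
    nlinarith

theorem support_dist (r : Rhombus) {p : Pt} (hp : p ∈ r.support) :
    ‖p - r.center‖ ≤ ‖r.u‖ + ‖r.v‖ := by
  obtain ⟨s, t, hs, ht, rfl⟩ := (r.mem_support_iff 1 p).1 hp
  have e : r.center + s • r.off 1 + t • r.off (1 + 1) - r.center = s • r.u + t • r.v := by
    simp [Rhombus.off]; module
  rw [e]
  refine (norm_add_le _ _).trans ?_
  rw [norm_smul, norm_smul]
  have n2 := norm_nonneg r.u
  have n3 := norm_nonneg r.v
  simp only [Real.norm_eq_abs]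
  nlinarith

theorem exists_ball (hval : ∀ i, (shapes i).IsValid) :
    ∃ ρ > 0, ∀ x, IsTilingOn (Set.range shapes) x → ∀ r ∈ x, ∀ p, ‖p - r.center‖ < ρ → p ∈ r.support := by
  choose f hf hp using fun i => ball_subset_support (shapes i) (hval i)
  obtain ⟨ρ, h0, h1⟩ := exists_pos_le f hf
  refine ⟨ρ, h0, fun x hx r hr p hpr => ?_⟩
  obtain ⟨_, ⟨i, rfl⟩, hu, hv⟩ := hx.2 r hr
  have := hp i (p - r.center + (shapes i).center) (by simpa using hpr.trans_le (h1 i))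
  obtain ⟨s, t, hs, ht, e⟩ := (Rhombus.mem_support_iff _ 1 _).1 this
  refine (Rhombus.mem_support_iff _ 1 _).2 ⟨s, t, hs, ht, ?_⟩
  have o : r.off = (shapes i).off := by simp only [Rhombus.off, hu, hv]
  rw [o]
  have : p = (p - r.center + (shapes i).center) + r.center - (shapes i).center := by abel
  rw [this, e]; abel

theorem exists_diam (shapes : Fin k → Rhombus) :
    ∃ D > 0, ∀ x, IsTilingOn (Set.range shapes) x → ∀ r ∈ x, ∀ p ∈ r.support,
      ‖p - r.center‖ ≤ D := by
  obtain ⟨D, h0, h1⟩ := exists_ge (fun i => ‖(shapes i).u‖ + ‖(shapes i).v‖)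
  refine ⟨D, h0, fun x hx r hr p hp => ?_⟩
  obtain ⟨_, ⟨i, rfl⟩, hu, hv⟩ := hx.2 r hr
  have := support_dist r hp
  rw [hu, hv] at this
  exact this.trans (h1 i)

theorem local_finite (hval : ∀ i, (shapes i).IsValid) (hx : IsTilingOn (Set.range shapes) x)
    (z : Pt) (R : ℝ) : {r ∈ x | ∃ p ∈ r.support, ‖p - z‖ < R}.Finite := by
  obtain ⟨ρ, hρ, hb⟩ := exists_ball hval
  obtain ⟨D, hD, hd⟩ := exists_diam shapes
  obtain ⟨t, ht, hcov⟩ : ∃ t : Set Pt, t.Finite ∧ closedBall z (R + D) ⊆ ⋃ y ∈ t, ball y (ρ / 2) := by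
    obtain ⟨t, -, h1, h2⟩ := (isCompact_closedBall z (R + D)).finite_cover_balls
      (e := ρ / 2) (by positivity)
    exact ⟨t, h1, h2⟩
  have key : ∀ r ∈ {r ∈ x | ∃ p ∈ r.support, ‖p - z‖ < R}, ∃ y ∈ t, ‖r.center - y‖ < ρ / 2 := by
    rintro r ⟨hr, p, hp, hpz⟩
    have h1 := hd x hx r hr p hp
    have : r.center ∈ closedBall z (R + D) := by
      rw [mem_closedBall, dist_eq_norm]
      have : r.center - z = (p - z) - (p - r.center) := by abel
      rw [this]
      refine (norm_sub_le _ _).trans (by linarith)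
    have := hcov this
    simp only [mem_iUnion, mem_ball, dist_eq_norm] at this
    obtain ⟨y, h1, h2⟩ := this
    exact ⟨y, h1, h2⟩
  choose! f hf1 hf2 using key
  refine Set.Finite.of_finite_image (f := f) (ht.subset ?_) ?_
  · rintro _ ⟨r, hr, rfl⟩
    exact hf1 r hr
  · intro r hr s hs he
    by_contra hne
    refine hx.1.center_notMem hr.1 hs.1 hne (hb x hx r hr.1 _ ?_)
    have e : s.center - r.center = (s.center - f s) - (r.center - f r) := by rw [he]; abel
    rw [e]
    refine (norm_sub_le _ _).trans_lt ?_
    linarith [hf2 r hr, hf2 s hs]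

theorem support_closed (r : Rhombus) : IsClosed r.support := by
  have : r.support = (fun q : ℝ × ℝ => r.pos + q.1 • r.u + q.2 • r.v) '' (Icc 0 1 ×ˢ Icc 0 1) := by
    ext p
    constructor
    · rintro ⟨s, t, hs, ht, rfl⟩; exact ⟨(s, t), ⟨hs, ht⟩, rfl⟩
    · rintro ⟨⟨s, t⟩, ⟨hs, ht⟩, rfl⟩; exact ⟨s, t, hs, ht, rfl⟩
  rw [this]
  exact ((isCompact_Icc.prod isCompact_Icc).image (by fun_prop)).isClosed

theorem support_convex (r : Rhombus) : Convex ℝ r.support := by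
  rintro p ⟨s, t, hs, ht, rfl⟩ q ⟨s', t', hs', ht', rfl⟩ a b ha hb hab
  refine ⟨a • s + b • s', a • t + b • t', (convex_Icc 0 1) hs hs' ha hb hab,
    (convex_Icc 0 1) ht ht' ha hb hab, ?_⟩
  obtain rfl : b = 1 - a := by linarith
  simp only [smul_eq_mul]
  module

theorem star_lemma (hval : ∀ i, (shapes i).IsValid) (hx : IsTilingOn (Set.range shapes) x)
    (z : Pt) : ∃ δ > 0, ∀ r ∈ x, ∀ p ∈ r.support, ‖p - z‖ < δ → z ∈ r.support := by
  have hf := local_finite hval hx z 1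
  set F := {r ∈ x | ∃ p ∈ r.support, ‖p - z‖ < 1} with hF
  have hf2 : {r ∈ F | z ∉ r.support}.Finite := hf.subset (sep_subset _ _)
  have hc : IsClosed (⋃ r ∈ {r ∈ F | z ∉ r.support}, r.support) :=
    hf2.isClosed_biUnion fun r _ => support_closed r
  have hz : z ∈ (⋃ r ∈ {r ∈ F | z ∉ r.support}, r.support)ᶜ := by
    simp only [mem_compl_iff, mem_iUnion, not_exists]
    intro r hr
    exact hr.2
  obtain ⟨δ, h0, h1⟩ := Metric.isOpen_iff.1 hc.isOpen_compl z hz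
  refine ⟨min δ 1, by positivity, fun r hr p hp hpz => ?_⟩
  by_contra hn
  have h2 : p ∈ ball z δ := by
    rw [mem_ball, dist_eq_norm]; exact hpz.trans_le (min_le_left _ _)
  refine h1 h2 ?_
  simp only [mem_iUnion]
  exact ⟨r, ⟨⟨hr, p, hp, hpz.trans_le (min_le_right _ _)⟩, hn⟩, hp⟩

/-- A function locally constant on a convex set is constant on it. -/
theorem const_of_local {S : Set Pt} (hS : Convex ℝ S) (D : Pt → ℝ)
    (h : ∀ p ∈ S, ∃ δ > 0, ∀ q ∈ S, ‖q - p‖ < δ → D q = D p) {a b : Pt} (ha : a ∈ S) (hb : b ∈ S) :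
    D a = D b := by
  have : PreconnectedSpace S := Subtype.preconnectedSpace hS.isPreconnected
  have hl : IsLocallyConstant (fun p : S => D p) := by
    rw [IsLocallyConstant.iff_eventually_eq]
    rintro ⟨p, hp⟩
    obtain ⟨δ, h0, h1⟩ := h p hp
    rw [Metric.eventually_nhds_iff]
    refine ⟨δ, h0, ?_⟩
    rintro ⟨q, hq⟩ hd
    refine h1 q hq ?_
    rwa [← dist_eq_norm]
  exact hl.apply_eq_of_preconnectedSpace ⟨a, ha⟩ ⟨b, hb⟩

/-- Height function on a set. -/
def IsHt (x : Set Rhombus) (lam : Rhombus → Pt →ₗ[ℝ] ℝ) (S : Set Pt) (H : Pt → ℝ) : Prop :=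
  ∀ r ∈ x, ∀ a ∈ r.support, ∀ b ∈ r.support, a ∈ S → b ∈ S → H b - H a = lam r (b - a)

theorem IsHt.unique (hval : ∀ i, (shapes i).IsValid) (hx : IsTilingOn (Set.range shapes) x)
    {lam : Rhombus → Pt →ₗ[ℝ] ℝ} {S : Set Pt} (hS : Convex ℝ S) {H H' : Pt → ℝ}
    (h : IsHt x lam S H) (h' : IsHt x lam S H') {a b : Pt} (ha : a ∈ S) (hb : b ∈ S) :
    H b - H a = H' b - H' a := by
  have := const_of_local hS (fun p => H p - H' p) (fun p hp => ?_) ha hb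
  · linarith
  · obtain ⟨δ, h0, h1⟩ := star_lemma hval hx p
    refine ⟨δ, h0, fun q hq hqp => ?_⟩
    obtain ⟨r, hr, hqr⟩ := hx.1.cover q
    have hpr := h1 r hr q hqr hqp
    have e1 := h r hr p hpr q hqr hp hq
    have e2 := h' r hr p hpr q hqr hp hq
    linarith

theorem exists_local_ht (hval : ∀ i, (shapes i).IsValid) (hx : IsTilingOn (Set.range shapes) x)
    (lam : Rhombus → Pt →ₗ[ℝ] ℝ)
    (hc : ∀ r ∈ x, ∀ s ∈ x, ∀ a ∈ r.support, ∀ b ∈ r.support, a ∈ s.support → b ∈ s.support →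
      lam r (b - a) = lam s (b - a)) (z : Pt) : ∃ δ > 0, ∃ H, IsHt x lam (ball z δ) H := by
  obtain ⟨δ, h0, h1⟩ := star_lemma hval hx z
  choose tl ht1 ht2 using hx.1.cover
  refine ⟨δ, h0, fun p => lam (tl p) (p - z), ?_⟩
  intro r hr a ha b hb haS hbS
  rw [mem_ball, dist_eq_norm] at haS hbS
  have key : ∀ p ∈ r.support, ‖p - z‖ < δ → lam (tl p) (p - z) = lam r (p - z) := by
    intro p hp hpz
    exact hc _ (ht1 p) r hr z (h1 _ (ht1 p) p (ht2 p) hpz) p (ht2 p) (h1 r hr p hp hpz) hp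
  simp only
  rw [key a ha haS, key b hb hbS, ← map_sub]
  congr 1; abel

theorem exists_ball_ht (hval : ∀ i, (shapes i).IsValid) (hx : IsTilingOn (Set.range shapes) x)
    (lam : Rhombus → Pt →ₗ[ℝ] ℝ)
    (hc : ∀ r ∈ x, ∀ s ∈ x, ∀ a ∈ r.support, ∀ b ∈ r.support, a ∈ s.support → b ∈ s.support →
      lam r (b - a) = lam s (b - a)) (R : ℝ) (hR : 0 < R) : ∃ H, IsHt x lam (ball 0 R) H := by
  choose d hd0 h hh using exists_local_ht hval hx lam hc
  obtain ⟨δ, hδ, hL⟩ := lebesgue_number_lemma_of_metric (isCompact_closedBall (0 : Pt) R)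
    (c := fun z : Pt => ball z (d z)) (fun z => isOpen_ball)
    (fun z _ => mem_iUnion.2 ⟨z, mem_ball_self (hd0 z)⟩)
  choose! c hcc using hL
  -- the transition function
  let g : Pt → Pt → ℝ := fun a b => h (c a) b - h (c a) a
  have hg : ∀ a p q : Pt, ‖a‖ ≤ R → ‖p‖ ≤ R → ‖p - a‖ < δ → ‖q - a‖ < δ → ‖q - p‖ < δ →
      g p q = h (c a) q - h (c a) p := by
    intro a p q ha hp h1 h2 h3
    have ha' : a ∈ closedBall (0 : Pt) R := by simpa using ha
    have hp' : p ∈ closedBall (0 : Pt) R := by simpa using hp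
    have A : IsHt x lam (ball a δ ∩ ball p δ) (h (c a)) := fun r hr u hu v hv huS hvS =>
      hh (c a) r hr u hu v hv (hcc a ha' huS.1) (hcc a ha' hvS.1)
    have B : IsHt x lam (ball a δ ∩ ball p δ) (h (c p)) := fun r hr u hu v hv huS hvS =>
      hh (c p) r hr u hu v hv (hcc p hp' huS.2) (hcc p hp' hvS.2)
    refine IsHt.unique hval hx ((convex_ball a δ).inter (convex_ball p δ)) B A ⟨?_, ?_⟩ ⟨?_, ?_⟩
    · rwa [mem_ball, dist_eq_norm]
    · exact mem_ball_self hδ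
    · rwa [mem_ball, dist_eq_norm]
    · rwa [mem_ball, dist_eq_norm]
  obtain ⟨N, hN⟩ := exists_nat_gt (4 * R / δ)
  have hN0 : (0 : ℝ) < N := lt_trans (by positivity) hN
  have hN1 : R / N < δ / 4 := by
    rw [div_lt_iff₀ hδ] at hN
    rw [div_lt_iff₀ hN0]; nlinarith
  let P : Pt → ℕ → Pt := fun z i => ((i : ℝ) / N) • z
  have hPn : ∀ z i, i ≤ N → ‖P z i‖ ≤ ‖z‖ := by
    intro z i hi
    simp only [P, norm_smul, Real.norm_eq_abs]
    have : |(i : ℝ) / N| ≤ 1 := by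
      rw [abs_of_nonneg (by positivity), div_le_one hN0]; exact_mod_cast hi
    nlinarith [norm_nonneg z]
  have hPd : ∀ z w i, i ≤ N → ‖P w i - P z i‖ ≤ ‖w - z‖ := by
    intro z w i hi
    have := hPn (w - z) i hi
    simpa only [P, smul_sub] using this
  have hPs : ∀ z i, ‖z‖ < R → ‖P z (i + 1) - P z i‖ < δ / 4 := by
    intro z i hz
    have e : P z (i + 1) - P z i = ((1 : ℝ) / N) • z := by
      simp only [P, ← sub_smul]; congr 1; push_cast; ring
    rw [e, norm_smul, Real.norm_eq_abs, abs_of_nonneg (by positivity)]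
    refine lt_of_le_of_lt ?_ hN1
    rw [div_mul_eq_mul_div, one_mul]
    gcongr
  let HH : Pt → ℕ → ℝ := fun z n => ∑ i ∈ Finset.range n, g (P z i) (P z (i + 1))
  have step : ∀ z w, ‖z‖ < R → ‖w‖ < R → ‖w - z‖ < δ / 4 → ∀ n ≤ N,
      HH w n - HH z n = g (P z n) (P w n) - g (P z 0) (P w 0) := by
    intro z w hz hw hzw n
    induction n with
    | zero => intro _; simp [HH]
    | succ n ih =>
      intro hn
      have ih := ih (by omega)
      have a1 := hPs z n hz
      have a2 := hPs w n hw
      have a3 := (hPd z w n (by omega)).trans_lt hzw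
      have a4 := (hPd z w (n + 1) hn).trans_lt hzw
      have b1 := (hPn z n (by omega)).trans hz.le
      have b2 := (hPn z (n + 1) hn).trans hz.le
      have b3 := (hPn w n (by omega)).trans hw.le
      have tri : ∀ a b c : Pt, ‖a - b‖ < δ / 4 → ‖b - c‖ < δ / 4 → ‖a - c‖ < δ := by
        intro a b c h1 h2
        have : a - c = (a - b) + (b - c) := by abel
        rw [this]
        refine (norm_add_le _ _).trans_lt (by linarith)
      have c1 := hg (P z n) (P z n) (P z (n + 1)) b1 b1 (by simpa using hδ) (by linarith)
        (by linarith)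
      have c2 := hg (P z n) (P w n) (P w (n + 1)) b1 b3 (by linarith) (tri _ _ _ a2 a3)
        (by linarith)
      have c3 := hg (P z n) (P z n) (P w n) b1 b1 (by simpa using hδ) (by linarith) (by linarith)
      have c4 := hg (P z n) (P z (n + 1)) (P w (n + 1)) b1 b2 (by linarith) (tri _ _ _ a4 a1)
        (by linarith)
      simp only [HH, Finset.sum_range_succ] at ih ⊢
      rw [c1, c2, c4]
      rw [c3] at ih
      linarith
  have fin : ∀ z w, ‖z‖ < R → ‖w‖ < R → ‖w - z‖ < δ / 4 → HH w N - HH z N = g z w := by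
    intro z w hz hw hzw
    rw [step z w hz hw hzw N le_rfl]
    have e1 : ∀ z, P z N = z := by intro z; simp only [P]; rw [div_self hN0.ne', one_smul]
    have e0 : ∀ z, P z 0 = 0 := by intro z; simp [P]
    rw [e1, e1, e0, e0]
    simp [g]
  refine ⟨fun z => HH z N, ?_⟩
  intro r hr a ha b hb haS hbS
  have := const_of_local ((support_convex r).inter (convex_ball (0 : Pt) R))
    (fun p => HH p N - lam r p) (fun p hp => ⟨δ / 4, by positivity, fun q hq hqp => ?_⟩)
    ⟨ha, haS⟩ ⟨hb, hbS⟩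
  · rw [map_sub]; simp only at this ⊢; linarith
  · have hp2 : ‖p‖ < R := by simpa using hp.2
    have hq2 : ‖q‖ < R := by simpa using hq.2
    have h1 := fin p q hp2 hq2 hqp
    have hp' : p ∈ closedBall (0 : Pt) R := by simpa using hp2.le
    have h2 := hh (c p) r hr p hp.1 q hq.1 (hcc p hp' (mem_ball_self hδ))
      (hcc p hp' (by rw [mem_ball, dist_eq_norm]; linarith))
    rw [map_sub] at h2
    simp only [g] at h1 ⊢
    linarith

theorem exists_height (hval : ∀ i, (shapes i).IsValid) (hx : IsTilingOn (Set.range shapes) x)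
    (lam : Rhombus → Pt →ₗ[ℝ] ℝ)
    (hc : ∀ r ∈ x, ∀ s ∈ x, ∀ a ∈ r.support, ∀ b ∈ r.support, a ∈ s.support → b ∈ s.support →
      lam r (b - a) = lam s (b - a)) :
    ∃ H : Pt → ℝ, ∀ r ∈ x, ∀ a ∈ r.support, ∀ b ∈ r.support, H b - H a = lam r (b - a) := by
  choose h hh using fun n : ℕ => exists_ball_ht hval hx lam hc (n + 1) (by positivity)
  have key : ∀ (m n : ℕ) (z : Pt), m ≤ n → ‖z‖ < m + 1 → h m z - h m 0 = h n z - h n 0 := by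
    intro m n z hmn hz
    have hmn' : (m : ℝ) ≤ n := by exact_mod_cast hmn
    refine IsHt.unique hval hx (convex_ball (0 : Pt) (m + 1)) (hh m) ?_
      (mem_ball_self (by positivity)) (by simpa using hz)
    intro r hr a ha b hb haS hbS
    exact hh n r hr a ha b hb (ball_subset_ball (by linarith) haS)
      (ball_subset_ball (by linarith) hbS)
  refine ⟨fun z => h ⌈‖z‖⌉₊ z - h ⌈‖z‖⌉₊ 0, fun r hr a ha b hb => ?_⟩
  simp only
  have hz : ∀ z : Pt, ‖z‖ < ⌈‖z‖⌉₊ + 1 := fun z => by linarith [Nat.le_ceil ‖z‖]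
  set n := max ⌈‖a‖⌉₊ ⌈‖b‖⌉₊
  rw [key _ n a (le_max_left _ _) (hz a), key _ n b (le_max_right _ _) (hz b)]
  have ha' : ‖a‖ < n + 1 := (hz a).trans_le (by gcongr; exact le_max_left _ _)
  have hb' : ‖b‖ < n + 1 := (hz b).trans_le (by gcongr; exact le_max_right _ _)
  have := hh n r hr a ha b hb (by simpa using ha') (by simpa using hb')
  linarith

end tiling

/-! ### Heights attached to an edge direction -/

open Classical in
/-- Signed indicator of the direction `U`. -/
def eps (U w : Pt) : ℝ := if w = U then 1 else if w = -U then -1 else 0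

theorem ne_neg_self {U : Pt} (hU : U ≠ 0) : U ≠ -U := by
  intro h
  exact hU (by
    have h2 : (2 : ℝ) • U = 0 := by rw [two_smul]; nth_rewrite 2 [h]; simp
    simpa using h2)

theorem eps_self (U : Pt) : eps U U = 1 := by simp [eps]

theorem eps_neg_self {U : Pt} (hU : U ≠ 0) : eps U (-U) = -1 := by
  simp [eps, (ne_neg_self hU).symm]

theorem eps_zero {U w : Pt} (h1 : w ≠ U) (h2 : w ≠ -U) : eps U w = 0 := by simp [eps, h1, h2]

theorem eps_neg {U : Pt} (hU : U ≠ 0) (w : Pt) : eps U (-w) = - eps U w := by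
  by_cases h1 : w = U
  · rw [h1, eps_neg_self hU, eps_self]
  · by_cases h2 : w = -U
    · rw [h2, neg_neg, eps_neg_self hU, eps_self]; norm_num
    · rw [eps_zero h1 h2, eps_zero]; · simp
      · intro h; exact h2 (by rw [← h, neg_neg])
      · intro h; exact h1 (neg_injective h)

theorem eps_int (U w : Pt) : ∃ n : ℤ, eps U w = n := by
  unfold eps
  split_ifs
  · exact ⟨1, by norm_num⟩
  · exact ⟨-1, by norm_num⟩
  · exact ⟨0, by norm_num⟩

/-- `det2` as a linear map in the first variable. -/
def detL (b : Pt) : Pt →ₗ[ℝ] ℝ where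
  toFun a := det2 a b
  map_add' a c := by simp
  map_smul' a c := by simp

theorem detL_apply (a b : Pt) : detL b a = det2 a b := rfl

/-- The linear form on a tile with `u ↦ eps U u`, `v ↦ eps U v`. -/
def lamU (U : Pt) (r : Rhombus) : Pt →ₗ[ℝ] ℝ :=
  (eps U r.u / det2 r.u r.v) • detL r.v - (eps U r.v / det2 r.u r.v) • detL r.u

theorem lamU_apply (U : Pt) (r : Rhombus) (w : Pt) : lamU U r w =
    eps U r.u / det2 r.u r.v * det2 w r.v - eps U r.v / det2 r.u r.v * det2 w r.u := by
  simp [lamU, detL_apply]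

theorem lamU_off {U : Pt} (hU : U ≠ 0) {r : Rhombus} (h : r.IsValid) (i : Fin 4) :
    lamU U r (r.off i) = eps U (r.off i) := by
  have hd := det2_ne_zero h.1
  have hu : lamU U r r.u = eps U r.u := by
    rw [lamU_apply]; simp [hd]
  have hv : lamU U r r.v = eps U r.v := by
    rw [lamU_apply, det2_swap r.v r.u]; simp [hd]
  fin_cases i
  · simp [Rhombus.off, hv, eps_neg hU]
  · simp [Rhombus.off, hu]
  · simp [Rhombus.off, hv]
  · simp [Rhombus.off, hu, eps_neg hU]

theorem shared {x : Set Rhombus} (hx : IsTiling x) {r s : Rhombus} (hr : r ∈ x) (hs : s ∈ x)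
    (hne : r ≠ s) {p : Pt} (hp : p ∈ r.support) (hp' : p ∈ s.support) :
    (∃ i j, p = r.vert i ∧ p = s.vert j ∧ r.support ∩ s.support = {p}) ∨
    (∃ i j, r.edge i = s.edge j ∧ r.support ∩ s.support = r.edge i) := by
  have hm : p ∈ r.support ∩ s.support := ⟨hp, hp'⟩
  rcases hx.2.2 r hr s hs hne with h | ⟨q, hq, hq', h⟩ | ⟨e, ⟨i, hi⟩, ⟨j, hj⟩, h⟩
  · rw [h] at hm; exact hm.elim
  · rw [h] at hm
    obtain rfl : p = q := hm
    obtain ⟨i, hi⟩ := Rhombus.exists_vert hq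
    obtain ⟨j, hj⟩ := Rhombus.exists_vert hq'
    exact Or.inl ⟨i, j, hi, hj, h⟩
  · exact Or.inr ⟨i, j, hi.trans hj.symm, h.trans hi.symm⟩

theorem Rhombus.IsValid.off_ne {r : Rhombus} (h : r.IsValid) (i : Fin 4) : r.off i ≠ 0 := by
  intro h0
  have := h.det_ne i
  rw [h0] at this
  simp [det2] at this

theorem edge_match {r s : Rhombus} (h : r.IsValid) {i j : Fin 4} (he : r.edge i = s.edge j) :
    r.mid i = s.mid j ∧ (r.off (i + 1) = s.off (j + 1) ∨ r.off (i + 1) = - s.off (j + 1)) := by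
  rw [Rhombus.edge_eq, Rhombus.edge_eq] at he
  exact Eseg_inj (h.off_ne _) he

theorem lamU_compat {U : Pt} (hU : U ≠ 0) {x : Set Rhombus} (hx : IsTiling x) :
    ∀ r ∈ x, ∀ s ∈ x, ∀ a ∈ r.support, ∀ b ∈ r.support, a ∈ s.support → b ∈ s.support →
      lamU U r (b - a) = lamU U s (b - a) := by
  intro r hr s hs a ha b hb ha' hb'
  by_cases hne : r = s
  · rw [hne]
  rcases shared hx hr hs hne ha ha' with ⟨i, j, -, -, h⟩ | ⟨i, j, he, h⟩
  · have : b ∈ r.support ∩ s.support := ⟨hb, hb'⟩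
    rw [h] at this
    obtain rfl : b = a := this
    simp
  · have h1 : b ∈ r.support ∩ s.support := ⟨hb, hb'⟩
    have h2 : a ∈ r.support ∩ s.support := ⟨ha, ha'⟩
    rw [h, Rhombus.edge_eq] at h1 h2
    obtain ⟨t, -, rfl⟩ := h1
    obtain ⟨t', -, rfl⟩ := h2
    have e : r.mid i + t • r.off (i + 1) - (r.mid i + t' • r.off (i + 1)) =
      (t - t') • r.off (i + 1) := by module
    rw [e, map_smul, map_smul, lamU_off hU (hx.1 r hr)]
    rcases (edge_match (hx.1 r hr) he).2 with e | e
    · rw [e, lamU_off hU (hx.1 s hs)]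
    · rw [e, map_neg, lamU_off hU (hx.1 s hs), eps_neg hU]

/-- `H` is an integral height function for the direction `U`. -/
def IsH (x : Set Rhombus) (U : Pt) (H : Pt → ℝ) : Prop :=
  (∀ r ∈ x, ∀ a ∈ r.support, ∀ b ∈ r.support, H b - H a = lamU U r (b - a)) ∧
  (∀ r ∈ x, ∀ i, ∃ n : ℤ, H (r.vert i) = n)

theorem vert_succ (r : Rhombus) (i : Fin 4) : r.vert (i + 1) - r.vert i = - r.off i := by
  unfold Rhombus.vert
  have : r.off (i + 1 + 1) = - r.off i := by
    rw [add_assoc]; exact r.off_two i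
  rw [this]; module

theorem exists_H {k : ℕ} {shapes : Fin k → Rhombus} {x : Set Rhombus} (hval : ∀ i, (shapes i).IsValid)
    (hx : IsTilingOn (Set.range shapes) x) {U : Pt} (hU : U ≠ 0) : ∃ H, IsH x U H := by
  obtain ⟨H, hH⟩ := exists_height hval hx (lamU U) (lamU_compat hU hx.1)
  have step : ∀ r ∈ x, ∀ i, Int.fract (H (r.vert (i + 1))) = Int.fract (H (r.vert i)) := by
    intro r hr i
    have := hH r hr _ (r.vert_mem i) _ (r.vert_mem (i + 1))
    rw [vert_succ, map_neg, lamU_off hU (hx.1.1 r hr)] at this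
    obtain ⟨n, hn⟩ := eps_int U (r.off i)
    rw [hn] at this
    rw [Int.fract_eq_fract]
    exact ⟨-n, by rw [this]; push_cast; ring⟩
  have all : ∀ r ∈ x, ∀ i j, Int.fract (H (r.vert i)) = Int.fract (H (r.vert j)) := by
    intro r hr i j
    have h1 := step r hr i
    have h2 := step r hr (i + 1)
    have h3 := step r hr (i + 2)
    have e2 : i + 1 + 1 = i + 2 := by rw [add_assoc]; rfl
    have e3 : i + 2 + 1 = i + 3 := by rw [add_assoc]; rfl
    rw [e2] at h2
    rw [e3] at h3
    rcases Rhombus.fin4_cases i j with h | h | h | h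
    · rw [h]
    · rw [h, h1]
    · rw [h, h2, h1]
    · rw [h, h3, h2, h1]
  have sh : ∀ r ∈ x, ∀ s ∈ x, ∀ p ∈ r.support, p ∈ s.support →
      Int.fract (H (r.vert 0)) = Int.fract (H (s.vert 0)) := by
    intro r hr s hs p hp hp'
    by_cases hne : r = s
    · rw [hne]
    rcases shared hx.1 hr hs hne hp hp' with ⟨i, j, h1, h2, -⟩ | ⟨i, j, he, h⟩
    · rw [all r hr 0 i, all s hs 0 j, ← h1, ← h2]
    · obtain ⟨hm, hd⟩ := edge_match (hx.1.1 r hr) he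
      have e : r.vert i = s.vert j ∨ r.vert i = s.vert (j + 3) := by
        have e1 : r.vert i = r.mid i + (1 / 2 : ℝ) • r.off (i + 1) := rfl
        have e2 : s.vert j = s.mid j + (1 / 2 : ℝ) • s.off (j + 1) := rfl
        have e3 : s.vert (j + 3) = s.mid j - (1 / 2 : ℝ) • s.off (j + 1) := by
          unfold Rhombus.vert Rhombus.mid
          rw [s.off_three, show j + 3 + 1 = j by rw [add_assoc]; exact add_zero j]
          module
        rcases hd with hd | hd
        · left; rw [e1, e2, hm, hd]
        · right; rw [e1, e3, hm, hd]; module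
      rcases e with e | e
      · rw [all r hr 0 i, all s hs 0 j, e]
      · rw [all r hr 0 i, all s hs 0 (j + 3), e]
  choose tl ht1 ht2 using hx.1.cover
  have key : ∀ a b, Int.fract (H ((tl a).vert 0)) = Int.fract (H ((tl b).vert 0)) := by
    intro a b
    refine const_of_local (S := univ) convex_univ (fun p => Int.fract (H ((tl p).vert 0)))
      (fun p _ => ?_) (mem_univ a) (mem_univ b)
    obtain ⟨δ, h0, h1⟩ := star_lemma hval hx p
    exact ⟨δ, h0, fun q _ hq => sh _ (ht1 q) _ (ht1 p) p (h1 _ (ht1 q) q (ht2 q) hq) (ht2 p)⟩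
  refine ⟨fun p => H p - Int.fract (H ((tl 0).vert 0)), fun r hr a ha b hb => ?_, fun r hr i => ?_⟩
  · rw [← hH r hr a ha b hb]; ring
  · have : Int.fract (H ((tl 0).vert 0)) = Int.fract (H (r.vert i)) := by
      rw [key 0 r.center, all r hr i 0]
      exact sh _ (ht1 _) r hr r.center (ht2 _) r.center_mem
    refine ⟨⌊H (r.vert i)⌋, ?_⟩
    beta_reduce
    rw [this, Int.self_sub_fract]

section
variable {x : Set Rhombus} {U : Pt} {H : Pt → ℝ}

theorem IsH.mid_eq (hH : IsH x U H) (hx : IsTiling x) (hU : U ≠ 0) {r : Rhombus} (hr : r ∈ x)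
    (i : Fin 4) : H (r.mid i) = H r.center + 1 / 2 * eps U (r.off i) := by
  have := hH.1 r hr _ r.center_mem _ (r.mid_mem i)
  have e : r.mid i - r.center = (1 / 2 : ℝ) • r.off i := by unfold Rhombus.mid; module
  rw [e, map_smul, lamU_off hU (hx.1 r hr), smul_eq_mul] at this
  linarith

theorem off_not_both {r : Rhombus} (h : r.IsValid) {i : Fin 4} (h1 : r.off i = U ∨ r.off i = -U) :
    eps U (r.off (i + 1)) = 0 := by
  have hd := h.det_ne i
  refine eps_zero ?_ ?_ <;> intro h2 <;> rcases h1 with h1 | h1 <;> rw [h1, h2] at hd <;>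
    simp [det2_self] at hd

theorem off_not_both' {r : Rhombus} (h : r.IsValid) {i : Fin 4}
    (h1 : r.off (i + 1) = U ∨ r.off (i + 1) = -U) : eps U (r.off i) = 0 := by
  have hd := h.det_ne i
  refine eps_zero ?_ ?_ <;> intro h2 <;> rcases h1 with h1 | h1 <;> rw [h1, h2] at hd <;>
    simp [det2_self] at hd

theorem IsH.center_half (hH : IsH x U H) (hx : IsTiling x) (hU : U ≠ 0) {r : Rhombus} (hr : r ∈ x)
    {i : Fin 4} (h1 : r.off i = U ∨ r.off i = -U) : ∃ n : ℤ, H r.center = n + 1 / 2 := by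
  obtain ⟨n, hn⟩ := hH.2 r hr i
  have := hH.1 r hr _ r.center_mem _ (r.vert_mem i)
  have e : r.vert i - r.center = (1 / 2 : ℝ) • r.off i + (1 / 2 : ℝ) • r.off (i + 1) := by
    unfold Rhombus.vert; module
  rw [e, map_add, map_smul, map_smul, lamU_off hU (hx.1 r hr), lamU_off hU (hx.1 r hr),
    off_not_both (hx.1 r hr) h1, hn] at this
  rcases h1 with h1 | h1
  · rw [h1, eps_self] at this
    refine ⟨n - 1, ?_⟩
    simp at this
    push_cast; linarith
  · rw [h1, eps_neg_self hU] at this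
    refine ⟨n, ?_⟩
    simp at this
    linarith
end

/-- A locally non-increasing function is non-increasing. -/
theorem local_antitone {g : ℝ → ℝ}
    (h : ∀ t, ∃ δ > 0, ∀ s, |s - t| < δ → (t ≤ s → g s ≤ g t) ∧ (s ≤ t → g t ≤ g s))
    {a b : ℝ} (hab : a ≤ b) : g b ≤ g a := by
  set S := {t | t ∈ Icc a b ∧ g t ≤ g a} with hS
  have haS : a ∈ S := ⟨⟨le_rfl, hab⟩, le_rfl⟩
  have hbd : BddAbove S := ⟨b, fun t ht => ht.1.2⟩
  set T := sSup S with hT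
  have hTa : a ≤ T := le_csSup hbd haS
  have hTb : T ≤ b := csSup_le ⟨a, haS⟩ fun t ht => ht.1.2
  obtain ⟨δ, h0, h1⟩ := h T
  have hTS : g T ≤ g a := by
    obtain ⟨s, hs, hs'⟩ := exists_lt_of_lt_csSup ⟨a, haS⟩ (show T - δ < sSup S by linarith)
    have hsT : s ≤ T := le_csSup hbd hs
    have := (h1 s (by rw [abs_lt]; constructor <;> linarith)).2 hsT
    exact this.trans hs.2
  rcases hTb.eq_or_lt with e | hlt
  · rw [← e]; exact hTS
  · exfalso
    set s := min b (T + δ / 2) with hs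
    have hs1 : T < s := lt_min hlt (by linarith)
    have hs2 : s ≤ T + δ / 2 := min_le_right _ _
    have hs3 : s ≤ b := min_le_left _ _
    have := (h1 s (by rw [abs_lt]; constructor <;> linarith)).1 hs1.le
    have : s ∈ S := ⟨⟨by linarith, hs3⟩, this.trans hTS⟩
    have := le_csSup hbd this
    linarith

section
variable {k : ℕ} {shapes : Fin k → Rhombus} {x : Set Rhombus} {U : Pt} {H : Pt → ℝ}

theorem IsH.slope (hH : IsH x U H) (hval : ∀ i, (shapes i).IsValid)
    (hx : IsTilingOn (Set.range shapes) x) {w : Pt} {C : ℝ} (hC : ∀ r ∈ x, lamU U r w ≤ C)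
    (z : Pt) {t : ℝ} (ht : 0 ≤ t) : H (z + t • w) ≤ H z + C * t := by
  have := local_antitone (g := fun t => H (z + t • w) - C * t) (fun t => ?_) ht
  · simp at this; linarith
  · obtain ⟨δ, h0, h1⟩ := star_lemma hval hx (z + t • w)
    refine ⟨δ / (‖w‖ + 1), by positivity, fun s hs => ?_⟩
    have hn : ‖(z + s • w) - (z + t • w)‖ < δ := by
      have e : (z + s • w) - (z + t • w) = (s - t) • w := by module
      rw [e, norm_smul, Real.norm_eq_abs]
      rw [lt_div_iff₀ (by positivity)] at hs
      nlinarith [abs_nonneg (s - t)]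
    obtain ⟨r, hr, hp⟩ := hx.1.cover (z + s • w)
    have hz := h1 r hr _ hp hn
    have e := hH.1 r hr _ hz _ hp
    have e' : (z + s • w) - (z + t • w) = (s - t) • w := by module
    rw [e', map_smul, smul_eq_mul] at e
    have hc := hC r hr
    constructor <;> intro hst <;> nlinarith

theorem lamU_nonneg {r : Rhombus} (h : r.IsValid) (hU : U ≠ 0) : 0 ≤ lamU U r U := by
  have hd := det2_ne_zero h.1
  have hu := lamU_off hU h 1
  have hv := lamU_off hU h 2
  simp only [Rhombus.off] at hu hv
  by_cases h1 : ∃ i, r.off i = U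
  · obtain ⟨i, hi⟩ := h1
    have := lamU_off hU h i
    rw [hi, eps_self] at this
    rw [this]; norm_num
  · push Not at h1
    have h3 : eps U r.u = 0 := eps_zero (h1 1) (fun e => h1 3 (by simp [Rhombus.off, e]))
    have h4 : eps U r.v = 0 := eps_zero (h1 2) (fun e => h1 0 (by simp [Rhombus.off, e]))
    rw [lamU_apply, h3, h4]; simp

theorem IsH.mono (hH : IsH x U H) (hU : U ≠ 0) (hval : ∀ i, (shapes i).IsValid)
    (hx : IsTilingOn (Set.range shapes) x) (z : Pt) {t : ℝ} (ht : 0 ≤ t) :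
    H z ≤ H (z + t • U) := by
  have := hH.slope hval hx (w := -U) (C := 0) (fun r hr => by
    rw [map_neg]; have := lamU_nonneg (hx.1.1 r hr) hU; linarith) (z + t • U) ht
  have e : z + t • U + t • -U = z := by module
  rw [e] at this
  linarith

theorem exists_lip (hval : ∀ i, (shapes i).IsValid) :
    ∃ C > 0, ∀ x, IsTilingOn (Set.range shapes) x → ∀ U H, IsH x U H →
      ∀ a b, |H a - H b| ≤ C * ‖a - b‖ := by
  obtain ⟨C, h0, hC⟩ := exists_ge (fun i =>
    2 * (‖(shapes i).u‖ + ‖(shapes i).v‖) / |det2 (shapes i).u (shapes i).v|)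
  refine ⟨C, h0, fun x hx U H hH => ?_⟩
  have eps_le : ∀ w, |eps U w| ≤ 1 := by
    intro w; unfold eps; split_ifs <;> norm_num
  have hl : ∀ r ∈ x, ∀ w, lamU U r w ≤ C * ‖w‖ := by
    intro r hr w
    obtain ⟨_, ⟨i, rfl⟩, hu, hv⟩ := hx.2 r hr
    have hc := hC i
    rw [← hu, ← hv] at hc
    have hd : 0 < |det2 r.u r.v| := abs_pos.2 (det2_ne_zero (hx.1.1 r hr).1)
    rw [div_le_iff₀ hd] at hc
    have key : |eps U r.u * det2 w r.v - eps U r.v * det2 w r.u| ≤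
        2 * (‖r.u‖ + ‖r.v‖) * ‖w‖ := by
      refine (abs_sub _ _).trans ?_
      rw [abs_mul, abs_mul]
      have a1 := abs_det2_le w r.v
      have a2 := abs_det2_le w r.u
      have a3 := mul_le_mul (eps_le r.u) a1 (abs_nonneg _) zero_le_one
      have a4 := mul_le_mul (eps_le r.v) a2 (abs_nonneg _) zero_le_one
      linarith
    have e : lamU U r w = (eps U r.u * det2 w r.v - eps U r.v * det2 w r.u) / det2 r.u r.v := by
      rw [lamU_apply]; ring
    rw [e]
    refine (le_abs_self _).trans ?_
    rw [abs_div, div_le_iff₀ hd]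
    nlinarith [norm_nonneg w]
  have half : ∀ a b, H a - H b ≤ C * ‖a - b‖ := by
    intro a b
    have := hH.slope hval hx (w := a - b) (fun r hr => hl r hr _) b zero_le_one
    have e : b + (1 : ℝ) • (a - b) = a := by module
    rw [e] at this
    linarith
  intro a b
  rw [abs_le]
  have h1 := half a b
  have h2 := half b a
  rw [norm_sub_rev] at h2
  constructor <;> linarith
end

/-! ### Chains of tiles -/

/-- Oriented coordinate transverse to `U`. -/
def tau (U V z : Pt) : ℝ := det2 U V * det2 U z

theorem tau_add (U V a b : Pt) : tau U V (a + b) = tau U V a + tau U V b := by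
  simp [tau]; ring
theorem tau_smul (U V : Pt) (c : ℝ) (a : Pt) : tau U V (c • a) = c * tau U V a := by
  simp [tau]; ring
theorem tau_neg (U V a : Pt) : tau U V (-a) = - tau U V a := by
  simp [tau]
theorem tau_sub (U V a b : Pt) : tau U V (a - b) = tau U V a - tau U V b := by
  rw [sub_eq_add_neg, tau_add, tau_neg]; ring
theorem tau_self (U V : Pt) : tau U V U = 0 := by
  simp [tau, det2_self]

/-- A tile crossed by a `U`-chain, with the index of its upper edge. -/
def Up (x : Set Rhombus) (U V : Pt) (q : Rhombus × Fin 4) : Prop :=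
  q.1 ∈ x ∧ (q.1.off (q.2 + 1) = U ∨ q.1.off (q.2 + 1) = -U) ∧ 0 < tau U V (q.1.off q.2)

/-- The tile `q'` follows `q` in the chain. -/
def Nxt (q q' : Rhombus × Fin 4) : Prop :=
  q.1 ≠ q'.1 ∧ q.1.edge q.2 = q'.1.edge (q'.2 + 2) ∧ q.1.mid q.2 = q'.1.mid (q'.2 + 2)

theorem tau_pm {U V w : Pt} (h : w = U ∨ w = -U) : tau U V w = 0 := by
  rcases h with rfl | rfl
  · exact tau_self _ _
  · rw [tau_neg, tau_self, neg_zero]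

theorem pm_of_pm {U a b : Pt} (h : a = U ∨ a = -U) (h' : a = b ∨ a = -b) : b = U ∨ b = -U := by
  rcases h' with rfl | rfl
  · exact h
  · rcases h with h | h
    · right; rw [← h, neg_neg]
    · left; exact neg_injective h

section
variable {k : ℕ} {shapes : Fin k → Rhombus} {x : Set Rhombus} {U V : Pt} {H H' : Pt → ℝ}

theorem exists_nxt (hval : ∀ i, (shapes i).IsValid) (hx : IsTilingOn (Set.range shapes) x)
    {q : Rhombus × Fin 4} (hq : Up x U V q) : ∃ q', Up x U V q' ∧ Nxt q q' := by
  obtain ⟨r, i⟩ := q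
  obtain ⟨hr, hU, ht⟩ := hq
  dsimp only at hr hU ht
  have hrv := hx.1.1 r hr
  obtain ⟨δ, h0, h1⟩ := star_lemma hval hx (r.mid i)
  set ε := δ / (2 * (‖r.off i‖ + 1)) with hε
  have hεp : 0 < ε := by positivity
  obtain ⟨s, hs, hp⟩ := hx.1.cover (r.mid i + ε • r.off i)
  have hm : r.mid i ∈ s.support := by
    refine h1 s hs _ hp ?_
    rw [add_sub_cancel_left, norm_smul, Real.norm_eq_abs, abs_of_pos hεp, hε, div_mul_eq_mul_div,
      div_lt_iff₀ (by positivity)]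
    nlinarith [norm_nonneg (r.off i)]
  have hpr : r.mid i + ε • r.off i ∉ r.support := by
    intro h
    obtain ⟨a, b, ha, hb, e⟩ := (r.mem_support_iff i _).1 h
    have e2 := congrArg (tau U V) e
    simp only [Rhombus.mid, tau_add, tau_smul] at e2
    rw [tau_pm hU] at e2
    have : (1 / 2 + ε - a) * tau U V (r.off i) = 0 := by linarith
    have h3 := (abs_le.1 ha).2
    have : 0 < (1 / 2 + ε - a) * tau U V (r.off i) := mul_pos (by linarith) ht
    linarith
  have hne : r ≠ s := fun e => hpr (e ▸ hp)
  rcases shared hx.1 hr hs hne (r.mid_mem i) hm with ⟨i', j, h, -, -⟩ | ⟨i', j, he, h⟩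
  · exact (Rhombus.mid_ne_vert hrv i i' h).elim
  have hmm : r.mid i ∈ r.edge i' := h ▸ ⟨r.mid_mem i, hm⟩
  obtain rfl := Rhombus.mid_edge hrv hmm
  obtain ⟨e1, e2⟩ := edge_match hrv he
  have hj : j + 2 + 2 = j := by rw [add_assoc]; exact add_zero j
  have hj2 : j + 2 + 1 = j + 3 := by rw [add_assoc]; rfl
  have hU' := pm_of_pm hU e2
  refine ⟨(s, j + 2), ⟨hs, ?_, ?_⟩, hne, ?_, ?_⟩
  · dsimp only
    rw [hj2, s.off_three]
    rcases hU' with h | h <;> rw [h] <;> simp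
  · dsimp only
    rw [s.off_two, tau_neg]
    obtain ⟨a, b, ha, hb, e⟩ := (s.mem_support_iff j _).1 hp
    have e3 := congrArg (tau U V) e
    rw [e1] at e3
    simp only [Rhombus.mid, tau_add, tau_smul, tau_pm hU'] at e3
    have h3 := (abs_le.1 ha).2
    by_contra hc
    have : 0 < ε * tau U V (r.off i') := mul_pos hεp ht
    nlinarith
  · dsimp only; rw [hj]; exact he
  · dsimp only; rw [hj]; exact e1

theorem exists_chain (hval : ∀ i, (shapes i).IsValid) (hx : IsTilingOn (Set.range shapes) x)
    {q : Rhombus × Fin 4} (hq : Up x U V q) : ∃ f : ℕ → Rhombus × Fin 4, f 0 = q ∧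
      (∀ n, Up x U V (f n)) ∧ ∀ n, Nxt (f n) (f (n + 1)) := by
  choose g hg hg' using fun q : {q // Up x U V q} => exists_nxt hval hx q.2
  let f : ℕ → {q // Up x U V q} := fun n => Nat.rec ⟨q, hq⟩ (fun _ p => ⟨g p, hg p⟩) n
  exact ⟨fun n => (f n).1, rfl, fun n => (f n).2, fun n => hg' (f n)⟩

theorem Nxt.center {q q' : Rhombus × Fin 4} (h : Nxt q q') :
    q'.1.center = q.1.center + (1 / 2 : ℝ) • q.1.off q.2 + (1 / 2 : ℝ) • q'.1.off q'.2 := by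
  have := h.2.2
  unfold Rhombus.mid at this
  rw [Rhombus.off_two] at this
  rw [this]; module

theorem tau_lower (hval : ∀ i, (shapes i).IsValid) (hx : IsTilingOn (Set.range shapes) x)
    (hUV : det2 U V ≠ 0) : ∃ c > 0, ∀ q, Up x U V q → c ≤ tau U V (q.1.off q.2) := by
  obtain ⟨c, h0, h1⟩ := exists_pos_le (fun i => |det2 (shapes i).u (shapes i).v|)
    (fun i => abs_pos.2 (det2_ne_zero (hval i).1))
  refine ⟨|det2 U V| * c, mul_pos (abs_pos.2 hUV) h0, fun q hq => ?_⟩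
  obtain ⟨hr, hU, ht⟩ := hq
  rw [← abs_of_pos ht]
  unfold tau
  rw [abs_mul]
  refine mul_le_mul_of_nonneg_left ?_ (abs_nonneg _)
  obtain ⟨_, ⟨i, rfl⟩, hu, hv⟩ := hx.2 q.1 hr
  have := h1 i
  rw [← hu, ← hv, ← q.1.det_off q.2] at this
  rcases hU with h | h
  · rw [h, det2_swap, abs_neg] at this; exact this
  · rw [h, det2_swap, abs_neg] at this; simpa using this

theorem Up.hU_mid (hx : IsTiling x) (hU : U ≠ 0) (hH : IsH x U H) {q : Rhombus × Fin 4}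
    (hq : Up x U V q) : H (q.1.mid q.2) = H q.1.center ∧ H (q.1.mid (q.2 + 2)) = H q.1.center := by
  rw [hH.mid_eq hx hU hq.1, hH.mid_eq hx hU hq.1, Rhombus.off_two, eps_neg hU,
    off_not_both' (hx.1 _ hq.1) hq.2.1]
  simp

theorem chain_hU (hx : IsTiling x) (hU : U ≠ 0) (hH : IsH x U H) {q q' : Rhombus × Fin 4}
    (hq : Up x U V q) (hq' : Up x U V q') (h : Nxt q q') : H q'.1.center = H q.1.center := by
  rw [← (hq'.hU_mid hx hU hH).2, ← h.2.2, (hq.hU_mid hx hU hH).1]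

/-- Every `U`-tile of the same height above the first tile of a chain is in the chain. -/
theorem chain_reach (hval : ∀ i, (shapes i).IsValid) (hx : IsTilingOn (Set.range shapes) x)
    (hUV : det2 U V ≠ 0) (hU : U ≠ 0) (hH : IsH x U H) {f : ℕ → Rhombus × Fin 4}
    (hf : ∀ n, Up x U V (f n)) (hn : ∀ n, Nxt (f n) (f (n + 1))) {q : Rhombus × Fin 4}
    (hq : Up x U V q) (hh : H q.1.center = H (f 0).1.center)
    (ht : tau U V (f 0).1.center ≤ tau U V q.1.center) : ∃ n, q.1 = (f n).1 := by
  have hc : ∀ n, H (f n).1.center = H (f 0).1.center := by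
    intro n
    induction n with
    | zero => rfl
    | succ n ih => rw [chain_hU hx.1 hU hH (hf n) (hf (n + 1)) (hn n), ih]
  obtain ⟨c, c0, hcl⟩ := tau_lower hval hx hUV
  set T : ℕ → ℝ := fun n => tau U V ((f n).1.mid (f n).2) with hT
  have hTs : ∀ n, T (n + 1) = T n + tau U V ((f (n + 1)).1.off (f (n + 1)).2) := by
    intro n
    simp only [hT]
    rw [(hn n).2.2]
    simp only [Rhombus.mid, Rhombus.off_two, tau_add, tau_smul, tau_neg]
    ring
  have hTl : ∀ n : ℕ, T 0 + n * c ≤ T n := by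
    intro n
    induction n with
    | zero => simp
    | succ n ih =>
      have := hcl _ (hf (n + 1))
      rw [hTs]; push_cast; linarith
  have hex : ∃ n, tau U V q.1.center < T n := by
    obtain ⟨n, hn⟩ := exists_nat_gt ((tau U V q.1.center - T 0) / c)
    rw [div_lt_iff₀ c0] at hn
    exact ⟨n, by have := hTl n; linarith⟩
  classical
  let n := Nat.find hex
  have hn1 : tau U V q.1.center < T n := Nat.find_spec hex
  have hn2 : T n - tau U V ((f n).1.off (f n).2) ≤ tau U V q.1.center := by
    rcases hnn : n with _ | m
    · have := (hf 0).2.2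
      simp only [hT, Rhombus.mid, tau_add, tau_smul]
      linarith
    · have := Nat.find_min hex (m := m) (by show m < n; omega)
      rw [hTs]; linarith
  refine ⟨n, ?_⟩
  -- the point of the median of `f n` at the level of `q`
  set r := (f n).1 with hr
  set i := (f n).2 with hi
  have ho : 0 < tau U V (r.off i) := (hf n).2.2
  have hTn : T n = tau U V r.center + 1 / 2 * tau U V (r.off i) := by
    simp only [hT, Rhombus.mid, tau_add, tau_smul, ← hr, ← hi]
  set s := (tau U V q.1.center - tau U V r.center) / tau U V (r.off i) with hs
  have hs' : s * tau U V (r.off i) = tau U V q.1.center - tau U V r.center := by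
    rw [hs]; field_simp
  have hsa : |s| ≤ 1 / 2 := by
    rw [abs_le]
    constructor <;> by_contra hcon <;> push Not at hcon <;> nlinarith
  set z := r.center + s • r.off i with hz
  have hpar : ∃ a : ℝ, q.1.center - z = a • U := by
    have e0 : det2 U (q.1.center - z) = 0 := by
      have : tau U V (q.1.center - z) = 0 := by
        rw [hz, tau_sub, tau_add, tau_smul, hs']; ring
      exact (mul_eq_zero.1 this).resolve_left hUV
    have := det2_expand hUV (q.1.center - z)
    rw [e0] at this
    exact ⟨_, by simpa using this⟩
  obtain ⟨a, ha⟩ := hpar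
  have hq2 : q.1.center = z + a • U := by rw [← ha]; abel
  have hUi : ∃ σ : ℝ, |σ| = 1 ∧ U = σ • r.off (i + 1) := by
    rcases (hf n).2.1 with h | h
    · exact ⟨1, by simp, by rw [one_smul]; exact h.symm⟩
    · exact ⟨-1, by simp, by
        have : r.off (i + 1) = -U := h
        rw [this]; simp⟩
  obtain ⟨σ, hσ, hσU⟩ := hUi
  have hmem : ∀ b : ℝ, |b| ≤ 1 / 2 → z + b • U ∈ r.support := by
    intro b hb
    refine (r.mem_support_iff i _).2 ⟨s, b * σ, hsa, by rw [abs_mul, hσ, mul_one]; exact hb, ?_⟩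
    rw [hσU, smul_smul]
  have hrx : r ∈ x := (hf n).1
  have hHz : ∀ b : ℝ, |b| ≤ 1 / 2 → H (z + b • U) = H r.center + b := by
    intro b hb
    have e := hH.1 r hrx _ r.center_mem _ (hmem b hb)
    have e1 : z + b • U - r.center = s • r.off i + b • U := by rw [hz]; module
    have e2 : lamU U r (r.off i) = 0 := by
      rw [lamU_off hU (hx.1.1 r hrx), off_not_both' (hx.1.1 r hrx) (hf n).2.1]
    have e3 : lamU U r U = 1 := by
      have h4 := lamU_off hU (hx.1.1 r hrx) (i + 1)
      rcases (hf n).2.1 with h | h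
      · change r.off (i + 1) = U at h
        rw [h, eps_self] at h4; exact h4
      · change r.off (i + 1) = -U at h
        rw [h, eps_neg_self hU, map_neg] at h4; linarith
    rw [e1, map_add, map_smul, map_smul, e2, e3] at e
    simp at e
    linarith
  have hab : |a| ≤ 1 / 2 := by
    rw [abs_le]
    constructor <;> by_contra hcon <;> push Not at hcon
    · have h1 := hH.mono hU hval hx (z + a • U) (t := -(1 / 2) - a) (by linarith)
      have e : z + a • U + (-(1 / 2) - a) • U = z + (-(1 / 2) : ℝ) • U := by module
      rw [e, ← hq2, hHz _ (by norm_num [abs_le]), hh, hc n] at h1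
      linarith
    · have h1 := hH.mono hU hval hx (z + (1 / 2 : ℝ) • U) (t := a - 1 / 2) (by linarith)
      have e : z + (1 / 2 : ℝ) • U + (a - 1 / 2) • U = z + a • U := by module
      rw [e, ← hq2, hHz _ (by norm_num), hh, hc n] at h1
      linarith
  by_contra hne
  exact hx.1.center_notMem hrx hq.1 (Ne.symm hne) (hq2 ▸ hmem a hab)
end

/-- `q` is a tile with edge directions `U`, `V`, with the index of its `V` side. -/
def Fr (x : Set Rhombus) (U V : Pt) (q : Rhombus × Fin 4) : Prop :=
  q.1 ∈ x ∧ q.1.off q.2 = V ∧ (q.1.off (q.2 + 1) = U ∨ q.1.off (q.2 + 1) = -U)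

theorem Fr.up {x : Set Rhombus} {U V : Pt} {q : Rhombus × Fin 4} (h : Fr x U V q)
    (hUV : det2 U V ≠ 0) : Up x U V q :=
  ⟨h.1, h.2.2, by rw [h.2.1]; exact mul_self_pos.2 hUV⟩

theorem Fr.symm {x : Set Rhombus} {U V : Pt} {q : Rhombus × Fin 4} (h : Fr x U V q) :
    ∃ i, Fr x V U (q.1, i) := by
  obtain ⟨h1, h2, h3 | h3⟩ := h
  · refine ⟨q.2 + 1, h1, h3, ?_⟩
    right
    dsimp only
    rw [add_assoc, show (1 + 1 : Fin 4) = 2 from rfl, Rhombus.off_two, h2]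
  · refine ⟨q.2 + 3, h1, ?_, ?_⟩
    · dsimp only; rw [Rhombus.off_three, h3, neg_neg]
    · left
      dsimp only
      rw [add_assoc, show (3 + 1 : Fin 4) = 0 from rfl, add_zero, h2]

section
variable {k : ℕ} {shapes : Fin k → Rhombus} {x : Set Rhombus} {U V : Pt} {H H' : Pt → ℝ}

theorem det_ne_left (hUV : det2 U V ≠ 0) : U ≠ 0 := by
  rintro rfl; simp [det2] at hUV
theorem det_ne_right (hUV : det2 U V ≠ 0) : V ≠ 0 := by
  rintro rfl; simp [det2] at hUV

/-- The `V`-height of the lower edge along a chain. -/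
def gh (H' : Pt → ℝ) (f : ℕ → Rhombus × Fin 4) (n : ℕ) : ℝ := H' ((f n).1.mid ((f n).2 + 2))

theorem gh_center (hx : IsTiling x) (hV : V ≠ 0) (hH' : IsH x V H') {f : ℕ → Rhombus × Fin 4}
    (hf : ∀ n, Up x U V (f n)) (n : ℕ) :
    H' (f n).1.center = gh H' f n + 1 / 2 * eps V ((f n).1.off (f n).2) := by
  unfold gh
  rw [hH'.mid_eq hx hV (hf n).1, Rhombus.off_two, eps_neg hV]; ring

theorem gh_step (hx : IsTiling x) (hV : V ≠ 0) (hH' : IsH x V H') {f : ℕ → Rhombus × Fin 4}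
    (hf : ∀ n, Up x U V (f n)) (hn : ∀ n, Nxt (f n) (f (n + 1))) (n : ℕ) :
    gh H' f (n + 1) = gh H' f n + eps V ((f n).1.off (f n).2) := by
  have := gh_center hx hV hH' hf n
  have h2 : gh H' f (n + 1) = H' ((f n).1.mid (f n).2) := by
    unfold gh; rw [← (hn n).2.2]
  rw [h2, hH'.mid_eq hx hV (hf n).1, this]; ring

theorem Up.eps_cases (hUV : det2 U V ≠ 0) {q : Rhombus × Fin 4} (hq : Up x U V q) :
    (q.1.off q.2 = V ∧ eps V (q.1.off q.2) = 1) ∨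
    (q.1.off q.2 ≠ V ∧ q.1.off q.2 ≠ -V ∧ eps V (q.1.off q.2) = 0) := by
  by_cases h : q.1.off q.2 = V
  · left; exact ⟨h, by rw [h, eps_self]⟩
  · have h2 : q.1.off q.2 ≠ -V := by
      intro h2
      have h3 := hq.2.2
      rw [h2, tau_neg] at h3
      have : 0 < tau U V V := mul_self_pos.2 hUV
      linarith
    right; exact ⟨h, h2, eps_zero h h2⟩

theorem gh_mono (hx : IsTiling x) (hUV : det2 U V ≠ 0) (hH' : IsH x V H') {f : ℕ → Rhombus × Fin 4}
    (hf : ∀ n, Up x U V (f n)) (hn : ∀ n, Nxt (f n) (f (n + 1))) {m n : ℕ} (hmn : m ≤ n) :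
    gh H' f m ≤ gh H' f n := by
  refine monotone_nat_of_le_succ (fun n => ?_) hmn
  rw [gh_step hx (det_ne_right hUV) hH' hf hn n]
  rcases (hf n).eps_cases hUV with h | h
  · rw [h.2]; linarith
  · rw [h.2.2]; linarith

theorem off_inj {r : Rhombus} (h : r.IsValid) {i j : Fin 4} (e : r.off i = r.off j) : i = j := by
  have hd := h.det_ne i
  rcases Rhombus.fin4_cases i j with h1 | h1 | h1 | h1
  · exact h1.symm
  · rw [← h1, ← e] at hd; simp [det2_self] at hd
  · rw [h1, r.off_two] at e
    exact (ne_neg_self (h.off_ne i) e).elim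
  · rw [h1, r.off_three] at e
    have : r.off (i + 1) = - r.off i := by rw [e, neg_neg]
    rw [this] at hd; simp [det2_self] at hd

/-- The basic statement on two tiles with both directions in the same column. -/
theorem col_chain (hval : ∀ i, (shapes i).IsValid) (hx : IsTilingOn (Set.range shapes) x)
    (hUV : det2 U V ≠ 0) (hH : IsH x U H) (hH' : IsH x V H') {q q' : Rhombus × Fin 4}
    (hq : Fr x U V q) (hq' : Fr x U V q') (hh : H q.1.center = H q'.1.center)
    (hle : H' q.1.center ≤ H' q'.1.center) :
    ∃ f : ℕ → Rhombus × Fin 4, f 0 = q ∧ (∀ n, Up x U V (f n)) ∧ (∀ n, Nxt (f n) (f (n + 1))) ∧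
      (∀ n, H (f n).1.center = H q.1.center) ∧ ∃ n, q' = f n := by
  have hU := det_ne_left hUV
  have hV := det_ne_right hUV
  have reach : ∀ q q', Fr x U V q → Fr x U V q' → H q.1.center = H q'.1.center →
      tau U V q.1.center ≤ tau U V q'.1.center →
      ∃ f : ℕ → Rhombus × Fin 4, f 0 = q ∧ (∀ n, Up x U V (f n)) ∧ (∀ n, Nxt (f n) (f (n + 1))) ∧
      (∀ n, H (f n).1.center = H q.1.center) ∧ ∃ n, q' = f n := by
    intro q q' hq hq' hh ht
    obtain ⟨f, f0, hf, hn⟩ := exists_chain hval hx (hq.up hUV)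
    obtain ⟨n, e⟩ := chain_reach hval hx hUV hU hH hf hn (hq'.up hUV) (by rw [f0, hh])
      (by rw [f0]; exact ht)
    refine ⟨f, f0, hf, hn, ?_, n, ?_⟩
    · intro n
      induction n with
      | zero => rw [f0]
      | succ n ih => rw [chain_hU hx.1 hU hH (hf n) (hf (n + 1)) (hn n), ih]
    · refine Prod.ext e ?_
      -- the index is determined by the direction
      have hv := hx.1.1 _ (hf n).1
      have h1 := hq'.2.1
      rw [e] at h1
      have h2 := hq'.2.2
      rw [e] at h2
      rcases Rhombus.fin4_cases q'.2 (f n).2 with h | h | h | h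
      · exact h.symm
      · have h3 := (hf n).2.2
        rw [h, tau_pm h2] at h3
        exact (lt_irrefl _ h3).elim
      · have h3 := (hf n).2.2
        rw [h, Rhombus.off_two, h1, tau_neg] at h3
        have : 0 < tau U V V := mul_self_pos.2 hUV
        linarith
      · have h3 := (hf n).2.2
        rw [h, Rhombus.off_three, tau_neg, tau_pm h2] at h3
        norm_num at h3
  rcases le_total (tau U V q.1.center) (tau U V q'.1.center) with ht | ht
  · exact reach q q' hq hq' hh ht
  · obtain ⟨f, f0, hf, hn, hc, n, e⟩ := reach q' q hq' hq hh.symm ht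
    rcases Nat.eq_zero_or_pos n with h0 | h0
    · rw [h0, f0] at e
      subst e
      exact reach q q hq hq rfl le_rfl
    · exfalso
      have a1 := gh_center hx.1 hV hH' hf n
      have a2 := gh_center hx.1 hV hH' hf 0
      have a3 := gh_step hx.1 hV hH' hf hn 0
      have a4 := gh_mono hx.1 hUV hH' hf hn (m := 0 + 1) (n := n) h0
      rw [← e, hq.2.1, eps_self] at a1
      rw [f0, hq'.2.1, eps_self] at a2 a3
      linarith

theorem col_eq (hval : ∀ i, (shapes i).IsValid) (hx : IsTilingOn (Set.range shapes) x)
    (hUV : det2 U V ≠ 0) (hH : IsH x U H) (hH' : IsH x V H') {q q' : Rhombus × Fin 4}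
    (hq : Fr x U V q) (hq' : Fr x U V q') (hh : H q.1.center = H q'.1.center)
    (he : H' q.1.center = H' q'.1.center) : q = q' := by
  have hV := det_ne_right hUV
  obtain ⟨f, f0, hf, hn, -, n, e⟩ := col_chain hval hx hUV hH hH' hq hq' hh he.le
  rcases Nat.eq_zero_or_pos n with h0 | h0
  · rw [e, h0, f0]
  · exfalso
    have a1 := gh_center hx.1 hV hH' hf n
    have a2 := gh_center hx.1 hV hH' hf 0
    have a3 := gh_step hx.1 hV hH' hf hn 0
    have a4 := gh_mono hx.1 hUV hH' hf hn (m := 0 + 1) (n := n) h0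
    rw [← e, hq'.2.1, eps_self] at a1
    rw [f0, hq.2.1, eps_self] at a2 a3
    linarith

theorem col_between (hval : ∀ i, (shapes i).IsValid) (hx : IsTilingOn (Set.range shapes) x)
    (hUV : det2 U V ≠ 0) (hH : IsH x U H) (hH' : IsH x V H') {q q' : Rhombus × Fin 4}
    (hq : Fr x U V q) (hq' : Fr x U V q') (hh : H q.1.center = H q'.1.center) (m : ℕ)
    (hle : H' q.1.center + m ≤ H' q'.1.center) :
    ∃ p, Fr x U V p ∧ H p.1.center = H q.1.center ∧ H' p.1.center = H' q.1.center + m := by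
  have hV := det_ne_right hUV
  have hm0 : (0 : ℝ) ≤ m := Nat.cast_nonneg m
  obtain ⟨f, f0, hf, hn, hc, n, e⟩ := col_chain hval hx hUV hH hH' hq hq' hh (by linarith)
  have a2 := gh_center hx.1 hV hH' hf 0
  rw [f0, hq.2.1, eps_self] at a2
  have a1 := gh_center hx.1 hV hH' hf n
  have a3 := gh_step hx.1 hV hH' hf hn n
  rw [← e, hq'.2.1, eps_self] at a1 a3
  have hintg : ∀ n, ∃ z : ℤ, gh H' f n = gh H' f 0 + z := by
    intro n
    induction n with
    | zero => exact ⟨0, by simp⟩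
    | succ n ih =>
      obtain ⟨z, hz⟩ := ih
      obtain ⟨y, hy⟩ := eps_int V ((f n).1.off (f n).2)
      exact ⟨z + y, by rw [gh_step hx.1 hV hH' hf hn n, hz, hy]; push_cast; ring⟩
  have hex : ∃ j, gh H' f 0 + m < gh H' f (j + 1) := ⟨n, by linarith⟩
  classical
  let j := Nat.find hex
  have hj1 : gh H' f 0 + m < gh H' f (j + 1) := Nat.find_spec hex
  have hj2 : gh H' f j ≤ gh H' f 0 + m := by
    rcases hjj : j with _ | i
    · linarith
    · have := Nat.find_min hex (m := i) (by show i < j; omega)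
      exact not_lt.1 this
  have b1 := gh_step hx.1 hV hH' hf hn j
  have b2 := gh_center hx.1 hV hH' hf j
  rcases (hf j).eps_cases hUV with h | h
  · rw [h.2] at b1 b2
    refine ⟨f j, ⟨(hf j).1, h.1, (hf j).2.1⟩, hc j, ?_⟩
    obtain ⟨z, hz⟩ := hintg j
    have c1 : (z : ℝ) ≤ m := by linarith
    have c2 : (m : ℝ) < z + 1 := by linarith
    have c3 : z ≤ (m : ℤ) := by exact_mod_cast c1
    have c4 : (m : ℤ) < z + 1 := by exact_mod_cast c2
    have c5 : (z : ℤ) = m := by omega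
    rw [b2, hz, c5, a2]; push_cast; ring
  · rw [h.2.2] at b1
    linarith

theorem col_color (hval : ∀ i, (shapes i).IsValid) (hx : IsTilingOn (Set.range shapes) x)
    (hUV : det2 U V ≠ 0) (hH : IsH x U H) (hH' : IsH x V H') {q q' : Rhombus × Fin 4}
    (hq : Fr x U V q) (hq' : Fr x U V q') (hh : H q.1.center = H q'.1.center)
    (he : H' q'.1.center = H' q.1.center + 1) (col : Rhombus → Fin 4 → ℕ)
    (hmatch : ∀ r ∈ x, ∀ s ∈ x, r ≠ s → ∀ i j, r.edge i = s.edge j → col r i = col s j)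
    (hpass : ∀ r ∈ x, (¬ ∃ i, Fr x U V (r, i)) → ∀ i, col r (i + 2) = col r i) :
    col q.1 q.2 = col q'.1 (q'.2 + 2) := by
  have hV := det_ne_right hUV
  obtain ⟨f, f0, hf, hn, hc, n, e⟩ := col_chain hval hx hUV hH hH' hq hq' hh (by linarith)
  have a2 := gh_center hx.1 hV hH' hf 0
  have a5 := gh_step hx.1 hV hH' hf hn 0
  rw [f0, hq.2.1, eps_self] at a2 a5
  have a1 := gh_center hx.1 hV hH' hf n
  have a3 := gh_step hx.1 hV hH' hf hn n
  rw [← e, hq'.2.1, eps_self] at a1 a3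
  have hnx : ∀ m, col (f m).1 (f m).2 = col (f (m + 1)).1 ((f (m + 1)).2 + 2) := fun m =>
    hmatch _ (hf m).1 _ (hf (m + 1)).1 (hn m).1 _ _ (hn m).2.1
  have hnf : ∀ m, m + 1 < n → ¬ ∃ i, Fr x U V ((f (m + 1)).1, i) := by
    rintro m hm ⟨i, hi⟩
    have b1 := gh_step hx.1 hV hH' hf hn (m + 1)
    have b2 := gh_mono hx.1 hUV hH' hf hn (m := 0 + 1) (n := m + 1) (by omega)
    have b3 := gh_mono hx.1 hUV hH' hf hn (m := m + 1 + 1) (n := n) (by omega)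
    have h0 : eps V ((f (m + 1)).1.off (f (m + 1)).2) = 1 := by
      rcases (hf (m + 1)).eps_cases hUV with h | h
      · exact h.2
      · exfalso
        have h1 : (f (m + 1)).1.off i = V := hi.2.1
        have h2 := hi.2.2
        dsimp only at h2
        have hup := hf (m + 1)
        rcases Rhombus.fin4_cases i (f (m + 1)).2 with g | g | g | g
        · rw [g] at h; exact h.1 h1
        · have h3 := hup.2.2
          rw [g, tau_pm h2] at h3
          exact (lt_irrefl _ h3).elim
        · rw [g, Rhombus.off_two, h1] at h; exact h.2.1 rfl
        · have h3 := hup.2.2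
          rw [g, Rhombus.off_three, tau_neg, tau_pm h2] at h3
          norm_num at h3
    rw [h0] at b1
    linarith
  have key : ∀ m, m < n → col q.1 q.2 = col (f (m + 1)).1 ((f (m + 1)).2 + 2) := by
    intro m
    induction m with
    | zero => intro _; rw [← hnx 0, f0]
    | succ m ih =>
      intro hm
      rw [ih (by omega), ← hnx (m + 1), hpass _ (hf (m + 1)).1 (hnf m hm)]
  rcases n with _ | n
  · rw [f0] at e; rw [e] at he; linarith
  · rw [key n (by omega), ← e]
end

/-! ### A counting argument -/

theorem count_fail {G : Finset (ℤ × ℤ)} {n N : ℕ} (hn : 0 < n) {B : ℤ}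
    (hB : ∀ p ∈ G, p.2 ∈ Finset.Ico B (B + N))
    (hF : ∀ p ∈ G, ∀ p' ∈ G, p.2 = p'.2 → p'.1 < p.1 + n) : G.card ≤ N * n := by
  have hn' : (0 : ℤ) < n := by exact_mod_cast hn
  have : G.card ≤ (Finset.Ico (0 : ℤ) n ×ˢ Finset.Ico B (B + N)).card := by
    refine Finset.card_le_card_of_injOn (fun p => (p.1 % n, p.2)) (fun p hp => ?_) ?_
    · have h1 := Int.emod_nonneg p.1 hn'.ne'
      have h2 := Int.emod_lt_of_pos p.1 hn'
      have h3 := hB p hp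
      simp at h3 ⊢
      exact ⟨⟨h1, h2⟩, h3⟩
    · intro p hp p' hp' e
      simp only [Prod.mk.injEq] at e
      have h1 := hF p hp p' hp' e.2
      have h2 := hF p' hp' p hp e.2.symm
      refine Prod.ext ?_ e.2
      have h3 : (n : ℤ) ∣ p.1 - p'.1 := (Int.ModEq.symm e.1).dvd
      have h4 := Int.eq_zero_of_abs_lt_dvd h3 (by rw [abs_lt]; constructor <;> linarith)
      linarith
  refine this.trans ?_
  simp [mul_comm]

theorem exists_square_of_count {I : Set (ℤ × ℤ)}
    (hrow : ∀ a b c e, (a, b) ∈ I → (c, b) ∈ I → a ≤ e → e ≤ c → (e, b) ∈ I)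
    (hcol : ∀ a b d e, (a, b) ∈ I → (a, d) ∈ I → b ≤ e → e ≤ d → (a, e) ∈ I)
    {G : Finset (ℤ × ℤ)} (hG : ∀ p ∈ G, p ∈ I) {A B : ℤ} {N n : ℕ}
    (hA : ∀ p ∈ G, p.1 ∈ Finset.Ico A (A + N)) (hB : ∀ p ∈ G, p.2 ∈ Finset.Ico B (B + N))
    (hn : 0 < n) (hc : 2 * (N * n) < G.card) :
    ∃ a b : ℤ, ∀ i j : ℕ, i < n → j < n → (a + i, b + j) ∈ I := by
  classical
  set P : ℤ × ℤ → Prop := fun p => ∃ p' ∈ G, p'.2 = p.2 ∧ p.1 + n ≤ p'.1 with hP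
  set A1 := G.filter P with hA1
  set Q : ℤ × ℤ → Prop := fun p => ∃ p' ∈ A1, p'.1 = p.1 ∧ p.2 + n ≤ p'.2 with hQ
  set A2 := A1.filter Q with hA2
  have c1 : (G.filter fun p => ¬ P p).card ≤ N * n := by
    refine count_fail hn (fun p hp => hB p (Finset.mem_filter.1 hp).1) fun p hp p' hp' e => ?_
    by_contra hcon
    exact (Finset.mem_filter.1 hp).2 ⟨p', (Finset.mem_filter.1 hp').1, e.symm, not_lt.1 hcon⟩
  have c2 : (A1.filter fun p => ¬ Q p).card ≤ N * n := by
    have : ((A1.filter fun p => ¬ Q p).image Prod.swap).card ≤ N * n := by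
      refine count_fail hn (B := A) (fun p hp => ?_) fun p hp p' hp' e => ?_
      · obtain ⟨q, hq, rfl⟩ := Finset.mem_image.1 hp
        exact hA q (Finset.mem_filter.1 (Finset.mem_filter.1 hq).1).1
      · obtain ⟨q, hq, rfl⟩ := Finset.mem_image.1 hp
        obtain ⟨q', hq', rfl⟩ := Finset.mem_image.1 hp'
        by_contra hcon
        exact (Finset.mem_filter.1 hq).2 ⟨q', (Finset.mem_filter.1 hq').1, e.symm, not_lt.1 hcon⟩
    rwa [Finset.card_image_of_injective _ Prod.swap_injective] at this
  have e1 := Finset.card_filter_add_card_filter_not (s := G) P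
  have e2 := Finset.card_filter_add_card_filter_not (s := A1) Q
  have hpos : 0 < A2.card := by
    have : G.card = A1.card + (G.filter fun p => ¬ P p).card := e1.symm
    have : A1.card = A2.card + (A1.filter fun p => ¬ Q p).card := e2.symm
    omega
  obtain ⟨⟨a, b⟩, hab⟩ := Finset.card_pos.1 hpos
  obtain ⟨h1, ⟨a', d⟩, h2, rfl, h3⟩ := Finset.mem_filter.1 hab
  dsimp only at h2 h3 h1
  have row : ∀ b, (a', b) ∈ A1 → ∀ i : ℕ, i < n → (a' + i, b) ∈ I := by
    intro b hb i hi
    obtain ⟨h4, ⟨c, b'⟩, h5, h6, h7⟩ := Finset.mem_filter.1 hb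
    dsimp only at h6 h7
    subst h6
    exact hrow a' b' c _ (hG _ h4) (hG _ h5) (by omega) (by omega)
  refine ⟨a', b, fun i j hi hj => ?_⟩
  exact hcol _ b d _ (row b h1 i hi) (row d h2 i hi) (by omega) (by omega)

section
variable {k : ℕ} {shapes : Fin k → Rhombus} {x : Set Rhombus}

theorem exists_frame_square (hval : ∀ i, (shapes i).IsValid)
    (hx : IsTilingOn (Set.range shapes) x) (H H' : Fin k → Pt → ℝ)
    (hH : ∀ l, IsH x (shapes l).u (H l)) (hH' : ∀ l, IsH x (shapes l).v (H' l)) (n : ℕ)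
    (hn : 0 < n) : ∃ (l : Fin k) (a b : ℤ), ∀ i j : ℕ, i < n → j < n →
      ∃ q, Fr x (shapes l).u (shapes l).v q ∧ H l q.1.center = ((a + i : ℤ) : ℝ) + 1 / 2 ∧
        H' l q.1.center = ((b + j : ℤ) : ℝ) + 1 / 2 := by
  classical
  obtain ⟨D, hD, hd⟩ := exists_diam shapes
  obtain ⟨C, hC, hc⟩ := exists_lip hval
  set L : ℝ := 2 * D + 1 with hL
  set P : ℕ × ℕ → Pt := fun p => !₂[L * p.1, L * p.2] with hP
  choose tl ht1 ht2 using hx.1.cover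
  choose sh hsh using fun p => hx.2 (tl p) (ht1 p)
  have hsh' : ∀ p, ∃ l, (tl p).SameShape (shapes l) := by
    intro p
    obtain ⟨⟨l, hl⟩, h⟩ := hsh p
    exact ⟨l, hl ▸ h⟩
  choose ix hix using hsh'
  -- size parameters
  obtain ⟨K, hK⟩ := exists_nat_gt (C * (2 * L + 2 * D) + 1)
  set M : ℕ := 8 * K * n * (k + 1) + 1 with hM
  set N : ℕ := 2 * (K * M) + 1 with hN
  set S : Finset (ℕ × ℕ) := Finset.range M ×ˢ Finset.range M with hS
  have hScard : S.card = M * M := by simp [hS]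
  -- pigeonhole
  obtain ⟨l, -, hl⟩ : ∃ l ∈ (Finset.univ : Finset (Fin k)),
      2 * (N * n) < (S.filter fun p => ix (P p) = l).card := by
    refine Finset.exists_lt_card_fiber_of_mul_lt_card_of_maps_to (fun p _ => Finset.mem_univ _) ?_
    rw [hScard, Finset.card_univ, Fintype.card_fin]
    have hK0 : 0 < K := by
      have : (0 : ℝ) < K := lt_of_le_of_lt (by positivity) hK
      exact_mod_cast this
    have hKM : 1 ≤ K * M := Nat.mul_pos hK0 (by omega)
    have h1 : N ≤ 3 * (K * M) := by omega
    calc k * (2 * (N * n)) ≤ k * (2 * (3 * (K * M) * n)) := by gcongr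
      _ = (6 * K * n * k) * M := by ring
      _ < M * M := by
        refine Nat.mul_lt_mul_of_pos_right ?_ (by omega)
        rw [hM]
        nlinarith [Nat.zero_le (K * n * k), Nat.zero_le (K * n)]
  set U := (shapes l).u with hU
  set V := (shapes l).v with hV
  have hUV : det2 U V ≠ 0 := det2_ne_zero (hval l).1
  have hVU : det2 V U ≠ 0 := by rw [det2_swap]; exact neg_ne_zero.2 hUV
  have hU0 := det_ne_left hUV
  have hV0 := det_ne_right hUV
  have hHl := hH l
  have hHl' := hH' l
  set I : Set (ℤ × ℤ) := {p | ∃ q, Fr x U V q ∧ H l q.1.center = (p.1 : ℝ) + 1 / 2 ∧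
    H' l q.1.center = (p.2 : ℝ) + 1 / 2} with hI
  have key : ∃ a b : ℤ, ∀ i j : ℕ, i < n → j < n → (a + i, b + j) ∈ I := by
    set idx : ℕ × ℕ → ℤ × ℤ := fun p =>
      (⌊H l (tl (P p)).center⌋, ⌊H' l (tl (P p)).center⌋) with hidx
    set S' := S.filter fun p => ix (P p) = l with hS'
    have hfr : ∀ p ∈ S', Fr x U V (tl (P p), 2) := by
      intro p hp
      have h1 := hix (P p)
      rw [(Finset.mem_filter.1 hp).2] at h1
      refine ⟨ht1 _, h1.2, Or.inr ?_⟩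
      show -(tl (P p)).u = _
      rw [h1.1]
    have hval1 : ∀ p ∈ S', H l (tl (P p)).center = ((idx p).1 : ℝ) + 1 / 2 ∧
        H' l (tl (P p)).center = ((idx p).2 : ℝ) + 1 / 2 := by
      intro p hp
      have h1 := hfr p hp
      obtain ⟨n1, e1⟩ := hHl.center_half hx.1 hU0 h1.1 h1.2.2
      obtain ⟨n2, e2⟩ := hHl'.center_half hx.1 hV0 h1.1 (Or.inl h1.2.1)
      dsimp only at e1 e2
      have fl : ∀ m : ℤ, ⌊(m : ℝ) + 1 / 2⌋ = m := by
        intro m; rw [Int.floor_eq_iff]; constructor <;> linarith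
      simp only [hidx, e1, e2, fl, and_self]
    have hdist : ∀ p, ‖P p - (tl (P p)).center‖ ≤ D := fun p => hd x hx _ (ht1 _) _ (ht2 _)
    have hinj : Set.InjOn idx S' := by
      intro p hp p' hp' e
      have v1 := hval1 p hp
      have v2 := hval1 p' hp'
      rw [← e] at v2
      have := col_eq hval hx hUV hHl hHl' (hfr p hp) (hfr p' hp') (v1.1.trans v2.1.symm)
        (v1.2.trans v2.2.symm)
      have e2 : tl (P p) = tl (P p') := congrArg Prod.fst this
      have d1 := hdist p
      have d2 := hdist p'
      rw [← e2] at d2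
      have d3 : ‖P p - P p'‖ ≤ 2 * D := by
        have : P p - P p' = (P p - (tl (P p)).center) - (P p' - (tl (P p)).center) := by abel
        rw [this]
        refine (norm_sub_le _ _).trans (by linarith)
      have co : ∀ a b : ℕ, |L * a - L * b| ≤ 2 * D → a = b := by
        intro a b h
        rw [← mul_sub, abs_mul, abs_of_pos (by positivity)] at h
        by_contra hab
        have h1 : (1 : ℤ) ≤ |(a : ℤ) - b| := Int.one_le_abs (by omega)
        have h2 : (1 : ℝ) ≤ |(a : ℝ) - b| := by exact_mod_cast h1
        nlinarith
      have d4 := (abs_coord_le (P p - P p') 0).trans d3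
      have d5 := (abs_coord_le (P p - P p') 1).trans d3
      simp [hP] at d4 d5
      exact Prod.ext (co _ _ d4) (co _ _ d5)
    have hPn : ∀ p ∈ S, ‖P p - P (0, 0)‖ ≤ 2 * L * M := by
      intro p hp
      obtain ⟨h1, h2⟩ := Finset.mem_product.1 hp
      have h1' : (p.1 : ℝ) ≤ M := by exact_mod_cast (Finset.mem_range.1 h1).le
      have h2' : (p.2 : ℝ) ≤ M := by exact_mod_cast (Finset.mem_range.1 h2).le
      have e : P p - P (0, 0) = !₂[L * p.1, 0] + !₂[0, L * p.2] := by
        ext i; fin_cases i <;> simp [hP]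
      rw [e]
      refine (norm_add_le _ _).trans ?_
      have n1 : ‖!₂[L * (p.1 : ℝ), 0]‖ = L * p.1 := by
        rw [EuclideanSpace.norm_eq]; simp
        rw [Real.sqrt_sq (by positivity)]
      have n2 : ‖!₂[0, L * (p.2 : ℝ)]‖ = L * p.2 := by
        rw [EuclideanSpace.norm_eq]; simp
        rw [Real.sqrt_sq (by positivity)]
      rw [n1, n2]
      have : 0 < L := by positivity
      nlinarith
    have hbox : ∀ F W, IsH x W F → ∀ p ∈ S, ⌊F (tl (P p)).center⌋ ∈
        Finset.Ico (⌊F (tl (P (0, 0))).center⌋ - (K * M : ℕ)) (⌊F (tl (P (0, 0))).center⌋ - (K * M : ℕ) + N) := by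
      intro F W hF p hp
      have h1 := hc x hx W F hF (tl (P p)).center (tl (P (0, 0))).center
      have h2 : ‖(tl (P p)).center - (tl (P (0, 0))).center‖ ≤ 2 * L * M + 2 * D := by
        have : (tl (P p)).center - (tl (P (0, 0))).center = (P p - P (0, 0)) -
          (P p - (tl (P p)).center) + (P (0, 0) - (tl (P (0, 0))).center) := by abel
        rw [this]
        refine (norm_add_le _ _).trans ?_
        have := norm_sub_le (P p - P (0, 0)) (P p - (tl (P p)).center)
        have := hPn p hp
        have := hdist p
        have := hdist (0, 0)
        linarith
      have hM1 : (1 : ℝ) ≤ M := by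
        have : 1 ≤ M := by omega
        exact_mod_cast this
      have h3 : |F (tl (P p)).center - F (tl (P (0, 0))).center| < K * M - 1 + 1 := by
        refine h1.trans_lt ?_
        have h4 : C * ‖(tl (P p)).center - (tl (P (0, 0))).center‖ ≤ C * (2 * L * M + 2 * D) := by
          gcongr
        have h5 : C * (2 * L * M + 2 * D) ≤ C * (2 * L + 2 * D) * M := by
          have : 0 ≤ C * D * (M - 1) := by
            have : (0 : ℝ) ≤ M - 1 := by linarith
            positivity
          nlinarith
        have h6 : C * (2 * L + 2 * D) * M < K * M := by
          have : (0 : ℝ) < M := by linarith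
          nlinarith
        linarith
      rw [abs_lt] at h3
      have f1 := Int.floor_le (F (tl (P p)).center)
      have f2 := Int.lt_floor_add_one (F (tl (P p)).center)
      have f3 := Int.floor_le (F (tl (P (0, 0))).center)
      have f4 := Int.lt_floor_add_one (F (tl (P (0, 0))).center)
      have g1 : ((⌊F (tl (P (0, 0))).center⌋ : ℝ)) - (K * M : ℕ) <
          (⌊F (tl (P p)).center⌋ : ℝ) + 1 := by
        push_cast; linarith
      have g2 : (⌊F (tl (P p)).center⌋ : ℝ) < ⌊F (tl (P (0, 0))).center⌋ + (K * M : ℕ) + 1 := by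
        push_cast; linarith
      have g3 : ⌊F (tl (P (0, 0))).center⌋ - ((K * M : ℕ) : ℤ) < ⌊F (tl (P p)).center⌋ + 1 := by
        exact_mod_cast g1
      have g4 : ⌊F (tl (P p)).center⌋ < ⌊F (tl (P (0, 0))).center⌋ + ((K * M : ℕ) : ℤ) + 1 := by
        exact_mod_cast g2
      rw [Finset.mem_Ico, hN]
      generalize K * M = J at *
      push_cast at *
      constructor <;> omega
    refine exists_square_of_count (I := I) (G := S'.image idx) ?_ ?_ ?_
      (A := ⌊H l (tl (P (0, 0))).center⌋ - (K * M : ℕ))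
      (B := ⌊H' l (tl (P (0, 0))).center⌋ - (K * M : ℕ)) (N := N) ?_ ?_ hn ?_
    · rintro a b c e ⟨q, hq, q1, q2⟩ ⟨q', hq', q1', q2'⟩ hae hec
      obtain ⟨i, hi⟩ := hq.symm
      obtain ⟨i', hi'⟩ := hq'.symm
      dsimp only at q1 q2 q1' q2'
      have hm : ((e - a).toNat : ℝ) = e - a := by
        have : ((e - a).toNat : ℤ) = e - a := Int.toNat_of_nonneg (by omega)
        exact_mod_cast this
      have hec' : (e : ℝ) ≤ c := by exact_mod_cast hec
      obtain ⟨p, hp, p1, p2⟩ := col_between hval hx hVU hHl' hHl hi hi'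
        (by dsimp only; rw [q2, q2']) (e - a).toNat (by dsimp only; rw [q1, q1', hm]; linarith)
      obtain ⟨j, hj⟩ := hp.symm
      refine ⟨(p.1, j), hj, ?_, ?_⟩
      · dsimp only at p1 p2 ⊢; rw [p2, q1, hm]; ring
      · dsimp only at p1 p2 ⊢; rw [p1, q2]
    · rintro a b d e ⟨q, hq, q1, q2⟩ ⟨q', hq', q1', q2'⟩ hae hec
      dsimp only at q1 q2 q1' q2'
      have hm : ((e - b).toNat : ℝ) = e - b := by
        have : ((e - b).toNat : ℤ) = e - b := Int.toNat_of_nonneg (by omega)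
        exact_mod_cast this
      have hec' : (e : ℝ) ≤ d := by exact_mod_cast hec
      obtain ⟨p, hp, p1, p2⟩ := col_between hval hx hUV hHl hHl' hq hq'
        (by rw [q1, q1']) (e - b).toNat (by rw [q2, q2', hm]; linarith)
      refine ⟨p, hp, ?_, ?_⟩
      · dsimp only; rw [p1, q1]
      · dsimp only; rw [p2, q2, hm]; ring
    · intro p hp
      obtain ⟨p', hp', rfl⟩ := Finset.mem_image.1 hp
      exact ⟨_, hfr p' hp', (hval1 p' hp').1, (hval1 p' hp').2⟩
    · intro p hp
      obtain ⟨p', hp', rfl⟩ := Finset.mem_image.1 hp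
      exact hbox _ _ hHl p' (Finset.mem_filter.1 hp').1
    · intro p hp
      obtain ⟨p', hp', rfl⟩ := Finset.mem_image.1 hp
      exact hbox _ _ hHl' p' (Finset.mem_filter.1 hp').1
    · rw [Finset.card_image_of_injOn hinj]; exact hl
  obtain ⟨a, b, hab⟩ := key
  exact ⟨l, a, b, fun i j hi hj => hab i j hi hj⟩
end

/-! ### Lifting a Wang tileset to rhombus tiles -/

/-- Colour tuple as a function. -/
def cf (c : WT) : Fin 4 → ℕ := ![c.1, c.2.1, c.2.2.1, c.2.2.2]

/-- Colour function as a tuple. -/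
def tup (f : Fin 4 → ℕ) : WT := (f 0, f 1, f 2, f 3)

theorem cf_tup (f : Fin 4 → ℕ) : cf (tup f) = f := by
  funext i; fin_cases i <;> rfl

/-- `r` has the edge directions `U`, `V`. -/
def IsFrame (U V : Pt) (r : Rhombus) : Prop :=
  ∃ i, r.off i = V ∧ (r.off (i + 1) = U ∨ r.off (i + 1) = -U)

open Classical in
/-- The colour of the Wang tile `t` in direction `o` with respect to the frame `U`, `V`. -/
def cdir (U V o : Pt) (t : WT) : ℕ :=
  if o = U then t.2.1 else if o = -U then t.1 else if o = V then t.2.2.2 else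
    if o = -V then t.2.2.1 else 0

theorem dirs_ne {U V : Pt} (h : det2 U V ≠ 0) : -U ≠ U ∧ V ≠ U ∧ V ≠ -U ∧ -V ≠ U ∧ -V ≠ -U ∧ -V ≠ V := by
  have hU := det_ne_left h
  have hV := det_ne_right h
  refine ⟨(ne_neg_self hU).symm, ?_, ?_, ?_, ?_, (ne_neg_self hV).symm⟩
  · rintro rfl; simp [det2_self] at h
  · rintro rfl; simp [det2_self] at h
  · rintro rfl; simp [det2_self] at h
  · intro e; rw [neg_injective e] at h; simp [det2_self] at h

theorem cdir_U (U V : Pt) (t : WT) : cdir U V U t = t.2.1 := by simp [cdir]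
theorem cdir_nU {U V : Pt} (h : det2 U V ≠ 0) (t : WT) : cdir U V (-U) t = t.1 := by
  simp [cdir, (dirs_ne h).1]
theorem cdir_V {U V : Pt} (h : det2 U V ≠ 0) (t : WT) : cdir U V V t = t.2.2.2 := by
  obtain ⟨h1, h2, h3, h4, h5, h6⟩ := dirs_ne h
  simp [cdir, h2, h3]
theorem cdir_nV {U V : Pt} (h : det2 U V ≠ 0) (t : WT) : cdir U V (-V) t = t.2.2.1 := by
  obtain ⟨h1, h2, h3, h4, h5, h6⟩ := dirs_ne h
  unfold cdir
  rw [if_neg h4, if_neg h5, if_neg h6, if_pos rfl]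

open Classical in
/-- Possible colours of shape `s` in the layer with frame `g`. -/
def opt (g s : Rhombus) (W : List WT) : List WT :=
  if IsFrame g.u g.v s then W.map fun t => tup fun i => cdir g.u g.v (s.off i) t
  else (cols W).flatMap fun a => (cols W).map fun b => (a, b, a, b)

/-- Componentwise pairing of colours. -/
def pr4 (o c : WT) : WT :=
  (Nat.pair o.1 c.1, Nat.pair o.2.1 c.2.1, Nat.pair o.2.2.1 c.2.2.1, Nat.pair o.2.2.2 c.2.2.2)

/-- Superposition of layers. -/
def comb (s : Rhombus) (W : List WT) : List Rhombus → List WT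
  | [] => [(0, 0, 0, 0)]
  | g :: gs => (opt g s W).flatMap fun o => (comb s W gs).map fun c => pr4 o c

/-- The lifted tileset. -/
def lift {k : ℕ} (shapes : Fin k → Rhombus) (W : List WT) : List (SymbTile k) :=
  (List.finRange k).flatMap fun m =>
    (comb (shapes m) W ((List.finRange k).map shapes)).map fun c => (m, c)

/-- Encode a list of colours. -/
def encL : List ℕ → ℕ
  | [] => 0
  | a :: l => Nat.pair a (encL l)

/-- Decode one layer. -/
def decL : ℕ → ℕ → ℕ
  | 0, c => c.unpair.1
  | j + 1, c => decL j c.unpair.2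

theorem comb_complete (s : Rhombus) (W : List WT) (K : Rhombus → Fin 4 → ℕ) (gs : List Rhombus)
    (h : ∀ g ∈ gs, tup (K g) ∈ opt g s W) :
    tup (fun i => encL (gs.map fun g => K g i)) ∈ comb s W gs := by
  induction gs with
  | nil => simp [comb, tup, encL]
  | cons g gs ih =>
    simp only [comb, List.mem_flatMap, List.mem_map]
    exact ⟨_, h g (by simp), _, ih fun g hg => h g (by simp [hg]), rfl⟩

theorem comb_sound (s : Rhombus) (W : List WT) (gs : List Rhombus) {c : WT} (hc : c ∈ comb s W gs)
    (j : ℕ) (hj : j < gs.length) : tup (fun i => decL j (cf c i)) ∈ opt gs[j] s W := by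
  induction gs generalizing c j with
  | nil => simp at hj
  | cons g gs ih =>
    simp only [comb, List.mem_flatMap, List.mem_map] at hc
    obtain ⟨o, ho, c', hc', rfl⟩ := hc
    cases j with
    | zero =>
      have : tup (fun i => decL 0 (cf (pr4 o c') i)) = o := by
        simp [tup, decL, cf, pr4]
      rw [this]; exact ho
    | succ j =>
      have := ih hc' j (by simpa using hj)
      have e : tup (fun i => decL (j + 1) (cf (pr4 o c') i)) = tup (fun i => decL j (cf c' i)) := by
        simp [tup, decL, cf, pr4]
      rw [e]; exact this

theorem opt_frame {g s : Rhombus} {W : List WT} {f : Fin 4 → ℕ} (h : tup f ∈ opt g s W)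
    (hf : IsFrame g.u g.v s) : ∃ t ∈ W, ∀ i, f i = cdir g.u g.v (s.off i) t := by
  rw [opt, if_pos hf, List.mem_map] at h
  obtain ⟨t, ht, e⟩ := h
  refine ⟨t, ht, fun i => ?_⟩
  have := congrArg cf e
  rw [cf_tup, cf_tup] at this
  exact (congrFun this i).symm

theorem opt_pass {g s : Rhombus} {W : List WT} {f : Fin 4 → ℕ} (h : tup f ∈ opt g s W)
    (hf : ¬ IsFrame g.u g.v s) (i : Fin 4) : f (i + 2) = f i := by
  rw [opt, if_neg hf] at h
  simp only [List.mem_flatMap, List.mem_map] at h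
  obtain ⟨a, -, b, -, e⟩ := h
  simp only [tup, Prod.mk.injEq] at e
  obtain ⟨e0, e1, e2, e3⟩ := e
  fin_cases i
  · show f 2 = f 0; rw [← e0, ← e2]
  · show f 3 = f 1; rw [← e1, ← e3]
  · show f 0 = f 2; rw [← e0, ← e2]
  · show f 1 = f 3; rw [← e1, ← e3]

theorem off_congr {r s : Rhombus} (h : r.SameShape s) : r.off = s.off := by
  unfold Rhombus.off; rw [h.1, h.2]

section
variable {k : ℕ} {shapes : Fin k → Rhombus} {X : Set (Set Rhombus)}

theorem lift_sound (hval : ∀ i, (shapes i).IsValid)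
    (hX : ∀ x ∈ X, IsTilingOn (Set.range shapes) x) {W : List WT}
    (h : DominoPred shapes X (lift shapes W)) (n : ℕ) : TilesSq W n := by
  classical
  obtain ⟨y, ⟨-, hinj, hmatch⟩, hreal, hyX⟩ := h
  set x := eraseColors y with hxdef
  have hx := hX x hyX
  rcases Nat.eq_zero_or_pos n with rfl | hn
  · exact ⟨fun _ _ => (0, 0, 0, 0), by omega, by omega, by omega⟩
  have hU0 : ∀ l, (shapes l).u ≠ 0 := fun l => det_ne_left (det2_ne_zero (hval l).1)
  have hV0 : ∀ l, (shapes l).v ≠ 0 := fun l => det_ne_right (det2_ne_zero (hval l).1)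
  choose H hH using fun l => exists_H hval hx (hU0 l)
  choose H' hH' using fun l => exists_H hval hx (hV0 l)
  obtain ⟨l, a, b, hab⟩ := exists_frame_square hval hx H H' hH hH' n hn
  have hUV := det2_ne_zero (hval l).1
  set U := (shapes l).u with hU
  set V := (shapes l).v with hV
  have hVU : det2 V U ≠ 0 := by rw [det2_swap]; exact neg_ne_zero.2 hUV
  have ex : ∀ r : Rhombus, ∃ c : Fin 4 → ℕ, r ∈ x → (⟨r, c⟩ : ColoredRhombus) ∈ y := by
    intro r
    by_cases hr : r ∈ x
    · obtain ⟨t, ht, rfl⟩ := hr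
      exact ⟨t.color, fun _ => ht⟩
    · exact ⟨fun _ => 0, fun h => (hr h).elim⟩
  choose C hC using ex
  have hopt : ∀ r ∈ x, tup (fun i => decL l (C r i)) ∈ opt (shapes l) r W := by
    intro r hr
    obtain ⟨p, hp, h1, h2⟩ := hreal _ (hC r hr)
    simp only [lift, List.mem_flatMap, List.mem_map] at hp
    obtain ⟨m, -, c, hc, rfl⟩ := hp
    have := comb_sound _ _ _ hc l (by simp)
    have e : C r = cf c := h2
    rw [e]
    have e2 : opt (shapes l) r W = opt (shapes l) (shapes m) W := by
      unfold opt IsFrame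
      rw [off_congr h1]
    rw [e2]
    simpa using this
  set col : Rhombus → Fin 4 → ℕ := fun r i => decL l (C r i) with hcol
  have hm : ∀ r ∈ x, ∀ s ∈ x, r ≠ s → ∀ i j, r.edge i = s.edge j → col r i = col s j := by
    intro r hr s hs hne i j he
    simp only [hcol]
    exact congrArg (decL l) (hmatch _ (hC r hr) _ (hC s hs) hne i j he)
  have hp : ∀ r ∈ x, (¬ ∃ i, Fr x U V (r, i)) → ∀ i, col r (i + 2) = col r i := by
    intro r hr hnf i
    refine opt_pass (hopt r hr) ?_ i
    rintro ⟨i, hi⟩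
    exact hnf ⟨i, hr, hi⟩
  have hp' : ∀ r ∈ x, (¬ ∃ i, Fr x V U (r, i)) → ∀ i, col r (i + 2) = col r i := by
    intro r hr hnf i
    refine hp r hr ?_ i
    rintro ⟨i, hi⟩
    exact hnf hi.symm
  have hex : ∀ i j : ℕ, ∃ (q : Rhombus × Fin 4) (t : WT), i < n → j < n → Fr x U V q ∧
      H l q.1.center = ((a + i : ℤ) : ℝ) + 1 / 2 ∧ H' l q.1.center = ((b + j : ℤ) : ℝ) + 1 / 2 ∧
      t ∈ W ∧ ∀ c, col q.1 c = cdir U V (q.1.off c) t := by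
    intro i j
    by_cases hij : i < n ∧ j < n
    · obtain ⟨q, hq, h1, h2⟩ := hab i j hij.1 hij.2
      obtain ⟨t, ht, h3⟩ := opt_frame (hopt q.1 hq.1) ⟨q.2, hq.2⟩
      exact ⟨q, t, fun _ _ => ⟨hq, h1, h2, ht, h3⟩⟩
    · exact ⟨(shapes l, 0), (0, 0, 0, 0), fun h1 h2 => (hij ⟨h1, h2⟩).elim⟩
  choose q t hqt using hex
  refine ⟨t, fun i j hi hj => (hqt i j hi hj).2.2.2.1, fun i j hi hj => ?_, fun i j hi hj => ?_⟩
  · obtain ⟨f1, a1, a2, -, a3⟩ := hqt i j (by omega) hj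
    obtain ⟨f2, b1, b2, -, b3⟩ := hqt (i + 1) j hi hj
    obtain ⟨c, hc⟩ := f1.symm
    obtain ⟨c', hc'⟩ := f2.symm
    have := col_color hval hx hVU (hH' l) (hH l) hc hc' (by dsimp only; rw [a2, b2])
      (by dsimp only; rw [a1, b1]; push_cast; ring) col hm hp'
    dsimp only at this
    rw [a3, b3, Rhombus.off_two] at this
    have o1 : (q i j).1.off c = U := hc.2.1
    have o2 : (q (i + 1) j).1.off c' = U := hc'.2.1
    rw [o1, o2, cdir_U, cdir_nU hUV] at this
    exact this
  · obtain ⟨f1, a1, a2, -, a3⟩ := hqt i j hi (by omega)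
    obtain ⟨f2, b1, b2, -, b3⟩ := hqt i (j + 1) hi hj
    have := col_color hval hx hUV (hH l) (hH' l) f1 f2 (by rw [a1, b1])
      (by rw [a2, b2]; push_cast; ring) col hm hp
    rw [a3, b3, Rhombus.off_two, f1.2.1, f2.2.1, cdir_V hUV, cdir_nV hUV] at this
    exact this

open Classical in
/-- The colour of an edge with midpoint `z` and direction `d` in the complete lift. -/
def KK (T : ℤ → ℤ → WT) (H H' : Pt → ℝ) (U V z d : Pt) : ℕ :=
  if d = U ∨ d = -U then (T ⌊H z⌋ ⌊H' z⌋).2.2.1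
  else if d = V ∨ d = -V then (T ⌊H z⌋ ⌊H' z⌋).1 else 0

theorem pm_neg {d U : Pt} : (-d = U ∨ -d = -U) ↔ (d = U ∨ d = -U) := by
  constructor
  · rintro (h | h)
    · right; rw [← h, neg_neg]
    · left; exact neg_injective h
  · rintro (h | h)
    · right; rw [h]
    · left; rw [h, neg_neg]

theorem KK_neg (T : ℤ → ℤ → WT) (H H' : Pt → ℝ) (U V z d : Pt) :
    KK T H H' U V z (-d) = KK T H H' U V z d := by
  unfold KK
  simp only [pm_neg]

theorem IsFrame.symm {U V : Pt} {r : Rhombus} (h : IsFrame U V r) : IsFrame V U r := by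
  obtain ⟨i, hi⟩ := h
  obtain ⟨j, hj⟩ := Fr.symm (x := univ) (q := (r, i)) ⟨mem_univ r, hi⟩
  exact ⟨j, hj.2⟩

theorem isFrame_of {U V : Pt} {r : Rhombus} {i : Fin 4} (h : r.off i = V ∨ r.off i = -V)
    (h' : r.off (i + 1) = U ∨ r.off (i + 1) = -U) : IsFrame U V r := by
  rcases h with h | h
  · exact ⟨i, h, h'⟩
  · refine ⟨i + 2, by rw [r.off_two, h, neg_neg], ?_⟩
    rw [show i + 2 + 1 = i + 3 by rw [add_assoc]; rfl, r.off_three]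
    exact pm_neg.2 h'

theorem KK_opt {x : Set Rhombus} (hx : IsTiling x) {W : List WT} {T : ℤ → ℤ → WT}
    (hT : ∀ i j, T i j ∈ W) (hT1 : ∀ i j, (T i j).2.1 = (T (i + 1) j).1)
    (hT2 : ∀ i j, (T i j).2.2.2 = (T i (j + 1)).2.2.1) {g r : Rhombus} (hg : g.IsValid)
    {H H' : Pt → ℝ} (hH : IsH x g.u H) (hH' : IsH x g.v H') (hr : r ∈ x) :
    tup (fun i => KK T H H' g.u g.v (r.mid i) (r.off (i + 1))) ∈ opt g r W := by
  have hUV := det2_ne_zero hg.1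
  have hU0 := det_ne_left hUV
  have hV0 := det_ne_right hUV
  obtain ⟨d1, d2, d3, d4, d5, d6⟩ := dirs_ne hUV
  have hrv := hx.1 r hr
  have fl : ∀ m : ℤ, ⌊(m : ℝ) + 1 / 2⌋ = m := by
    intro m; rw [Int.floor_eq_iff]; constructor <;> linarith
  by_cases hf : IsFrame g.u g.v r
  · rw [opt, if_pos hf, List.mem_map]
    obtain ⟨c, hc1, hc2⟩ := hf
    obtain ⟨a, ha⟩ := hH.center_half hx hU0 hr hc2
    obtain ⟨b, hb⟩ := hH'.center_half hx hV0 hr (Or.inl hc1)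
    refine ⟨T a b, hT a b, ?_⟩
    congr 1
    funext i
    have hmU := hH.mid_eq hx hU0 hr i
    have hmV := hH'.mid_eq hx hV0 hr i
    -- sides in direction `V`
    have key1 : ∀ i, (r.off i = g.v ∨ r.off i = -g.v) → (r.off (i + 1) = g.u ∨ r.off (i + 1) = -g.u) →
        cdir g.u g.v (r.off i) (T a b) = KK T H H' g.u g.v (r.mid i) (r.off (i + 1)) := by
      intro i h1 h2
      unfold KK
      rw [if_pos h2, hH.mid_eq hx hU0 hr i, hH'.mid_eq hx hV0 hr i, off_not_both' hrv h2, ha, hb]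
      rcases h1 with h1 | h1
      · rw [h1, eps_self, cdir_V hUV, hT2]
        have e : (b : ℝ) + 1 / 2 + 1 / 2 * 1 = ((b + 1 : ℤ) : ℝ) := by push_cast; ring
        rw [e, Int.floor_intCast, mul_zero, add_zero, fl]
      · rw [h1, eps_neg_self hV0, cdir_nV hUV]
        have e : (b : ℝ) + 1 / 2 + 1 / 2 * (-1) = (b : ℝ) := by ring
        rw [e, Int.floor_intCast, mul_zero, add_zero, fl]
    have key2 : ∀ i, (r.off i = g.u ∨ r.off i = -g.u) → (r.off (i + 1) = g.v ∨ r.off (i + 1) = -g.v) →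
        cdir g.u g.v (r.off i) (T a b) = KK T H H' g.u g.v (r.mid i) (r.off (i + 1)) := by
      intro i h1 h2
      have h3 : ¬ (r.off (i + 1) = g.u ∨ r.off (i + 1) = -g.u) := by
        rcases h2 with h2 | h2 <;> rw [h2]
        · exact not_or.2 ⟨d2, d3⟩
        · exact not_or.2 ⟨d4, d5⟩
      unfold KK
      rw [if_neg h3, if_pos h2, hH.mid_eq hx hU0 hr i, hH'.mid_eq hx hV0 hr i, off_not_both' hrv h2,
        ha, hb]
      rcases h1 with h1 | h1
      · rw [h1, eps_self, cdir_U, hT1]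
        have e : (a : ℝ) + 1 / 2 + 1 / 2 * 1 = ((a + 1 : ℤ) : ℝ) := by push_cast; ring
        rw [e, Int.floor_intCast, mul_zero, add_zero, fl]
      · rw [h1, eps_neg_self hU0, cdir_nU hUV]
        have e : (a : ℝ) + 1 / 2 + 1 / 2 * (-1) = (a : ℝ) := by ring
        rw [e, Int.floor_intCast, mul_zero, add_zero, fl]
    have e1 : c + 1 + 1 = c + 2 := by rw [add_assoc]; rfl
    have e2 : c + 2 + 1 = c + 3 := by rw [add_assoc]; rfl
    have e3 : c + 3 + 1 = c := by rw [add_assoc]; exact add_zero c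
    rcases Rhombus.fin4_cases c i with h | h | h | h
    · rw [h]; exact key1 c (Or.inl hc1) hc2
    · rw [h]; exact key2 _ hc2 (by rw [e1, r.off_two, hc1]; exact Or.inr rfl)
    · rw [h]
      exact key1 _ (by rw [r.off_two, hc1]; exact Or.inr rfl) (by
        rw [e2, r.off_three]; exact pm_neg.2 hc2)
    · rw [h]
      exact key2 _ (by rw [r.off_three]; exact pm_neg.2 hc2) (by rw [e3]; exact Or.inl hc1)
  · have same : ∀ i, KK T H H' g.u g.v (r.mid (i + 2)) (r.off (i + 2 + 1)) =
        KK T H H' g.u g.v (r.mid i) (r.off (i + 1)) := by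
      intro i
      have e2 : i + 2 + 1 = i + 3 := by rw [add_assoc]; rfl
      rw [e2, r.off_three, KK_neg]
      have both : (r.off (i + 1) = g.u ∨ r.off (i + 1) = -g.u) ∨
          (r.off (i + 1) = g.v ∨ r.off (i + 1) = -g.v) →
          eps g.u (r.off i) = 0 ∧ eps g.v (r.off i) = 0 := by
        rintro (h | h)
        · refine ⟨off_not_both' hrv h, ?_⟩
          by_contra h0
          refine hf (isFrame_of (i := i) ?_ h)
          by_contra h1
          rw [not_or] at h1
          exact h0 (eps_zero h1.1 h1.2)
        · refine ⟨?_, off_not_both' hrv h⟩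
          by_contra h0
          refine hf (isFrame_of (U := g.v) (V := g.u) (i := i) ?_ h).symm
          by_contra h1
          rw [not_or] at h1
          exact h0 (eps_zero h1.1 h1.2)
      by_cases hb : (r.off (i + 1) = g.u ∨ r.off (i + 1) = -g.u) ∨
          (r.off (i + 1) = g.v ∨ r.off (i + 1) = -g.v)
      · obtain ⟨z1, z2⟩ := both hb
        unfold KK
        rw [hH.mid_eq hx hU0 hr, hH'.mid_eq hx hV0 hr, hH.mid_eq hx hU0 hr, hH'.mid_eq hx hV0 hr,
          r.off_two, eps_neg hU0, eps_neg hV0, z1, z2]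
        simp
      · rw [not_or] at hb
        unfold KK
        rw [if_neg hb.1, if_neg hb.2, if_neg hb.1, if_neg hb.2]
    have hcol : ∀ i, KK T H H' g.u g.v (r.mid i) (r.off (i + 1)) ∈ cols W := by
      intro i
      unfold KK
      split_ifs
      · exact (cols_of_mem (hT _ _)).2.2.1
      · exact (cols_of_mem (hT _ _)).1
      · exact zero_mem_cols W
    rw [opt, if_neg hf]
    simp only [List.mem_flatMap, List.mem_map]
    refine ⟨_, hcol 0, _, hcol 1, ?_⟩
    have s0 := same 0
    have s1 := same 1
    simp only [tup, Prod.mk.injEq, true_and]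
    exact ⟨s0.symm, s1.symm⟩

theorem lift_complete (hval : ∀ i, (shapes i).IsValid)
    (hX : ∀ x ∈ X, IsTilingOn (Set.range shapes) x) (hne : X.Nonempty) {W : List WT}
    (h : TilesZ W) : DominoPred shapes X (lift shapes W) := by
  obtain ⟨T, hT, hT1, hT2⟩ := h
  obtain ⟨x, hxX⟩ := hne
  have hx := hX x hxX
  have hg : ∀ g : Rhombus, ∃ H H' : Pt → ℝ, g.IsValid → IsH x g.u H ∧ IsH x g.v H' := by
    intro g
    by_cases hg : g.IsValid
    · have hUV := det2_ne_zero hg.1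
      obtain ⟨H, hH⟩ := exists_H hval hx (det_ne_left hUV)
      obtain ⟨H', hH'⟩ := exists_H hval hx (det_ne_right hUV)
      exact ⟨H, H', fun _ => ⟨hH, hH'⟩⟩
    · exact ⟨fun _ => 0, fun _ => 0, fun h => (hg h).elim⟩
  choose H H' hHH using hg
  set K : Rhombus → Fin 4 → Rhombus → ℕ := fun r i g =>
    KK T (H g) (H' g) g.u g.v (r.mid i) (r.off (i + 1)) with hK
  set c : Rhombus → Fin 4 → ℕ := fun r i => encL (((List.finRange k).map shapes).map (K r i)) with hc
  set y : Set ColoredRhombus := (fun r => ⟨r, c r⟩) '' x with hy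
  have hyx : eraseColors y = x := by
    unfold eraseColors
    rw [hy, Set.image_image]
    simp
  refine ⟨y, ⟨hyx.symm ▸ hx.1, ?_, ?_⟩, ?_, hyx.symm ▸ hxX⟩
  · rintro _ ⟨r, hr, rfl⟩ _ ⟨s, hs, rfl⟩ e
    dsimp only at e
    rw [e]
  · rintro _ ⟨r, hr, rfl⟩ _ ⟨s, hs, rfl⟩ hne i j e
    dsimp only at e ⊢
    obtain ⟨e1, e2⟩ := edge_match (hx.1.1 r hr) e
    have : K r i = K s j := by
      funext g
      simp only [hK]
      rw [e1]
      rcases e2 with e2 | e2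
      · rw [e2]
      · rw [e2, KK_neg]
    simp only [hc]
    rw [this]
  · rintro _ ⟨r, hr, rfl⟩
    obtain ⟨_, ⟨m, rfl⟩, hm⟩ := hx.2 r hr
    refine ⟨(m, tup (c r)), ?_, hm, (cf_tup (c r)).symm⟩
    simp only [lift, List.mem_flatMap, List.mem_map]
    refine ⟨m, by simp, _, ?_, rfl⟩
    refine comb_complete _ W (fun g i => K r i g) _ fun g hg => ?_
    obtain ⟨l, -, rfl⟩ := List.mem_map.1 hg
    have := KK_opt hx.1 hT hT1 hT2 (hval l) (hHH _ (hval l)).1 (hHH _ (hval l)).2 hr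
    have e2 : opt (shapes l) r W = opt (shapes l) (shapes m) W := by
      unfold opt IsFrame
      rw [off_congr hm]
    rw [← e2]
    exact this
end

/-! ### Computability of the tileset transformations -/

theorem primrec_constFlatMap {ι α β : Type} [Primcodable α] [Primcodable β] (L : List ι)
    (f : ι → α → List β) (h : ∀ i, Primrec (f i)) :
    Primrec fun a => L.flatMap fun i => f i a := by
  induction L with
  | nil => exact Primrec.const []
  | cons i L ih => exact Primrec.list_append.comp (h i) ih

theorem primrec_mapW {α β γ : Type} [Primcodable α] [Primcodable β] [Primcodable γ]
    {l : α → List β} (f : β → γ) (hl : Primrec l) (hf : Primrec f) :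
    Primrec fun a => (l a).map f :=
  Primrec.list_map hl (hf.comp Primrec.snd).to₂

theorem prim_w : Primrec fun t : WT => t.1 := Primrec.fst
theorem prim_e : Primrec fun t : WT => t.2.1 := Primrec.fst.comp Primrec.snd
theorem prim_s : Primrec fun t : WT => t.2.2.1 := Primrec.fst.comp (Primrec.snd.comp Primrec.snd)
theorem prim_n : Primrec fun t : WT => t.2.2.2 := Primrec.snd.comp (Primrec.snd.comp Primrec.snd)

theorem prim_mk {α : Type} [Primcodable α] {a b c d : α → ℕ} (ha : Primrec a) (hb : Primrec b)
    (hc : Primrec c) (hd : Primrec d) : Primrec fun x => ((a x, b x, c x, d x) : WT) :=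
  ha.pair (hb.pair (hc.pair hd))

theorem prim_cols : Primrec cols := by
  refine Primrec.list_cons.comp (Primrec.const 0) ?_
  refine Primrec.list_flatMap Primrec.id ?_
  refine (?_ : Primrec fun t : WT => [t.1, t.2.1, t.2.2.1, t.2.2.2]).comp Primrec.snd
  exact Primrec.list_cons.comp prim_w (Primrec.list_cons.comp prim_e
    (Primrec.list_cons.comp prim_s (Primrec.list_cons.comp prim_n (Primrec.const []))))

/-- Cartesian product of a list-valued function with another one. -/
theorem prim_prod {α β γ δ : Type} [Primcodable α] [Primcodable β] [Primcodable γ] [Primcodable δ]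
    {l : α → List β} {m : α → List γ} {f : β → γ → δ} (hl : Primrec l) (hm : Primrec m)
    (hf : Primrec₂ f) : Primrec fun a => (l a).flatMap fun b => (m a).map fun c => f b c := by
  refine Primrec.list_flatMap hl ?_
  refine Primrec.list_map (hm.comp Primrec.fst) ?_
  exact hf.comp (Primrec.snd.comp Primrec.fst) Primrec.snd

theorem prim_passD : Primrec passD := by
  refine prim_prod prim_cols prim_cols ?_
  exact prim_mk Primrec.fst Primrec.fst Primrec.snd Primrec.snd

theorem prim_allD : Primrec allD := by
  have h1 : Primrec fun W : List WT => (cols W).flatMap fun c => (cols W).map fun d => (c, d) :=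
    prim_prod prim_cols prim_cols Primrec.id
  have h2 : Primrec fun W : List WT => (cols W).flatMap fun b =>
      ((cols W).flatMap fun c => (cols W).map fun d => (c, d)).map fun p => (b, p) :=
    prim_prod prim_cols h1 Primrec.id
  have h3 : Primrec fun W : List WT => (cols W).flatMap fun a => ((cols W).flatMap fun b =>
      ((cols W).flatMap fun c => (cols W).map fun d => (c, d)).map fun p => (b, p)).map
      fun p => (a, p) :=
    prim_prod prim_cols h2 Primrec.id
  refine h3.of_eq fun W => ?_
  simp only [allD, List.map_flatMap, List.map_map]
  rfl

theorem prim_zeroD (a b : Bool) : Primrec (zeroD a b) := by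
  cases a <;> cases b
  · exact prim_mk prim_w prim_e prim_s prim_n
  · exact prim_mk prim_w prim_e prim_s (Primrec.const 0)
  · exact prim_mk prim_w (Primrec.const 0) prim_s prim_n
  · exact prim_mk prim_w (Primrec.const 0) prim_s (Primrec.const 0)

theorem prim_partH {L : List (BE × BE × BE × BE)} {D : List WT → List WT} (hD : Primrec D) :
    Primrec fun W => partH L (D W) := by
  refine primrec_constFlatMap L (fun q W => (D W).map fun d => combQ q d) fun q => ?_
  refine primrec_mapW _ hD ?_
  have h : ∀ c : ℕ, Primrec (Nat.pair c) := fun c => Primrec₂.natPair.comp (Primrec.const c) Primrec.id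
  exact prim_mk ((h _).comp prim_w) ((h _).comp prim_e) ((h _).comp prim_s) ((h _).comp prim_n)

theorem prim_hier : Primrec hier := by
  have h : ∀ a b, Primrec fun W => (allD W).map fun d => zeroD a b d :=
    fun a b => primrec_mapW _ prim_allD (prim_zeroD a b)
  exact Primrec.list_append.comp (Primrec.list_append.comp (Primrec.list_append.comp
    (Primrec.list_append.comp (Primrec.list_append.comp (prim_partH Primrec.id)
    (prim_partH prim_passD)) (prim_partH (h _ _))) (prim_partH (h _ _))) (prim_partH (h _ _)))
    (prim_partH (h _ _))

theorem prim_cdir (U V o : Pt) : Primrec (cdir U V o) := by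
  by_cases h1 : o = U
  · exact prim_e.of_eq fun t => by rw [cdir, if_pos h1]
  by_cases h2 : o = -U
  · exact prim_w.of_eq fun t => by rw [cdir, if_neg h1, if_pos h2]
  by_cases h3 : o = V
  · exact prim_n.of_eq fun t => by rw [cdir, if_neg h1, if_neg h2, if_pos h3]
  by_cases h4 : o = -V
  · exact prim_s.of_eq fun t => by rw [cdir, if_neg h1, if_neg h2, if_neg h3, if_pos h4]
  exact (Primrec.const 0).of_eq fun t => by
    rw [cdir, if_neg h1, if_neg h2, if_neg h3, if_neg h4]

theorem prim_opt (g s : Rhombus) : Primrec (opt g s) := by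
  unfold opt
  by_cases h : IsFrame g.u g.v s
  · simp only [h, if_true]
    exact primrec_mapW _ Primrec.id
      (prim_mk (prim_cdir _ _ _) (prim_cdir _ _ _) (prim_cdir _ _ _) (prim_cdir _ _ _))
  · simp only [h, if_false]
    exact prim_prod prim_cols prim_cols
      (prim_mk Primrec.fst Primrec.snd Primrec.fst Primrec.snd)

theorem prim_pr4 : Primrec fun p : WT × WT => pr4 p.1 p.2 := by
  have h : ∀ f : WT → ℕ, Primrec f → Primrec fun p : WT × WT => Nat.pair (f p.1) (f p.2) :=
    fun f hf => Primrec₂.natPair.comp (hf.comp Primrec.fst) (hf.comp Primrec.snd)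
  have h1 := h (fun t => t.1) prim_w
  have h2 := h (fun t => t.2.1) prim_e
  have h3 := h (fun t => t.2.2.1) prim_s
  have h4 := h (fun t => t.2.2.2) prim_n
  exact prim_mk h1 h2 h3 h4

theorem prim_comb (s : Rhombus) (gs : List Rhombus) : Primrec fun W => comb s W gs := by
  induction gs with
  | nil => exact Primrec.const _
  | cons g gs ih => exact prim_prod (prim_opt g s) ih prim_pr4

theorem prim_lift {k : ℕ} (shapes : Fin k → Rhombus) : Primrec (lift shapes) := by
  have h : ∀ m : Fin k, Primrec fun c : WT => ((m, c) : SymbTile k) := fun m =>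
    Primrec.pair (Primrec.const m) Primrec.id
  have h2 : ∀ m : Fin k, Primrec fun W : List WT =>
      (comb (shapes m) W ((List.finRange k).map shapes)).map fun c => ((m, c) : SymbTile k) :=
    fun m => primrec_mapW _ (prim_comb _ _) (h m)
  exact primrec_constFlatMap (List.finRange k) _ h2

/-! ### Turing machines and quadrant tilings -/

section Machine
open Turing

variable {Γ Λ : Type} [Inhabited Γ] [Inhabited Λ]

/-- A cell of the space-time diagram. -/
abbrev Cel (Γ Λ : Type) : Type := Γ × Option Λ

/-- The action prescribed by a cell. -/
def act (M : TM0.Machine Γ Λ) (c : Cel Γ Λ) : Option (Λ × TM0.Stmt Γ) := c.2.bind fun q => M q c.1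

/-- A halting cell. -/
def Hlt (M : TM0.Machine Γ Λ) (c : Cel Γ Λ) : Prop := c.2.isSome = true ∧ act M c = none

/-- The new symbol. -/
def nsym (M : TM0.Machine Γ Λ) (b : Cel Γ Λ) : Γ :=
  match act M b with
  | some (_, TM0.Stmt.write g) => g
  | _ => b.1

/-- The new state. -/
def nst (M : TM0.Machine Γ Λ) (a b c : Cel Γ Λ) : Option Λ :=
  match act M a with
  | some (q, TM0.Stmt.move Dir.right) => some q
  | _ => match act M c with
    | some (q, TM0.Stmt.move Dir.left) => some q
    | _ => match act M b with
      | some (q, TM0.Stmt.write _) => some q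
      | _ => none

/-- The local rule. -/
def rul (M : TM0.Machine Γ Λ) (a b c : Cel Γ Λ) : Cel Γ Λ := (nsym M b, nst M a b c)

/-- The initial cell. -/
def cel0 (l : List Γ) (i : ℕ) : Cel Γ Λ := (l.getD i default, if i = 0 then some default else none)

/-- The space-time diagram, in skewed coordinates. -/
def std (M : TM0.Machine Γ Λ) (l : List Γ) : ℕ → ℤ → Cel Γ Λ
  | 0, x => if 0 ≤ x then cel0 l x.toNat else (default, none)
  | t + 1, x => rul M (std M l t (x - 2)) (std M l t (x - 1)) (std M l t x)

theorem rul_blank (M : TM0.Machine Γ Λ) :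
    rul M (default, none) (default, none) (default, none) = (default, none) := rfl

theorem std_neg (M : TM0.Machine Γ Λ) (l : List Γ) (t : ℕ) (x : ℤ) (hx : x < 0) :
    std M l t x = (default, none) := by
  induction t generalizing x with
  | zero => rw [std, if_neg (by omega)]
  | succ t ih => rw [std, ih _ (by omega), ih _ (by omega), ih _ hx, rul_blank]

/-- Rule tile. -/
def rtile (M : TM0.Machine Γ Λ) (code : Cel Γ Λ → ℕ) (q : Cel Γ Λ × Cel Γ Λ × Cel Γ Λ) : WT :=
  (Nat.pair (code q.1) (code q.2.1), Nat.pair (code q.2.1) (code q.2.2), 1 + code q.2.2,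
    1 + code (rul M q.1 q.2.1 q.2.2))

/-- Initial tile. -/
def itile (code : Cel Γ Λ → ℕ) (l : List Γ) (i : ℕ) : WT :=
  (i, min (i + 1) (l.length + 1), 0, 1 + code (cel0 l i))

open Classical in
/-- The list of rule tiles. -/
def rtiles [Fintype Γ] [Fintype Λ] (M : TM0.Machine Γ Λ) (code : Cel Γ Λ → ℕ) : List WT :=
  ((Finset.univ.filter fun q : Cel Γ Λ × Cel Γ Λ × Cel Γ Λ => ¬ Hlt M q.2.1).toList).map
    (rtile M code)

/-- The tileset of the machine. -/
def mtiles [Fintype Γ] [Fintype Λ] (M : TM0.Machine Γ Λ) (code : Cel Γ Λ → ℕ) (l : List Γ) :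
    List WT :=
  ((List.range (l.length + 2)).map (itile code l)) ++ rtiles M code

theorem mem_mtiles [Fintype Γ] [Fintype Λ] {M : TM0.Machine Γ Λ} {code : Cel Γ Λ → ℕ} {l : List Γ}
    {w : WT} : w ∈ mtiles M code l ↔ (∃ i < l.length + 2, w = itile code l i) ∨
      ∃ a b c, ¬ Hlt M b ∧ w = rtile M code (a, b, c) := by
  simp only [mtiles, rtiles, List.mem_append, List.mem_map, List.mem_range, Finset.mem_toList,
    Finset.mem_filter, Finset.mem_univ, true_and, Prod.exists]
  constructor
  · rintro (⟨i, hi, rfl⟩ | ⟨a1, a2, b1, b2, c1, c2, h, rfl⟩)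
    · exact Or.inl ⟨i, hi, rfl⟩
    · exact Or.inr ⟨_, _, _, _, _, _, h, rfl⟩
  · rintro (⟨i, hi, rfl⟩ | ⟨a1, a2, b1, b2, c1, c2, h, rfl⟩)
    · exact Or.inl ⟨i, hi, rfl⟩
    · exact Or.inr ⟨_, _, _, _, _, _, h, rfl⟩

theorem cel0_min (l : List Γ) (i : ℕ) : (cel0 l (min i (l.length + 1)) : Cel Γ Λ) = cel0 l i := by
  rcases le_total i (l.length + 1) with h | h
  · rw [min_eq_left h]
  · rw [min_eq_right h]
    simp only [cel0]
    rw [List.getD_eq_default _ _ (by omega), List.getD_eq_default _ _ (by omega), if_neg (by omega),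
      if_neg (by omega)]

theorem mtiles_complete [Fintype Γ] [Fintype Λ] {M : TM0.Machine Γ Λ} {code : Cel Γ Λ → ℕ}
    (h0 : code (default, none) = 0) {l : List Γ}
    (h : ∀ t x, ¬ Hlt M (std M l t x)) : QuadAll (mtiles M code l) := by
  refine ⟨fun i j => match j with
    | 0 => itile code l (min i (l.length + 1))
    | t + 1 => rtile M code (std M l t (i - 2), std M l t (i - 1), std M l t i), ?_, ?_, ?_, ?_, ?_⟩
  · rintro i (_ | t)
    · exact mem_mtiles.2 (Or.inl ⟨_, by omega, rfl⟩)
    · exact mem_mtiles.2 (Or.inr ⟨_, _, _, h _ _, rfl⟩)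
  · rintro i (_ | t)
    · simp only [itile]; omega
    · simp only [rtile]
      push_cast
      rw [show (i : ℤ) + 1 - 2 = i - 1 by ring, show (i : ℤ) + 1 - 1 = i by ring]
  · rintro i (_ | t)
    · simp only [itile, rtile, cel0_min]
      rw [std, if_pos (by omega), Int.toNat_natCast]
    · simp only [rtile, std]
  · rintro (_ | t)
    · simp only [itile]; omega
    · simp only [rtile]
      rw [std_neg _ _ _ _ (by simp), std_neg _ _ _ _ (by simp), h0]; rfl
  · intro i; simp only [itile]

theorem mtiles_sound [Fintype Γ] [Fintype Λ] {M : TM0.Machine Γ Λ} {code : Cel Γ Λ → ℕ}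
    (h0 : code (default, none) = 0) (hc : Function.Injective code) {l : List Γ}
    (H : ∀ m, QuadSq (mtiles M code l) m) (t : ℕ) (x : ℤ) : ¬ Hlt M (std M l t x) := by
  rcases lt_or_ge x 0 with hx | hx
  · rw [std_neg _ _ _ _ hx]; simp [Hlt]
  obtain ⟨x, rfl⟩ := Int.eq_ofNat_of_zero_le hx
  obtain ⟨T, hT, hE, hN, hW, hS⟩ := H (x + t + 3)
  set m := x + t + 3 with hm
  -- the initial row
  have row0 : ∀ i, i < m → T i 0 = itile code l (min i (l.length + 1)) := by
    have key : ∀ i, i < m → (T i 0).1 = min i (l.length + 1) →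
        T i 0 = itile code l (min i (l.length + 1)) := by
      intro i hi hw
      rcases mem_mtiles.1 (hT i 0 hi (by omega)) with ⟨p, hp, e⟩ | ⟨a, b, c, -, e⟩
      · rw [e] at hw ⊢
        simp only [itile] at hw
        rw [hw]
      · have := hS i hi
        rw [e] at this
        simp only [rtile] at this
        omega
    intro i
    induction i with
    | zero => intro hi; exact key 0 hi (by rw [hW 0 (by omega)]; omega)
    | succ i ih =>
      intro hi
      refine key _ hi ?_
      rw [← hE i 0 hi (by omega), ih (by omega)]
      simp only [itile]; omega
  have rows : ∀ j, ∀ i, i < m → j < m → (T i j).2.2.2 = 1 + code (std M l j i) ∧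
      ∀ j', j = j' + 1 → ¬ Hlt M (std M l j' (i - 1)) := by
    intro j
    induction j with
    | zero =>
      intro i hi hj
      rw [row0 i hi]
      refine ⟨?_, fun j' hj' => by omega⟩
      simp only [itile, cel0_min]
      rw [std, if_pos (by omega), Int.toNat_natCast]
    | succ j ih =>
      have key : ∀ i, i < m → j + 1 < m →
          (T i (j + 1)).1 = Nat.pair (code (std M l j (i - 2))) (code (std M l j (i - 1))) →
          T i (j + 1) = rtile M code (std M l j (i - 2), std M l j (i - 1), std M l j i) ∧
          ¬ Hlt M (std M l j (i - 1)) := by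
        intro i hi hj hw
        have hs := hN i j hi hj
        rw [(ih i hi (by omega)).1] at hs
        rcases mem_mtiles.1 (hT i (j + 1) hi hj) with ⟨p, hp, e⟩ | ⟨a, b, c, hb, e⟩
        · rw [e] at hs
          simp only [itile] at hs
          omega
        · rw [e] at hs hw
          simp only [rtile] at hs hw
          obtain ⟨e1, e2⟩ := Nat.pair_eq_pair.1 hw
          have e3 : std M l j i = c := hc (by omega)
          rw [e, e3, ← hc e1, ← hc e2]
          exact ⟨rfl, hb⟩
      have all : ∀ i, i < m → j + 1 < m →
          T i (j + 1) = rtile M code (std M l j (i - 2), std M l j (i - 1), std M l j i) ∧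
          ¬ Hlt M (std M l j (i - 1)) := by
        intro i
        induction i with
        | zero =>
          intro hi hj
          refine key 0 hi hj ?_
          rw [hW _ hj, std_neg _ _ _ _ (by simp), std_neg _ _ _ _ (by simp), h0]; rfl
        | succ i ihi =>
          intro hi hj
          refine key _ hi hj ?_
          rw [← hE i _ hi hj, (ihi (by omega) hj).1]
          simp only [rtile]
          push_cast
          rw [show (i : ℤ) + 1 - 2 = i - 1 by ring, show (i : ℤ) + 1 - 1 = i by ring]
      intro i hi hj
      obtain ⟨e, hb⟩ := all i hi hj
      refine ⟨by rw [e]; simp only [rtile, std], fun j' hj' => ?_⟩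
      obtain rfl : j = j' := by omega
      exact hb
  have := (rows (t + 1) (x + 1) (by omega) (by omega)).2 t rfl
  push_cast at this
  rwa [show (x : ℤ) + 1 - 1 = x by ring] at this

/-- The tape cells of a configuration with head position `h`. -/
def tcel (c : TM0.Cfg Γ Λ) (h p : ℤ) : Cel Γ Λ :=
  (c.Tape.nth (p - h), if p = h then some c.q else none)

end Machine

section Machine2
open Turing

variable {Γ Λ : Type} [Inhabited Γ] [Inhabited Λ]

/-- The configurations reached after `t` steps. -/
def cfgs (M : TM0.Machine Γ Λ) (l : List Γ) : ℕ → Option (TM0.Cfg Γ Λ)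
  | 0 => some (TM0.init l)
  | t + 1 => (cfgs M l t).bind (TM0.step M)

theorem mk1_nth (l : List Γ) (x : ℤ) :
    (Tape.mk₁ l).nth x = if 0 ≤ x then l.getD x.toNat default else default := by
  rcases x with n | n
  · rw [if_pos (show (0 : ℤ) ≤ Int.ofNat n from Int.natCast_nonneg n)]
    show (Tape.mk' (ListBlank.mk []) (ListBlank.mk l)).nth (n : ℤ) = _
    rw [Tape.mk'_nth_nat, ListBlank.nth_mk]
    simp [List.getD_eq_getElem?_getD, List.getI_eq_getElem?_getD]
  · rw [if_neg (by omega)]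
    show (ListBlank.mk []).nth n = _
    simp

theorem act_tcel_ne (M : TM0.Machine Γ Λ) (c : TM0.Cfg Γ Λ) {h p : ℤ} (hp : p ≠ h) :
    act M (tcel c h p) = none := by simp [act, tcel, hp]

theorem act_tcel (M : TM0.Machine Γ Λ) (c : TM0.Cfg Γ Λ) {h p : ℤ} (hp : p = h) :
    act M (tcel c h p) = M c.q c.Tape.head := by simp [act, tcel, hp]

theorem step_tcel (M : TM0.Machine Γ Λ) (c c' : TM0.Cfg Γ Λ) (hc : TM0.step M c = some c') (h : ℤ) :
    ∃ h', h - 1 ≤ h' ∧ ∀ p, rul M (tcel c h (p - 1)) (tcel c h p) (tcel c h (p + 1)) = tcel c' h' p := by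
  obtain ⟨q, T⟩ := c
  simp only [TM0.step, Option.map_eq_some_iff, Prod.exists] at hc
  obtain ⟨q', a, hM, rfl⟩ := hc
  have hA : ∀ p : ℤ, p = h → act M (tcel ⟨q, T⟩ h p) = some (q', a) := fun p hp => by
    rw [act_tcel M _ hp]; exact hM
  have hB : ∀ p : ℤ, p ≠ h → act M (tcel ⟨q, T⟩ h p) = none := fun p hp => act_tcel_ne M _ hp
  rcases a with (_ | _) | g
  · refine ⟨h - 1, le_rfl, fun p => ?_⟩
    simp only [rul, nsym, nst]
    refine Prod.ext ?_ ?_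
    · have : (T.move Dir.left).nth (p - (h - 1)) = T.nth (p - h) := by
        rw [Tape.move_left_nth]; congr 1; ring
      simp only [tcel, this]
      by_cases hp : p = h
      · have := hA p hp
        simp only [tcel] at this
        rw [this]
      · have := hB p hp
        simp only [tcel] at this
        rw [this]
    · by_cases hp : p = h - 1
      · rw [hB (p - 1) (by omega), hA (p + 1) (by omega)]
        simp [tcel, hp]
      · rw [hB (p + 1) (by omega)]
        by_cases h2 : p = h
        · rw [hB (p - 1) (by omega), hA p h2]; simp [tcel, hp]
        · rw [hB p h2]
          by_cases h3 : p - 1 = h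
          · rw [hA _ h3]; simp [tcel, hp]
          · rw [hB _ h3]; simp [tcel, hp]
  · refine ⟨h + 1, by omega, fun p => ?_⟩
    simp only [rul, nsym, nst]
    refine Prod.ext ?_ ?_
    · have : (T.move Dir.right).nth (p - (h + 1)) = T.nth (p - h) := by
        rw [Tape.move_right_nth]; congr 1; ring
      simp only [tcel, this]
      by_cases hp : p = h
      · have := hA p hp
        simp only [tcel] at this
        rw [this]
      · have := hB p hp
        simp only [tcel] at this
        rw [this]
    · by_cases hp : p = h + 1
      · rw [hA (p - 1) (by omega)]
        simp [tcel, hp]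
      · rw [hB (p - 1) (by omega)]
        by_cases h2 : p = h
        · rw [hB (p + 1) (by omega), hA p h2]; simp [tcel, hp]
        · rw [hB p h2]
          by_cases h3 : p + 1 = h
          · rw [hA _ h3]; simp [tcel, hp]
          · rw [hB _ h3]; simp [tcel, hp]
  · refine ⟨h, by omega, fun p => ?_⟩
    simp only [rul, nsym, nst]
    by_cases hp : p = h
    · rw [hB (p - 1) (by omega), hB (p + 1) (by omega), hA p hp]
      simp [tcel, hp]
      rfl
    · have e2 : p - h ≠ 0 := by omega
      rw [hB p hp]
      by_cases h2 : p - 1 = h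
      · rw [hA _ h2, hB (p + 1) (by omega)]; simp [tcel, hp, Tape.write_nth, e2]
      · rw [hB _ h2]
        by_cases h3 : p + 1 = h
        · rw [hA _ h3]; simp [tcel, hp, Tape.write_nth, e2]
        · rw [hB _ h3]; simp [tcel, hp, Tape.write_nth, e2]

theorem std_cfgs (M : TM0.Machine Γ Λ) (l : List Γ) (t : ℕ) (c : TM0.Cfg Γ Λ)
    (hc : cfgs M l t = some c) : ∃ h : ℤ, ∀ x, std M l t x = tcel c h (x - t) := by
  induction t generalizing c with
  | zero =>
    simp only [cfgs, Option.some.injEq] at hc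
    subst hc
    refine ⟨0, fun x => ?_⟩
    simp only [std, tcel, TM0.init, mk1_nth, cel0]
    split_ifs with h1 h2 h3 h4 h5 <;> first | omega | simp_all
  | succ t ih =>
    simp only [cfgs, Option.bind_eq_some_iff] at hc
    obtain ⟨c0, h0, h1⟩ := hc
    obtain ⟨h, hh⟩ := ih c0 h0
    obtain ⟨h', -, hs⟩ := step_tcel M c0 c h1 h
    refine ⟨h', fun x => ?_⟩
    rw [std, hh, hh, hh, ← hs]
    push_cast
    congr 2 <;> ring

theorem cfgs_reaches (M : TM0.Machine Γ Λ) (l : List Γ) (c : TM0.Cfg Γ Λ) :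
    StateTransition.Reaches (TM0.step M) (TM0.init l) c ↔ ∃ t, cfgs M l t = some c := by
  constructor
  · intro h
    induction h with
    | refl => exact ⟨0, rfl⟩
    | tail _ h2 ih =>
      obtain ⟨t, ht⟩ := ih
      exact ⟨t + 1, by rw [cfgs, ht]; exact h2⟩
  · rintro ⟨t, ht⟩
    induction t generalizing c with
    | zero => simp only [cfgs, Option.some.injEq] at ht; subst ht; exact Relation.ReflTransGen.refl
    | succ t ih =>
      simp only [cfgs, Option.bind_eq_some_iff] at ht
      obtain ⟨c0, h0, h1⟩ := ht
      exact Relation.ReflTransGen.tail (ih c0 h0) h1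

theorem step_none (M : TM0.Machine Γ Λ) (c : TM0.Cfg Γ Λ) :
    TM0.step M c = none ↔ M c.q c.Tape.head = none := by
  obtain ⟨q, T⟩ := c
  simp [TM0.step]

theorem halts_iff (M : TM0.Machine Γ Λ) (l : List Γ) :
    (TM0.eval M l).Dom ↔ ∃ t x, Hlt M (std M l t x) := by
  have e : (TM0.eval M l).Dom ↔ (StateTransition.eval (TM0.step M) (TM0.init l)).Dom := Iff.rfl
  rw [e]
  constructor
  · intro h
    obtain ⟨b, hb⟩ := Part.dom_iff_mem.1 h
    obtain ⟨h1, h2⟩ := StateTransition.mem_eval.1 hb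
    obtain ⟨t, ht⟩ := (cfgs_reaches M l b).1 h1
    obtain ⟨h, hh⟩ := std_cfgs M l t b ht
    refine ⟨t, h + t, ?_⟩
    rw [hh]
    refine ⟨by simp [tcel], ?_⟩
    rw [act_tcel _ _ (by ring)]
    exact (step_none _ _).1 h2
  · rintro ⟨t, x, hx⟩
    by_contra hd
    have : ∀ t, ∃ c, cfgs M l t = some c := by
      intro t
      induction t with
      | zero => exact ⟨_, rfl⟩
      | succ t ih =>
        obtain ⟨c, hc⟩ := ih
        rcases hs : TM0.step M c with _ | c'
        · exact (hd (Part.dom_iff_mem.2 ⟨c, StateTransition.mem_eval.2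
            ⟨(cfgs_reaches M l c).2 ⟨t, hc⟩, hs⟩⟩)).elim
        · exact ⟨c', by rw [cfgs, hc]; exact hs⟩
    obtain ⟨c, hc⟩ := this t
    obtain ⟨h, hh⟩ := std_cfgs M l t c hc
    rw [hh] at hx
    have hp : x - t = h := by
      by_contra hne
      have := hx.1
      simp [tcel, hne] at this
    have h2 := hx.2
    rw [act_tcel _ _ hp] at h2
    exact hd (Part.dom_iff_mem.2 ⟨c, StateTransition.mem_eval.2
            ⟨(cfgs_reaches M l c).2 ⟨t, hc⟩, (step_none _ _).2 h2⟩⟩)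

end Machine2

section Machine3
open Turing

instance fintypeK : Fintype PartrecToTM2.K' :=
  ⟨{.main, .rev, .aux, .stack}, by intro x; cases x <;> simp⟩

/-- The tape alphabet. -/
abbrev GG : Type := TM2to1.Γ' PartrecToTM2.K' (fun _ => PartrecToTM2.Γ')

/-- The input tape. -/
def inpT (n : ℕ) : List GG :=
  TM2to1.trInit (Γ := fun _ => PartrecToTM2.Γ') PartrecToTM2.K'.main (PartrecToTM2.trList [n])

/-- A finitely supported machine may be assumed to have finitely many states. -/
theorem finite_machine {Γ Λ : Type} [Inhabited Γ] [Inhabited Λ] (M : TM0.Machine Γ Λ) (S : Finset Λ)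
    (hS : TM0.Supports M (S : Set Λ)) : ∃ (Λ₂ : Type) (_ : Fintype Λ₂) (_ : Inhabited Λ₂)
      (M₂ : TM0.Machine Γ Λ₂), ∀ l, (TM0.eval M₂ l).Dom ↔ (TM0.eval M l).Dom := by
  classical
  let _ : Inhabited {q // q ∈ S} := ⟨⟨default, hS.1⟩⟩
  let g₁ : PointedMap Λ {q // q ∈ S} :=
    ⟨fun q => if h : q ∈ S then ⟨q, h⟩ else default, by
      have : (default : Λ) ∈ S := hS.1
      simp only [this, dif_pos]; rfl⟩
  let f : PointedMap Γ Γ := ⟨id, rfl⟩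
  refine ⟨{q // q ∈ S}, inferInstance, inferInstance, M.map f f g₁ Subtype.val, fun l => ?_⟩
  have R := TM0.Machine.map_respects M f f g₁ Subtype.val hS (fun _ => rfl) (by
    intro q hq
    have hq' : q ∈ S := hq
    show (if h : q ∈ S then (⟨q, h⟩ : {q // q ∈ S}) else default).1 = q
    rw [dif_pos hq'])
  have := StateTransition.tr_eval_dom R (a₁ := TM0.init l) (a₂ := TM0.init l) ⟨hS.1, by
    rw [TM0.map_init]; congr 1; exact List.map_id l⟩
  exact this

theorem code_machine (c : ToPartrec.Code) : ∃ (Λ : Type) (_ : Fintype Λ) (_ : Inhabited Λ)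
    (M : TM0.Machine GG Λ), ∀ n, (TM0.eval M (inpT n)).Dom ↔ (c.eval [n]).Dom := by
  let _ : Inhabited PartrecToTM2.Λ' := ⟨PartrecToTM2.trNormal c PartrecToTM2.Cont'.halt⟩
  have s2 : TM2.Supports (K := PartrecToTM2.K') (Γ := fun _ => PartrecToTM2.Γ') PartrecToTM2.tr
    (PartrecToTM2.codeSupp c PartrecToTM2.Cont'.halt) := PartrecToTM2.tr_supports c _
  have s1 := TM2to1.tr_supports _ s2
  have s0 := TM1to0.tr_supports _ s1
  obtain ⟨Λ, i1, i2, M, hM⟩ := finite_machine _ _ s0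
  refine ⟨Λ, i1, i2, M, fun n => ?_⟩
  rw [hM, TM1to0.tr_eval]
  refine (TM2to1.tr_eval_dom _ _ _).trans ?_
  have e := PartrecToTM2.tr_eval c [n]
  have e2 : (TM2.init PartrecToTM2.K'.main (PartrecToTM2.trList [n]) :
      TM2.Cfg (fun _ : PartrecToTM2.K' => PartrecToTM2.Γ') PartrecToTM2.Λ'
        (Option PartrecToTM2.Γ')) = PartrecToTM2.init c [n] := by
    rw [TM2.init, PartrecToTM2.init]
    congr 1
    funext k; cases k <;> rfl
  show (StateTransition.eval _ (TM2.init _ _)).Dom ↔ _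
  rw [e2, e]
  rfl

end Machine3

section Machine4
open Turing

instance primΓ : Primcodable PartrecToTM2.Γ' := Primcodable.ofEquiv _ (Fintype.equivFin PartrecToTM2.Γ')

instance primGG : Primcodable GG := Primcodable.ofEquiv _ (Fintype.equivFin GG)

theorem trNat_bit (b : Bool) (n : ℕ) (h : Nat.bit b n ≠ 0) : PartrecToTM2.trNat (Nat.bit b n) =
    (bif b then PartrecToTM2.Γ'.bit1 else PartrecToTM2.Γ'.bit0) :: PartrecToTM2.trNat n := by
  have e : ((Nat.bit b n : ℕ) : Num) = Num.bit b (n : Num) := by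
    rw [← Num.ofNat'_eq, Num.ofNat'_bit, Num.ofNat'_eq]
    cases b <;> rfl
  rw [PartrecToTM2.trNat, PartrecToTM2.trNat, e]
  rcases hn : (n : Num) with _ | p
  · have hn0 : n = 0 := by
      have : (n : Num) = 0 := hn
      exact_mod_cast this
    subst hn0
    cases b
    · exact (h rfl).elim
    · rfl
  · cases b <;> rfl

theorem prim_trNat : Primrec PartrecToTM2.trNat := by
  let g : Unit → List (List PartrecToTM2.Γ') → Option (List PartrecToTM2.Γ') := fun _ l =>
    if l.length = 0 then some [] else
      (l[l.length / 2]?).map fun r =>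
        (bif Nat.bodd l.length then PartrecToTM2.Γ'.bit1 else PartrecToTM2.Γ'.bit0) :: r
  have hg : Primrec₂ g := by
    have hl : Primrec fun p : Unit × List (List PartrecToTM2.Γ') => p.2.length :=
      Primrec.list_length.comp Primrec.snd
    refine Primrec.ite (Primrec.eq.comp hl (Primrec.const 0)) (Primrec.const _) ?_
    refine Primrec.option_map (Primrec.list_getElem?.comp Primrec.snd
      (Primrec.nat_div.comp hl (Primrec.const 2))) ?_
    refine Primrec.list_cons.comp ?_ Primrec.snd
    exact Primrec.cond (Primrec.nat_bodd.comp (hl.comp Primrec.fst)) (Primrec.const _)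
      (Primrec.const _)
  have := Primrec.nat_strong_rec (fun (_ : Unit) n => PartrecToTM2.trNat n) hg (by
    intro _ n
    simp only [g, List.length_map, List.length_range]
    by_cases hn : n = 0
    · subst hn; simp
    · rw [if_neg hn, List.getElem?_map, List.getElem?_range (by omega)]
      have e : n = Nat.bit (Nat.bodd n) (n / 2) := by
        rw [← Nat.div2_val]; exact (Nat.bit_bodd_div2 n).symm
      simp only [Option.map_some, Option.some.injEq]
      conv_rhs => rw [e]
      rw [trNat_bit _ _ (by rw [← e]; exact hn)])
  exact this.comp (Primrec.const ()) Primrec.id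

theorem prim_inpT : Primrec inpT := by
  have h1 : Primrec fun n => PartrecToTM2.trList [n] :=
    Primrec.list_append.comp prim_trNat (Primrec.const _)
  let em : PartrecToTM2.Γ' → GG := fun a =>
    (false, Function.update (fun _ => none) PartrecToTM2.K'.main (some a))
  let mk : GG → GG := fun x => (true, x.2)
  have h2 : Primrec fun n => (PartrecToTM2.trList [n]).reverse.map em :=
    primrec_mapW em (Primrec.list_reverse.comp h1) (Primrec.dom_finite em)
  have h3 : Primrec mk := Primrec.dom_finite mk
  have h4 : Primrec fun n => mk ((PartrecToTM2.trList [n]).reverse.map em).headI ::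
      ((PartrecToTM2.trList [n]).reverse.map em).tail :=
    Primrec.list_cons.comp (h3.comp (Primrec.list_headI.comp h2)) (Primrec.list_tail.comp h2)
  exact h4

theorem prim_mtiles {Λ : Type} [Fintype Λ] [Inhabited Λ] (M : TM0.Machine GG Λ)
    (code : Cel GG Λ → ℕ) : Primrec fun n => mtiles M code (inpT n) := by
  refine Primrec.list_append.comp ?_ (Primrec.const _)
  have hlen : Primrec fun n => (inpT n).length := Primrec.list_length.comp prim_inpT
  refine Primrec.list_map (Primrec.list_range.comp (Primrec.nat_add.comp hlen (Primrec.const 2))) ?_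
  have hi : Primrec fun p : ℕ × ℕ => p.2 := Primrec.snd
  have hl : Primrec fun p : ℕ × ℕ => (inpT p.1).length := hlen.comp Primrec.fst
  have hg : Primrec fun p : ℕ × ℕ => (inpT p.1).getD p.2 default :=
    (Primrec.list_getD default).comp (prim_inpT.comp Primrec.fst) Primrec.snd
  have hc0 : Primrec fun g : GG => code (g, some default) := Primrec.dom_finite _
  have hc1 : Primrec fun g : GG => code (g, none) := Primrec.dom_finite _
  have hc : Primrec fun p : ℕ × ℕ => code (cel0 (inpT p.1) p.2) := by
    refine (Primrec.ite (Primrec.eq.comp hi (Primrec.const 0)) (hc0.comp hg) (hc1.comp hg)).of_eq ?_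
    intro p
    simp only [cel0]
    split_ifs <;> rfl
  exact prim_mk hi (Primrec.nat_min.comp (Primrec.succ.comp hi) (Primrec.succ.comp hl))
    (Primrec.const 0) (Primrec.nat_add.comp (Primrec.const 1) hc)

theorem exists_code_inj {C : Type} [Fintype C] (b : C) :
    ∃ code : C → ℕ, code b = 0 ∧ Function.Injective code := by
  classical
  let e := Fintype.equivFin C
  refine ⟨fun c => if c = b then 0 else (e c).1 + 1, by simp, fun c c' h => ?_⟩
  by_cases h1 : c = b <;> by_cases h2 : c' = b <;> simp [h1, h2] at h ⊢
  · exact e.injective (Fin.ext h)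

/-- Every `Π⁰₁` problem reduces to the quadrant tiling problem. -/
theorem quad_reduction {β : Type} [Primcodable β] {B : β → Prop} (hB : Pi01 B) :
    ∃ w : β → List WT, Computable w ∧ (∀ b, B b → QuadAll (w b)) ∧
      ∀ b, (∀ m, QuadSq (w b) m) → B b := by
  obtain ⟨f, hf, hBf⟩ := hB
  -- the search for a counterexample, as a partial recursive function on numbers
  let p : ℕ → ℕ → Bool := fun x n =>
    match (Encodable.decode x : Option β) with
    | some b => !(f b n)
    | none => false
  have hp : Computable₂ p := by
    have h1 : Computable fun q : ℕ × ℕ => (Encodable.decode q.1 : Option β) :=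
      Computable.decode.comp Computable.fst
    have h2 : Computable₂ fun (q : ℕ × ℕ) (b : β) => !(f b q.2) :=
      (Primrec.not.to_comp.comp (hf.comp Computable.snd (Computable.snd.comp Computable.fst)))
    refine (Computable.option_casesOn h1 (Computable.const false) h2).of_eq ?_
    rintro ⟨x, n⟩
    simp only [p]
    rcases (Encodable.decode x : Option β) with _ | b <;> rfl
  have hr : Partrec fun x : ℕ => Nat.rfind fun n => Part.some (p x n) :=
    Partrec.rfind hp.partrec₂
  have hr' : Nat.Partrec' fun v : List.Vector ℕ 1 => Nat.rfind fun n => Part.some (p v.head n) :=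
    Nat.Partrec'.of_part (hr.comp (Primrec.vector_head.to_comp))
  obtain ⟨c, hc⟩ := ToPartrec.Code.exists_code hr'
  obtain ⟨Λ, i1, i2, M, hM⟩ := code_machine c
  obtain ⟨code, h0, hinj⟩ := exists_code_inj ((default, none) : Cel GG Λ)
  have key : ∀ b, B b ↔ ∀ t x, ¬ Hlt M (std M (inpT (Encodable.encode b)) t x) := by
    intro b
    have h1 := hM (Encodable.encode b)
    rw [halts_iff] at h1
    have h2 := hc ⟨[Encodable.encode b], rfl⟩
    have h3 : (c.eval [Encodable.encode b]).Dom ↔ ¬ B b := by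
      rw [show c.eval [Encodable.encode b] = _ from h2, hBf]
      show (Nat.rfind fun n => Part.some (p (Encodable.encode b) n)).Dom ↔ _
      have hpb : ∀ n, p (Encodable.encode b) n = !(f b n) := by
        intro n; simp only [p, Encodable.encodek]
      refine Nat.rfind_dom.trans ?_
      constructor
      · rintro ⟨n, hn, -⟩ hall
        have hn' : true = p (Encodable.encode b) n := Part.mem_some_iff.1 hn
        rw [hpb, hall n] at hn'
        simp at hn'
      · intro hnot
        push Not at hnot
        obtain ⟨n, hn⟩ := hnot
        refine ⟨n, ?_, fun _ => trivial⟩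
        refine Part.mem_some_iff.2 ?_
        rw [hpb]
        simp at hn
        simp [hn]
    rw [h3] at h1
    constructor
    · intro hb t x hx
      exact (h1.1 ⟨t, x, hx⟩) hb
    · intro hall
      by_contra hb
      obtain ⟨t, x, hx⟩ := h1.2 hb
      exact hall t x hx
  refine ⟨fun b => mtiles M code (inpT (Encodable.encode b)), ?_, ?_, ?_⟩
  · exact ((prim_mtiles M code).comp Primrec.encode).to_comp
  · intro b hb
    exact mtiles_complete h0 ((key b).1 hb)
  · intro b hall
    exact (key b).2 (mtiles_sound h0 hinj hall)

end Machine4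

theorem pi01Hard_domino (k : ℕ) (shapes : Fin k → Rhombus)
    (hval : ∀ i, (shapes i).IsValid)
    (X : Set (Set Rhombus)) (hsub : IsSubshift (Set.range shapes) X)
    (hne : X.Nonempty) : Pi01Hard (DominoPred shapes X) := by
  intro β _ B hB
  obtain ⟨w, hw, h1, h2⟩ := quad_reduction hB
  refine ⟨fun b => lift shapes (hier (w b)),
    (prim_lift shapes).to_comp.comp (prim_hier.to_comp.comp hw), fun b => ⟨fun hb => ?_, fun hd => ?_⟩⟩
  · exact lift_complete hval hsub.1 hne (hier_complete (h1 b hb))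
  · exact h2 b (hier_sound (tilesZ_of_sq _ fun n => lift_sound hval hsub.1 hd n))

theorem not_computable_of_hard {α : Type} [Primcodable α] {A : α → Prop} (h : Pi01Hard A) :
    ¬ ComputablePred A := by
  intro hA
  have hP : Pi01 fun c : Nat.Partrec.Code => ¬ (c.eval 0).Dom := by
    refine ⟨fun c n => (Nat.Partrec.Code.evaln n c 0).isNone, ?_, fun c => ?_⟩
    · have h1 : Primrec fun p : Nat.Partrec.Code × ℕ => Nat.Partrec.Code.evaln p.2 p.1 0 :=
        Nat.Partrec.Code.primrec_evaln.comp
          ((Primrec.snd.pair Primrec.fst).pair (Primrec.const 0))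
      have h2 : Primrec fun p : Nat.Partrec.Code × ℕ =>
          (Nat.Partrec.Code.evaln p.2 p.1 0).isNone :=
        (Primrec.not.comp (Primrec.option_isSome.comp h1)).of_eq fun p => by
          cases Nat.Partrec.Code.evaln p.2 p.1 0 <;> rfl
      exact h2.to_comp
    · constructor
      · intro hd n
        rcases e : Nat.Partrec.Code.evaln n c 0 with _ | y
        · show (Nat.Partrec.Code.evaln n c 0).isNone = true
          rw [e]; rfl
        · exact (hd (Part.dom_iff_mem.2 ⟨y, Nat.Partrec.Code.evaln_sound (by rw [e]; rfl)⟩)).elim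
      · intro hall hd
        obtain ⟨y, hy⟩ := Part.dom_iff_mem.1 hd
        obtain ⟨n, hn⟩ := Nat.Partrec.Code.evaln_complete.1 hy
        have : (Nat.Partrec.Code.evaln n c 0).isNone = true := hall n
        rw [Option.mem_def.1 hn] at this
        simp at this
  have := ComputablePred.computable_of_manyOneReducible (h _ _ hP) hA
  refine ComputablePred.halting_problem 0 ?_
  exact this.not.of_eq fun c => by simp

/-- For any non-empty subshift `X` of edge-to-edge rhombus
tilings, `Domino(X)` is `Π⁰₁`-hard, and therefore undecidable. -/
theorem statement_13 (k : ℕ) (shapes : Fin k → Rhombus)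
    (hval : ∀ i, (shapes i).IsValid)
    (X : Set (Set Rhombus)) (hsub : IsSubshift (Set.range shapes) X)
    (hne : X.Nonempty) :
    Pi01Hard (DominoPred shapes X) ∧ ¬ ComputablePred (DominoPred shapes X) := by
  exact ⟨pi01Hard_domino k shapes hval X hsub hne,
    not_computable_of_hard (pi01Hard_domino k shapes hval X hsub hne)⟩
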